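/- arXiv:1109.4675 — 3 statements merged into one kernel-verified Lean document; each statement's English description precedes it below -/
import Mathlib

section
/- Every 2-connected graph G on n vertices contains a cycle that passes through every vertex of degree at least n/2. -/
open SimpleGraph

/-- A graph is 2-connected if it has at least 3 vertices and deleting any vertex
leaves a connected graph. -/
def TwoConnected {V : Type*} [Fintype V] (G : SimpleGraph V) : Prop :=
  3 ≤ Fintype.card V ∧ ∀ v : V, (G.induce {u | u ≠ v}).Connected

namespace SimpleGraph

variable {V : Type*} {G : SimpleGraph V}

theorem Walk.IsPath.isCycle_cons {u v : V} {p : G.Walk u v} (hp : p.IsPath)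
    (hl : 2 ≤ p.length) (h : G.Adj v u) : (Walk.cons h p).IsCycle := by
  rw [Walk.cons_isCycle_iff]
  refine ⟨hp, fun hmem ↦ ?_⟩
  have := hp.length_eq_one_of_mem_edges (Sym2.eq_swap ▸ hmem)
  omega

theorem Walk.IsPath.exists_common_neighbor_or_crossing [Fintype V] [DecidableRel G.Adj]
    {u v : V} {p : G.Walk u v} (hp : p.IsPath)
    (hdeg : Fintype.card V ≤ G.degree u + G.degree v) :
    (∃ x ∉ p.support, G.Adj u x ∧ G.Adj v x) ∨
      ∃ i < p.length, G.Adj v (p.getVert i) ∧ G.Adj u (p.getVert (i + 1)) := by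
  classical
  have hidx : ∀ x, ∃ n, x ∈ p.support → p.getVert n = x ∧ n ≤ p.length := by
    intro x
    by_cases hx : x ∈ p.support
    · obtain ⟨n, hn⟩ := Walk.mem_support_iff_exists_getVert.1 hx
      exact ⟨n, fun _ ↦ hn⟩
    · exact ⟨0, fun h ↦ (hx h).elim⟩
  choose idx hidx using hidx
  have hlt : ∀ x ∈ p.support, x ≠ v → idx x < p.length := by
    intro x hx hxv
    refine lt_of_le_of_ne (hidx x hx).2 fun h ↦ hxv ?_
    rw [← (hidx x hx).1, h, Walk.getVert_length]
  -- The successor map along `p`, extended by the identity off `p`.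
  let φ : V → V := fun x ↦ if x ∈ p.support then p.getVert (idx x + 1) else x
  have hφ_pos : ∀ x ∈ p.support, φ x = p.getVert (idx x + 1) := fun x hx ↦ if_pos hx
  have hφ_neg : ∀ x ∉ p.support, φ x = x := fun x hx ↦ if_neg hx
  have hφ_mem : ∀ x, φ x ∈ p.support ↔ x ∈ p.support := by
    intro x
    by_cases hx : x ∈ p.support
    · simp [hφ_pos x hx, hx, Walk.getVert_mem_support]
    · simp [hφ_neg x hx, hx]
  have hinj : Set.InjOn φ {x | x ≠ v} := by
    intro x hx y hy hxy
    by_cases hxp : x ∈ p.support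
    · have hyp : y ∈ p.support := by rwa [← hφ_mem, ← hxy, hφ_mem]
      rw [hφ_pos x hxp, hφ_pos y hyp] at hxy
      have := hp.getVert_injOn (Nat.succ_le_of_lt (hlt x hxp hx))
        (Nat.succ_le_of_lt (hlt y hyp hy)) hxy
      rw [← (hidx x hxp).1, ← (hidx y hyp).1, Nat.succ_injective this]
    · have hyp : y ∉ p.support := by rwa [← hφ_mem, ← hxy, hφ_mem]
      rwa [hφ_neg x hxp, hφ_neg y hyp] at hxy
  have hφu : ∀ x, x ≠ v → φ x ≠ u := by
    intro x hx h
    have hxp : x ∈ p.support := by rw [← hφ_mem, h]; exact p.start_mem_support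
    rw [hφ_pos x hxp] at h
    have := hp.getVert_injOn (Nat.succ_le_of_lt (hlt x hxp hx)) (Nat.zero_le _)
      (h.trans p.getVert_zero.symm)
    omega
  have hne : ∀ x ∈ G.neighborFinset v, x ≠ v := fun x hx ↦
    ((G.mem_neighborFinset v x).1 hx).ne'
  have hcard : ((G.neighborFinset v).image φ).card = G.degree v :=
    Finset.card_image_of_injOn fun x hx y hy ↦ hinj (hne x hx) (hne y hy)
  have hnd : ¬ Disjoint (G.neighborFinset u) ((G.neighborFinset v).image φ) := by
    intro hd
    have hsub : G.neighborFinset u ∪ (G.neighborFinset v).image φ ⊆ Finset.univ.erase u := by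
      intro y hy
      refine Finset.mem_erase.2 ⟨?_, Finset.mem_univ y⟩
      rcases Finset.mem_union.1 hy with hy | hy
      · exact ((G.mem_neighborFinset u y).1 hy).ne'
      · obtain ⟨x, hx, rfl⟩ := Finset.mem_image.1 hy
        exact hφu x (hne x hx)
    have hle := Finset.card_le_card hsub
    rw [Finset.card_union_of_disjoint hd, hcard, card_neighborFinset_eq_degree,
      Finset.card_erase_of_mem (Finset.mem_univ u), Finset.card_univ] at hle
    have := Fintype.card_pos_iff.2 ⟨u⟩
    omega
  obtain ⟨y, hyu, hyv⟩ := Finset.not_disjoint_iff.1 hnd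
  obtain ⟨x, hx, rfl⟩ := Finset.mem_image.1 hyv
  have hvx := (G.mem_neighborFinset v x).1 hx
  have hux := (G.mem_neighborFinset u _).1 hyu
  by_cases hxp : x ∈ p.support
  · refine .inr ⟨idx x, hlt x hxp (hne x hx), ?_, ?_⟩
    · rwa [(hidx x hxp).1]
    · rwa [← hφ_pos x hxp]
  · exact .inl ⟨x, hxp, by rwa [hφ_neg x hxp] at hux, hvx⟩

/-- Ore's argument: a path whose nonadjacent ends have large degree sum closes up to a cycle. -/
theorem Walk.IsPath.exists_isCycle_of_card_le_degree_add_degree [Fintype V] [DecidableRel G.Adj]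
    {u v : V} {p : G.Walk u v} (hp : p.IsPath) (hl : 2 ≤ p.length)
    (hdeg : Fintype.card V ≤ G.degree u + G.degree v) :
    ∃ (a : V) (c : G.Walk a a), c.IsCycle ∧ ∀ x ∈ p.support, x ∈ c.support := by
  rcases hp.exists_common_neighbor_or_crossing hdeg with ⟨x, hx, hux, hvx⟩ | ⟨i, hi, hvi, hui⟩
  · refine ⟨_, _, (hp.concat hx hvx).isCycle_cons (by simp; omega) hux.symm, fun y hy ↦ ?_⟩
    simp [Walk.support_concat, hy]
  · by_cases huv : G.Adj v u
    · exact ⟨_, _, hp.isCycle_cons hl huv, fun y hy ↦ by simp [hy]⟩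
    have hi0 : i ≠ 0 := by
      rintro rfl
      exact huv (by simpa using hvi)
    let q := (p.drop (i + 1)).append (Walk.cons hvi (p.take i).reverse)
    have hq_support : q.support = p.support.drop (i + 1) ++ (p.support.take (i + 1)).reverse := by
      simp [q, Walk.support_append, Walk.support_take, show i + 1 ≤ p.length from hi]
    have hperm : q.support.Perm p.support := by
      rw [hq_support]
      refine ((List.reverse_perm _).append_left _).trans (List.perm_append_comm.trans ?_)
      rw [List.take_append_drop]
    have hq : q.IsPath := by
      rw [Walk.isPath_def, hperm.nodup_iff]
      exact hp.support_nodup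
    have hql : 2 ≤ q.length := by
      have := hperm.length_eq
      simp only [Walk.length_support] at this
      omega
    exact ⟨_, _, hq.isCycle_cons hql hui, fun y hy ↦ by simp [hperm.mem_iff.2 hy]⟩

theorem exists_isPath_support_of_isClique {s : Finset V} (hs : s.Nonempty)
    (hc : G.IsClique (s : Set V)) :
    ∃ (u v : V) (p : G.Walk u v), p.IsPath ∧ p.length + 1 = s.card ∧ ∀ x, x ∈ p.support ↔ x ∈ s := by
  classical
  induction hs using Finset.Nonempty.cons_induction with
  | singleton a => exact ⟨a, a, Walk.nil, Walk.IsPath.nil, by simp, by simp⟩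
  | cons a s ha hs ih =>
    obtain ⟨u, v, p, hp, hl, hmem⟩ := ih (hc.subset (by simp))
    have hau : G.Adj a u := by
      have hu : u ∈ s := (hmem u).1 p.start_mem_support
      exact hc (by simp) (by simp [hu]) (by rintro rfl; exact ha hu)
    exact ⟨a, v, Walk.cons hau p, hp.cons (by rwa [hmem]), by rw [Walk.length_cons, hl, Finset.card_cons],
      by simp [hmem]⟩

theorem exists_isCycle_of_isClique {s : Finset V} (hs : 3 ≤ s.card)
    (hc : G.IsClique (s : Set V)) :
    ∃ (a : V) (c : G.Walk a a), c.IsCycle ∧ ∀ x ∈ s, x ∈ c.support := by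
  obtain ⟨u, v, p, hp, hl, hmem⟩ :=
    exists_isPath_support_of_isClique (Finset.card_pos.1 (by omega)) hc
  have huv : v ≠ u := by
    rintro rfl
    rw [(Walk.isPath_iff_nil.1 hp).length_eq_zero] at hl
    omega
  have hadj : G.Adj v u := hc (by simp [← hmem]) (by simp [← hmem]) huv
  exact ⟨_, _, hp.isCycle_cons (by omega) hadj, fun x hx ↦ by simp [(hmem x).2 hx]⟩

/-- A cycle of `G ⊔ edge u v` either is a cycle of `G` or yields a path of `G` from `u` to `v`. -/
theorem exists_isCycle_or_isPath_of_sup_edge {u v b : V} {c : (G ⊔ edge u v).Walk b b}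
    (hc : c.IsCycle) :
    (∃ (a : V) (d : G.Walk a a), d.IsCycle ∧ ∀ x ∈ c.support, x ∈ d.support) ∨
      ∃ p : G.Walk u v, p.IsPath ∧ 2 ≤ p.length ∧ ∀ x ∈ c.support, x ∈ p.support := by
  classical
  have hG : ∀ e ∈ (G ⊔ edge u v).edgeSet, e ≠ s(u, v) → e ∈ G.edgeSet := by
    intro e
    induction e with | h x y
    intro he hne
    simp only [mem_edgeSet, sup_adj, edge_adj] at he ⊢
    rcases he with he | ⟨⟨rfl, rfl⟩ | ⟨rfl, rfl⟩, -⟩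
    · exact he
    · exact (hne rfl).elim
    · exact (hne Sym2.eq_swap).elim
  by_cases he : s(u, v) ∈ c.edges
  · right
    have hu : u ∈ c.support := c.fst_mem_support_of_mem_edges he
    have hr : (c.rotate u hu).IsCycle := (Walk.isCycle_rotate hu).2 hc
    have her : s(u, v) ∈ (c.rotate u hu).edges := (c.rotate_edges u hu).mem_iff.2 he
    obtain ⟨d, hd, hsnd, hverts⟩ := hr.exists_isCycle_snd_verts_eq (w := v)
      (by rwa [← Subgraph.mem_edgeSet, Walk.mem_edges_toSubgraph])
    have hsupp : ∀ x ∈ c.support, x ∈ d.support := by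
      intro x hx
      rw [← Walk.mem_verts_toSubgraph, hverts, Walk.mem_verts_toSubgraph]
      exact (Walk.mem_support_rotate_iff c u hu).2 hx
    cases d with
    | nil => simp at hd
    | cons h q =>
      simp only [Walk.snd_cons] at hsnd
      subst hsnd
      have hl := hd.three_le_length
      rw [Walk.cons_isCycle_iff] at hd
      have hqG : ∀ e ∈ q.edges, e ∈ G.edgeSet := fun e heq ↦
        hG e (q.edges_subset_edgeSet heq) fun h ↦ hd.2 (h ▸ heq)
      refine ⟨(q.transfer G hqG).reverse, (hd.1.transfer hqG).reverse, ?_, fun x hx ↦ ?_⟩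
      · simpa using hl
      · have := hsupp x hx
        simp only [Walk.support_cons, List.mem_cons] at this
        rcases this with rfl | this
        · simp
        · simpa using this
  · left
    have hcG : ∀ e ∈ c.edges, e ∈ G.edgeSet := fun e hec ↦
      hG e (c.edges_subset_edgeSet hec) fun h ↦ he (h ▸ hec)
    exact ⟨b, c.transfer G hcG, hc.transfer hcG, fun x hx ↦ by simpa using hx⟩

theorem exists_isCycle_of_three_le_card [Fintype V] (G : SimpleGraph V)
    [inst : DecidableRel G.Adj] {s : Finset V} (hs : 3 ≤ s.card)
    (hdeg : ∀ v ∈ s, Fintype.card V ≤ 2 * G.degree v) :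
    ∃ (a : V) (c : G.Walk a a), c.IsCycle ∧ ∀ x ∈ s, x ∈ c.support := by
  classical
  revert inst
  induction G using WellFoundedGT.induction with | ind G ih
  intro _ hdeg
  by_cases hc : G.IsClique (s : Set V)
  · exact exists_isCycle_of_isClique hs hc
  obtain ⟨u, hu, v, hv, huv, hadj⟩ : ∃ u ∈ s, ∃ v ∈ s, u ≠ v ∧ ¬ G.Adj u v := by
    simpa [isClique_iff, Set.Pairwise] using hc
  obtain ⟨b, c, hc, hsc⟩ := ih _ (G.lt_sup_edge u v huv hadj)
    fun w hw ↦ (hdeg w hw).trans (Nat.mul_le_mul_left 2 (degree_le_of_le le_sup_left))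
  rcases exists_isCycle_or_isPath_of_sup_edge hc with ⟨a, d, hd, hcd⟩ | ⟨p, hp, hl, hcp⟩
  · exact ⟨a, d, hd, fun x hx ↦ hcd x (hsc x hx)⟩
  · obtain ⟨a, d, hd, hpd⟩ := hp.exists_isCycle_of_card_le_degree_add_degree hl
      (by have := hdeg u hu; have := hdeg v hv; omega)
    exact ⟨a, d, hd, fun x hx ↦ hpd x (hcp x (hsc x hx))⟩

end SimpleGraph

namespace TwoConnected

variable {V : Type*} [Fintype V] {G : SimpleGraph V}

theorem exists_adj_ne (hG : TwoConnected G) (u w : V) : ∃ x, G.Adj u x ∧ x ≠ w := by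
  classical
  have key : ∀ w, w ≠ u → ∃ x, G.Adj u x ∧ x ≠ w := by
    intro w hw
    obtain ⟨y, hy⟩ : ∃ y, y ∉ ({u, w} : Finset V) := by
      by_contra! h
      have h1 := Finset.card_le_card (fun y _ ↦ h y : Finset.univ ⊆ ({u, w} : Finset V))
      have h2 := Finset.card_le_two (a := u) (b := w)
      have := hG.1
      rw [Finset.card_univ] at h1
      omega
    simp only [Finset.mem_insert, Finset.mem_singleton, not_or] at hy
    have : Nontrivial {x | x ≠ w} := ⟨⟨u, hw.symm⟩, ⟨y, hy.2⟩, by simpa using Ne.symm hy.1⟩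
    obtain ⟨x, hx⟩ := (hG.2 w).preconnected.exists_adj_of_nontrivial ⟨u, hw.symm⟩
    exact ⟨x, hx, x.2⟩
  by_cases hw : w = u
  · subst hw
    have : Nontrivial V := Fintype.one_lt_card_iff_nontrivial.1 (by have := hG.1; omega)
    obtain ⟨y, hy⟩ := exists_ne w
    obtain ⟨x, hx, -⟩ := key y hy
    exact ⟨x, hx, hx.ne'⟩
  · exact key w hw

theorem exists_isCycle_of_adj (hG : TwoConnected G) {u v : V} (huv : G.Adj u v) :
    ∃ (a : V) (c : G.Walk a a), c.IsCycle ∧ u ∈ c.support ∧ v ∈ c.support := by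
  classical
  obtain ⟨x, hux, hxv⟩ := hG.exists_adj_ne u v
  obtain ⟨p, hp⟩ := (hG.2 u).exists_isPath ⟨x, hux.ne'⟩ ⟨v, huv.ne'⟩
  let q : G.Walk x v := p.map (Embedding.induce _).toHom
  have hq : q.IsPath := hp.map Subtype.val_injective
  have huq : u ∉ q.support := by
    intro h
    obtain ⟨y, -, hy⟩ := List.mem_map.1 (Walk.support_map _ p ▸ h)
    exact y.2 hy
  have hql : q.length ≠ 0 := fun h ↦ hxv (Walk.eq_of_length_eq_zero h)
  refine ⟨_, _, (hq.cons huq (h := hux)).isCycle_cons ?_ huv.symm, by simp, by simp⟩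
  simp only [Walk.length_cons]
  omega

theorem exists_isCycle_of_card_le_degree_add_degree [DecidableRel G.Adj] (hG : TwoConnected G)
    {u v : V} (huv : u ≠ v) (hdeg : Fintype.card V ≤ G.degree u + G.degree v) :
    ∃ (a : V) (c : G.Walk a a), c.IsCycle ∧ u ∈ c.support ∧ v ∈ c.support := by
  classical
  by_cases hadj : G.Adj u v
  · exact hG.exists_isCycle_of_adj hadj
  obtain ⟨x, hux, hvx⟩ : ∃ x, G.Adj u x ∧ G.Adj v x := by
    by_contra! h
    have hd : Disjoint (G.neighborFinset u) (G.neighborFinset v) := by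
      rw [Finset.disjoint_left]
      intro x hx hx'
      exact h x ((G.mem_neighborFinset u x).1 hx) ((G.mem_neighborFinset v x).1 hx')
    have hsub : G.neighborFinset u ∪ G.neighborFinset v ⊆ Finset.univ.erase u := by
      intro y hy
      refine Finset.mem_erase.2 ⟨?_, Finset.mem_univ y⟩
      rintro rfl
      simp [G.adj_comm v, hadj] at hy
    have hle := Finset.card_le_card hsub
    rw [Finset.card_union_of_disjoint hd, card_neighborFinset_eq_degree,
      card_neighborFinset_eq_degree, Finset.card_erase_of_mem (Finset.mem_univ u),
      Finset.card_univ] at hle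
    have := Fintype.card_pos_iff.2 ⟨u⟩
    omega
  have hp : (Walk.cons hux (Walk.cons hvx.symm Walk.nil)).IsPath := by
    simp [hux.ne, hvx.ne', huv]
  obtain ⟨a, c, hc, hpc⟩ := hp.exists_isCycle_of_card_le_degree_add_degree (by simp) hdeg
  exact ⟨a, c, hc, hpc u (by simp), hpc v (by simp)⟩

end TwoConnected

theorem stmt_0 {V : Type*} [Fintype V] [DecidableEq V] (G : SimpleGraph V)
    [DecidableRel G.Adj] (hG : TwoConnected G) :
    ∃ (a : V) (c : G.Walk a a), c.IsCycle ∧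
      ∀ v : V, Fintype.card V ≤ 2 * G.degree v → v ∈ c.support := by
  let s : Finset V := {v | Fintype.card V ≤ 2 * G.degree v}
  have hs : ∀ v, v ∈ s ↔ Fintype.card V ≤ 2 * G.degree v := by simp [s]
  simp only [← hs]
  by_cases h3 : 3 ≤ s.card
  · exact exists_isCycle_of_three_le_card G h3 fun v ↦ (hs v).1
  have hsmall : ∃ u v, (∀ x ∈ s, x = u ∨ x = v) ∧
      (G.Adj u v ∨ u ≠ v ∧ Fintype.card V ≤ G.degree u + G.degree v) := by
    rcases s.eq_empty_or_nonempty with h0 | ⟨u, hu⟩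
    · obtain ⟨u⟩ : Nonempty V := Fintype.card_pos_iff.1 (by have := hG.1; omega)
      obtain ⟨v, huv, -⟩ := hG.exists_adj_ne u u
      exact ⟨u, v, by simp [h0], .inl huv⟩
    · by_cases h : ∃ v ∈ s, v ≠ u
      · obtain ⟨v, hv, hvu⟩ := h
        refine ⟨u, v, fun x hx ↦ ?_, .inr ⟨hvu.symm, ?_⟩⟩
        · by_contra! hne
          have := Finset.two_lt_card.2 ⟨u, hu, v, hv, x, hx, hvu.symm, hne.1.symm, hne.2.symm⟩
          omega
        · have := (hs u).1 hu
          have := (hs v).1 hv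
          omega
      · push Not at h
        obtain ⟨v, huv, -⟩ := hG.exists_adj_ne u u
        exact ⟨u, v, fun x hx ↦ .inl (h x hx), .inl huv⟩
  obtain ⟨u, v, hsub, huv⟩ := hsmall
  obtain ⟨a, c, hc, huc, hvc⟩ :
      ∃ (a : V) (c : G.Walk a a), c.IsCycle ∧ u ∈ c.support ∧ v ∈ c.support := by
    rcases huv with huv | ⟨hne, hdeg⟩
    · exact hG.exists_isCycle_of_adj huv
    · exact hG.exists_isCycle_of_card_le_degree_add_degree hne hdeg
  exact ⟨a, c, hc, fun x hx ↦ by rcases hsub x hx with rfl | rfl <;> assumption⟩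
end

section
/- Let G be a 2-connected graph on n vertices such that every induced subgraph of G isomorphic to K_{1,4} contains two nonadjacent vertices whose degree sum in G is at least n. Then every longest cycle of G contains all vertices of degree at least n/2. -/
open SimpleGraph

/-- `PathOn G u w S`: the graph `G` has a path from `u` to `w` whose vertex set is exactly `S`. -/
inductive PathOn {V : Type*} [DecidableEq V] (G : SimpleGraph V) : V → V → Finset V → Prop
  | single (u : V) : PathOn G u u {u}
  | cons {u v w : V} {S : Finset V} :
      G.Adj u v → u ∉ S → PathOn G v w S → PathOn G u w (insert u S)

/-- `CycleOn G S`: the graph `G` has a cycle whose vertex set is exactly `S`. -/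
def CycleOn {V : Type*} [DecidableEq V] (G : SimpleGraph V) (S : Finset V) : Prop :=
  3 ≤ S.card ∧ ∃ u w, PathOn G u w S ∧ G.Adj w u

namespace PathOn

variable {V : Type*} [DecidableEq V] {G : SimpleGraph V} {u w x : V} {S T : Finset V}

theorem left_mem (h : PathOn G u w S) : u ∈ S := by
  cases h <;> simp

theorem right_mem (h : PathOn G u w S) : w ∈ S := by
  induction h <;> simp [*]

theorem eq_singleton (h : PathOn G u u S) : S = {u} := by
  cases h with
  | single => rfl
  | cons hadj hu h => exact absurd h.right_mem hu

theorem append {u' w' : V} (h : PathOn G u w S) (hadj : G.Adj w u') (h' : PathOn G u' w' T)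
    (hd : Disjoint S T) : PathOn G u w' (S ∪ T) := by
  induction h with
  | single u =>
    rw [← Finset.insert_eq]
    exact cons hadj (by simpa using hd) h'
  | cons huv hu _ ih =>
    rw [Finset.disjoint_insert_left] at hd
    rw [Finset.insert_union]
    exact cons huv (by simp [hu, hd.1]) (ih hadj hd.2)

theorem symm (h : PathOn G u w S) : PathOn G w u S := by
  induction h with
  | single u => exact single u
  | @cons u v w S huv hu _ ih =>
    rw [Finset.insert_eq, Finset.union_comm]
    exact ih.append huv.symm (single u) (by simpa using hu)

/-- A path can be cut in front of any of its vertices. -/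
theorem exists_suffix (h : PathOn G u w S) (hx : x ∈ S) :
    ∃ S₂, PathOn G x w S₂ ∧ ((x = u ∧ S₂ = S) ∨
      ∃ S₁ t, PathOn G u t S₁ ∧ G.Adj t x ∧ Disjoint S₁ S₂ ∧ S = S₁ ∪ S₂) := by
  induction h with
  | single u =>
    obtain rfl : x = u := by simpa using hx
    exact ⟨_, single x, Or.inl ⟨rfl, rfl⟩⟩
  | @cons u v w S huv hu h ih =>
    by_cases hxu : x = u
    · subst hxu
      exact ⟨_, cons huv hu h, Or.inl ⟨rfl, rfl⟩⟩
    · obtain ⟨S₂, h₂, ⟨rfl, rfl⟩ | ⟨S₁, t, h₁, htx, hd, rfl⟩⟩ := ih (by simpa [hxu] using hx)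
      · exact ⟨_, h₂, Or.inr ⟨{u}, u, single u, huv, by simpa using hu,
          Finset.insert_eq _ _⟩⟩
      · refine ⟨S₂, h₂, Or.inr ⟨insert u S₁, t, cons huv (by simp_all) h₁, htx, ?_, by simp⟩⟩
        rw [Finset.disjoint_insert_left]
        exact ⟨by simp_all, hd⟩

theorem exists_subpath (h : PathOn G u w S) (hx : x ∈ S) : ∃ S₂ ⊆ S, PathOn G x w S₂ := by
  obtain ⟨S₂, h₂, ⟨_, rfl⟩ | ⟨S₁, t, -, -, -, rfl⟩⟩ := h.exists_suffix hx
  · exact ⟨_, subset_rfl, h₂⟩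
  · exact ⟨_, Finset.subset_union_right, h₂⟩

theorem exists_erase (h : PathOn G u w S) (hne : u ≠ w) :
    ∃ p, G.Adj u p ∧ PathOn G p w (S.erase u) := by
  cases h with
  | single => exact absurd rfl hne
  | @cons _ p _ S huv hu h => exact ⟨p, huv, by rwa [Finset.erase_insert hu]⟩

/-- The part of a path after the last vertex in `B`. -/
theorem exists_last_mem (B : Finset V) (h : PathOn G u w S) (hB : ∃ x ∈ S, x ∈ B) :
    ∃ b ∈ B, ∃ T ⊆ S, PathOn G b w T ∧ ∀ x ∈ T, x ∈ B → x = b := by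
  induction h with
  | single u => exact ⟨u, by simpa using hB, _, subset_rfl, single u, by simp⟩
  | @cons u v w S huv hu h ih =>
    by_cases hS : ∃ x ∈ S, x ∈ B
    · obtain ⟨b, hb, T, hT, h1, h2⟩ := ih hS
      exact ⟨b, hb, T, hT.trans (Finset.subset_insert _ _), h1, h2⟩
    · push Not at hS
      refine ⟨u, ?_, _, subset_rfl, cons huv hu h, ?_⟩
      · obtain ⟨x, hx, hxB⟩ := hB
        rcases Finset.mem_insert.1 hx with rfl | hx
        · exact hxB
        · exact absurd hxB (hS x hx)
      · intro x hx hxB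
        rcases Finset.mem_insert.1 hx with rfl | hx
        · rfl
        · exact absurd hxB (hS x hx)

/-- The part of a path from the first vertex in `N` on. -/
theorem exists_first_mem (N : Finset V) (h : PathOn G u w S) (hw : w ∈ N) :
    ∃ a ∈ N, ∃ T ⊆ S, PathOn G a w T ∧ ∀ x ∈ S, x ∈ N → x ∈ T := by
  induction h with
  | single u => exact ⟨u, hw, _, subset_rfl, single u, by simp⟩
  | @cons u v w S huv hu h ih =>
    by_cases hN : u ∈ N
    · exact ⟨u, hN, _, subset_rfl, cons huv hu h, fun _ hx _ => hx⟩
    · obtain ⟨a, ha, T, hT, h1, h2⟩ := ih hw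
      refine ⟨a, ha, T, hT.trans (Finset.subset_insert _ _), h1, ?_⟩
      intro x hx hxN
      rcases Finset.mem_insert.1 hx with rfl | hx
      · exact absurd hxN hN
      · exact h2 x hx hxN

/-- Two paths with common ends and no other common vertex form a cycle. -/
theorem cycleOn_union (h : PathOn G u w S) (h' : PathOn G w u T) (hne : u ≠ w)
    (hST : ∀ x ∈ S, x ∈ T → x = u ∨ x = w) (hcard : 3 ≤ (S ∪ T).card) : CycleOn G (S ∪ T) := by
  obtain ⟨p, hwp, hp⟩ := h'.exists_erase hne.symm
  by_cases hpu : p = u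
  · subst hpu
    have hT := hp.eq_singleton
    have : S ∪ T = S := by
      rw [Finset.union_eq_left]
      intro x hx
      by_cases hxw : x = w
      · exact hxw ▸ h.right_mem
      · have : x ∈ T.erase w := by simp [hx, hxw]
        rw [hT] at this
        rw [Finset.mem_singleton.1 this]
        exact h.left_mem
    rw [this] at hcard ⊢
    exact ⟨hcard, _, _, h, hwp⟩
  · obtain ⟨r, hur, hr⟩ := hp.symm.exists_erase (Ne.symm hpu)
    have : S ∪ T = S ∪ (T.erase w).erase u := by
      ext x
      have := h.left_mem
      have := h.right_mem
      simp only [Finset.mem_union, Finset.mem_erase]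
      grind
    rw [this] at hcard ⊢
    refine ⟨hcard, u, r, h.append hwp hr.symm ?_, hur.symm⟩
    rw [Finset.disjoint_left]
    intro x hx hx'
    simp only [Finset.mem_erase] at hx'
    grind

/-- A path inside `B` ending at `b` that cannot be extended inside `B` at its first vertex. -/
theorem exists_maximal (G : SimpleGraph V) {B : Finset V} {b : V} (hb : b ∈ B) :
    ∃ l, ∃ L ⊆ B, PathOn G l b L ∧ ∀ x ∈ B, x ∉ L → ¬ G.Adj x l := by
  classical
  obtain ⟨L, hL, hmax⟩ := Finset.exists_max_image
    (B.powerset.filter fun L => ∃ l, PathOn G l b L) Finset.card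
    ⟨{b}, by simpa [hb] using ⟨b, single b⟩⟩
  simp only [Finset.mem_filter, Finset.mem_powerset] at hL hmax
  obtain ⟨hLB, l, hl⟩ := hL
  refine ⟨l, L, hLB, hl, fun x hx hxL hadj => ?_⟩
  have := hmax (insert x L) ⟨Finset.insert_subset hx hLB, x, cons hadj hxL hl⟩
  rw [Finset.card_insert_of_notMem hxL] at this
  omega

/-- Either some consecutive pair `x, x'` on the path has `x'` adjacent to `a` and `x` adjacent
to `b`, or the neighbourhoods of `a` and `b` on the path are small. -/
theorem crossing_or_card_le [DecidableRel G.Adj] (a b : V) (h : PathOn G u w S) :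
    (∃ x x' S₁ S₂, PathOn G u x S₁ ∧ PathOn G x' w S₂ ∧ Disjoint S₁ S₂ ∧ S = S₁ ∪ S₂ ∧
      G.Adj x x' ∧ G.Adj a x' ∧ G.Adj b x) ∨
    ((S.erase u).filter (G.Adj a)).card + ((S.erase w).filter (G.Adj b)).card + 1 ≤ S.card := by
  induction h with
  | single u => right; simp
  | @cons u v w S huv hu h ih =>
    rcases ih with ⟨x, x', S₁, S₂, h₁, h₂, hd, rfl, h3, h4, h5⟩ | ih
    · left
      refine ⟨x, x', insert u S₁, S₂, cons huv (by simp_all) h₁, h₂, ?_, by simp, h3, h4, h5⟩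
      rw [Finset.disjoint_insert_left]
      exact ⟨by simp_all, hd⟩
    · by_cases hc : G.Adj a v ∧ G.Adj b u
      · left
        exact ⟨u, v, {u}, S, single u, h, by simpa using hu, Finset.insert_eq u S, huv,
          hc.1, hc.2⟩
      · right
        have huw : u ≠ w := fun e => hu (e ▸ h.right_mem)
        rw [Finset.erase_insert hu, Finset.card_insert_of_notMem hu,
          Finset.erase_insert_of_ne huw, Finset.filter_insert]
        have e1 : S = insert v (S.erase v) := (Finset.insert_erase h.left_mem).symm
        have e2 : (S.filter (G.Adj a)).card =
            ((insert v (S.erase v)).filter (G.Adj a)).card := by rw [← e1]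
        rw [e2, Finset.filter_insert]
        have c1 := Finset.card_insert_le v ((S.erase v).filter (G.Adj a))
        have c2 := Finset.card_insert_le u ((S.erase w).filter (G.Adj b))
        split_ifs <;> first | omega | tauto

/-- Ore's argument: a path whose ends have large degree sum can be turned into a cycle
that is at least as long. -/
theorem exists_cycleOn_of_degree_sum [Fintype V] [DecidableRel G.Adj] {a b : V}
    (h : PathOn G a b S) (hS : 3 ≤ S.card)
    (hdeg : Fintype.card V ≤ G.degree a + G.degree b) :
    ∃ T, CycleOn G T ∧ S.card ≤ T.card := by
  by_cases hout : ∃ x ∉ S, G.Adj a x ∧ G.Adj b x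
  · obtain ⟨x, hxS, hax, hbx⟩ := hout
    refine ⟨insert x S, ⟨?_, x, b, cons hax.symm hxS h, hbx⟩, ?_⟩ <;>
    · rw [Finset.card_insert_of_notMem hxS]; omega
  rcases h.crossing_or_card_le a b with ⟨x, x', S₁, S₂, h₁, h₂, hd, rfl, -, h4, h5⟩ | hle
  · exact ⟨_, ⟨hS, a, x', h₁.append h5.symm h₂.symm hd, h4.symm⟩, le_rfl⟩
  · exfalso
    have key : ∀ y, (G.neighborFinset y) =
        ((S.erase y).filter (G.Adj y)) ∪ (Sᶜ.filter (G.Adj y)) := by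
      intro y
      ext x
      have := G.ne_of_adj (a := y) (b := x)
      simp only [SimpleGraph.mem_neighborFinset, Finset.mem_union, Finset.mem_filter, Finset.mem_erase,
        Finset.mem_compl]
      grind
    have hda := Finset.card_union_le ((S.erase a).filter (G.Adj a)) (Sᶜ.filter (G.Adj a))
    have hdb := Finset.card_union_le ((S.erase b).filter (G.Adj b)) (Sᶜ.filter (G.Adj b))
    rw [← key, SimpleGraph.card_neighborFinset_eq_degree] at hda hdb
    have hdis : Disjoint (Sᶜ.filter (G.Adj a)) (Sᶜ.filter (G.Adj b)) := by
      rw [Finset.disjoint_left]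
      simp only [Finset.mem_filter, Finset.mem_compl]
      grind
    have := Finset.card_union_of_disjoint hdis
    have h2 : (Sᶜ.filter (G.Adj a) ∪ Sᶜ.filter (G.Adj b)).card ≤ Sᶜ.card :=
      Finset.card_le_card (by rw [← Finset.filter_or]; exact Finset.filter_subset _ _)
    have h3 := Finset.card_add_card_compl S
    omega

end PathOn

namespace PathOn

variable {V : Type*} [DecidableEq V] {G : SimpleGraph V} {u w : V} {S : Finset V}

theorem exists_walk (h : PathOn G u w S) :
    ∃ p : G.Walk u w, p.IsPath ∧ p.support.toFinset = S ∧ p.length + 1 = S.card := by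
  induction h with
  | single u => exact ⟨Walk.nil, by simp⟩
  | @cons u v w S huv hu h ih =>
    obtain ⟨p, hp, rfl, hl⟩ := ih
    refine ⟨Walk.cons huv p, ?_, by simp, ?_⟩
    · rw [Walk.cons_isPath_iff]
      exact ⟨hp, by simpa using hu⟩
    · rw [Finset.card_insert_of_notMem hu, Walk.length_cons]; omega

/-- A path in `G` with the edge `ab` added either is a path of `G`, or splits into two
paths of `G` joined by that edge. -/
theorem of_sup_edge {a b : V} (h : PathOn (G ⊔ SimpleGraph.edge a b) u w S) :
    PathOn G u w S ∨ ∃ S₁ S₂, Disjoint S₁ S₂ ∧ S = S₁ ∪ S₂ ∧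
      ((PathOn G u a S₁ ∧ PathOn G b w S₂) ∨ (PathOn G u b S₁ ∧ PathOn G a w S₂)) := by
  induction h with
  | single u => exact Or.inl (single u)
  | @cons u v w S huv hu h ih =>
    rw [sup_adj, edge_adj] at huv
    rcases ih with ih | ⟨S₁, S₂, hd, rfl, ih⟩
    · rcases huv with huv | ⟨⟨rfl, rfl⟩ | ⟨rfl, rfl⟩, -⟩
      · exact Or.inl (cons huv hu ih)
      · exact Or.inr ⟨_, S, by simpa using hu, Finset.insert_eq _ _, Or.inl ⟨single _, ih⟩⟩
      · exact Or.inr ⟨_, S, by simpa using hu, Finset.insert_eq _ _, Or.inr ⟨single _, ih⟩⟩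
    · simp only [Finset.mem_union, not_or] at hu
      have hd' : Disjoint (insert u S₁) S₂ := Finset.disjoint_insert_left.2 ⟨hu.2, hd⟩
      rcases huv with huv | huv
      · refine Or.inr ⟨insert u S₁, S₂, hd', by simp, ?_⟩
        rcases ih with ⟨h1, h2⟩ | ⟨h1, h2⟩
        · exact Or.inl ⟨cons huv hu.1 h1, h2⟩
        · exact Or.inr ⟨cons huv hu.1 h1, h2⟩
      · exfalso
        rw [Finset.disjoint_left] at hd
        rcases ih with ⟨h1, h2⟩ | ⟨h1, h2⟩ <;>
        · have := h1.left_mem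
          have := h1.right_mem
          have := h2.left_mem
          grind

end PathOn

namespace CycleOn

variable {V : Type*} [DecidableEq V] {G : SimpleGraph V} {S : Finset V}

theorem exists_walk (h : CycleOn G S) :
    ∃ (u : V) (C : G.Walk u u), C.IsCycle ∧ C.length = S.card := by
  obtain ⟨hS, u, w, hp, hadj⟩ := h
  obtain ⟨p, hp, -, hl⟩ := hp.exists_walk
  refine ⟨w, Walk.cons hadj p, ?_, by rw [Walk.length_cons, hl]⟩
  rw [Walk.cons_isCycle_iff]
  refine ⟨hp, fun he => ?_⟩
  rw [Sym2.eq_swap] at he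
  have h1 := (hp.getVert_eq_end_iff (i := 1) (by omega)).1 (hp.eq_snd_of_mem_edges he).symm
  omega

theorem of_sup_edge {a b : V} (h : CycleOn (G ⊔ SimpleGraph.edge a b) S) :
    CycleOn G S ∨ PathOn G a b S := by
  obtain ⟨hS, u, w, hp, hadj⟩ := h
  rw [sup_adj, edge_adj] at hadj
  rcases hp.of_sup_edge with hq | ⟨S₁, S₂, hd, rfl, hq⟩
  · rcases hadj with hadj | ⟨⟨rfl, rfl⟩ | ⟨rfl, rfl⟩, -⟩
    · exact Or.inl ⟨hS, u, w, hq, hadj⟩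
    · exact Or.inr hq.symm
    · exact Or.inr hq
  · right
    rcases hadj with hadj | hadj
    · rcases hq with ⟨h1, h2⟩ | ⟨h1, h2⟩
      · exact h1.symm.append hadj.symm h2.symm hd
      · rw [Finset.union_comm]
        exact h2.append hadj h1 hd.symm
    · exfalso
      rw [Finset.disjoint_left] at hd
      rcases hq with ⟨h1, h2⟩ | ⟨h1, h2⟩ <;>
      · have := h1.left_mem
        have := h1.right_mem
        have := h2.left_mem
        have := h2.right_mem
        rcases hadj with ⟨⟨rfl, rfl⟩ | ⟨rfl, rfl⟩, -⟩
        all_goals first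
          | exact hd ‹_› ‹_›
          | (rw [h1.eq_singleton, h2.eq_singleton] at hS
             have := Finset.card_le_two (a := w) (b := u)
             have := Finset.card_le_two (a := u) (b := w)
             simp only [← Finset.insert_eq] at hS
             omega)

end CycleOn

/-- A graph containing `G`, with the same neighbours of `v` and no cycle on more than `c` vertices,
in which any two neighbours of `v` with large degree sum are adjacent. -/
theorem exists_closure {V : Type*} [Fintype V] [DecidableEq V] (G : SimpleGraph V)
    [DecidableRel G.Adj] (v : V) {c : ℕ} (hc : 3 ≤ c) (hG : ∀ S, CycleOn G S → S.card ≤ c) :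
    ∃ F : SimpleGraph V, G ≤ F ∧ (∀ x, F.Adj v x ↔ G.Adj v x) ∧
      (∀ S, CycleOn F S → S.card ≤ c) ∧
      ∀ a b, G.Adj v a → G.Adj v b → a ≠ b → Fintype.card V ≤ G.degree a + G.degree b →
        F.Adj a b := by
  classical
  obtain ⟨F, hF⟩ := Set.Finite.exists_maximal
    (s := {F : SimpleGraph V | G ≤ F ∧ (∀ x, F.Adj v x ↔ G.Adj v x) ∧
      ∀ S, CycleOn F S → S.card ≤ c}) (Set.toFinite _) ⟨G, le_rfl, fun _ => Iff.rfl, hG⟩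
  obtain ⟨⟨hGF, hv, hcyc⟩, hmax⟩ := hF
  refine ⟨F, hGF, hv, hcyc, fun a b ha hb hab hdeg => ?_⟩
  by_contra hnadj
  have hnot : ¬ ∀ S, CycleOn (F ⊔ SimpleGraph.edge a b) S → S.card ≤ c := by
    intro hall
    refine hnadj (hmax (y := F ⊔ SimpleGraph.edge a b) ⟨le_trans hGF le_sup_left, ?_, hall⟩
      le_sup_left ?_)
    · intro x
      rw [sup_adj, edge_adj, hv]
      have h1 := G.ne_of_adj ha
      have h2 := G.ne_of_adj hb
      constructor
      · rintro (h | ⟨⟨rfl, -⟩ | ⟨rfl, -⟩, -⟩)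
        · exact h
        · exact absurd rfl h1
        · exact absurd rfl h2
      · exact Or.inl
    · rw [sup_adj, edge_adj]
      exact Or.inr ⟨Or.inl ⟨rfl, rfl⟩, hab⟩
  push Not at hnot
  obtain ⟨S, hS, hcard⟩ := hnot
  rcases hS.of_sup_edge with h | h
  · exact absurd (hcyc S h) (by omega)
  · have hda : G.degree a ≤ F.degree a := degree_le_of_le hGF
    have hdb : G.degree b ≤ F.degree b := degree_le_of_le hGF
    obtain ⟨T, hT, hle⟩ := h.exists_cycleOn_of_degree_sum (by omega) (by omega)
    exact absurd (hcyc T hT) (by omega)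

section Exit

variable {V : Type*} [DecidableEq V] {G : SimpleGraph V} {O : Finset V} {x : V}

theorem exists_pathOn_adj_of_walk {b o : {u : V | u ≠ x}}
    (p : (G.induce {u | u ≠ x}).Walk b o) (ho : o.1 ∈ O) (hb : b.1 ∉ O) :
    ∃ T e' e, PathOn G b.1 e' T ∧ Disjoint T O ∧ x ∉ T ∧ G.Adj e' e ∧ e ∈ O := by
  induction p with
  | nil => exact absurd ho hb
  | @cons b b' o hadj p ih =>
    rw [induce_adj] at hadj
    by_cases hb' : b'.1 ∈ O
    · exact ⟨{b.1}, b, b', .single _, by simpa using hb, by simpa using Ne.symm b.2, hadj, hb'⟩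
    · obtain ⟨T, e', e, hT, hTO, hxT, he, heO⟩ := ih ho hb'
      by_cases hbT : b.1 ∈ T
      · obtain ⟨T', hT', hp⟩ := hT.exists_subpath hbT
        exact ⟨T', e', e, hp, Finset.disjoint_of_subset_left hT' hTO, fun h => hxT (hT' h), he, heO⟩
      · refine ⟨_, e', e, hT.cons hadj hbT, Finset.disjoint_insert_left.2 ⟨hb, hTO⟩, ?_, he, heO⟩
        have : x ≠ b.1 := Ne.symm b.2
        simp [hxT, this]

/-- In a graph that stays connected without `x`, every nonempty set `B` has a path avoiding `x`
that starts in `B`, does not return to `B`, and ends next to the set `O`. -/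
theorem exists_exit (hconn : (G.induce {u | u ≠ x}).Connected) {B : Finset V} (hB : B.Nonempty)
    (hxB : x ∉ B) (hxO : x ∉ O) (hBO : Disjoint B O) (hO : O.Nonempty) :
    ∃ b ∈ B, ∃ T e' e, PathOn G b e' T ∧ (∀ y ∈ T, y ∈ B → y = b) ∧ Disjoint T O ∧ x ∉ T ∧
      G.Adj e' e ∧ e ∈ O := by
  obtain ⟨b, hb⟩ := hB
  obtain ⟨o, ho⟩ := hO
  obtain ⟨p⟩ := hconn.preconnected ⟨b, fun h => hxB (h ▸ hb)⟩ ⟨o, fun h => hxO (h ▸ ho)⟩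
  obtain ⟨T, e', e, hT, hTO, hxT, he, heO⟩ :=
    exists_pathOn_adj_of_walk p ho (Finset.disjoint_left.1 hBO hb)
  obtain ⟨b', hb', T', hT', hp, hlast⟩ := hT.exists_last_mem B ⟨b, hT.left_mem, hb⟩
  exact ⟨b', hb', T', e', e, hp, hlast, Finset.disjoint_of_subset_left hT' hTO,
    fun h => hxT (hT' h), he, heO⟩

end Exit

/-- `f` runs periodically around a cycle of length `c`. -/
structure RunsAround {V : Type*} (G : SimpleGraph V) (f : ℕ → V) (c : ℕ) : Prop where
  three_le : 3 ≤ c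
  adj : ∀ i, G.Adj (f i) (f (i + 1))
  periodic : ∀ i, f (i + c) = f i
  ne : ∀ i j, i < j → j < i + c → f i ≠ f j

theorem SimpleGraph.Walk.IsCycle.runsAround {V : Type*} {G : SimpleGraph V} {a : V}
    {C : G.Walk a a} (hC : C.IsCycle) :
    RunsAround G (fun i => C.getVert (i % C.length)) C.length where
  three_le := hC.three_le_length
  adj i := by
    have h3 := hC.three_le_length
    have hlt := Nat.mod_lt i (show 0 < C.length by omega)
    have h := C.adj_getVert_succ hlt
    rcases Nat.lt_or_ge (i % C.length + 1) C.length with h1 | h1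
    · rwa [Nat.add_mod, Nat.mod_eq_of_lt (a := 1) (by omega), Nat.mod_eq_of_lt h1]
    · have h2 : i % C.length + 1 = C.length := by omega
      rw [h2, Walk.getVert_length] at h
      rwa [Nat.add_mod, Nat.mod_eq_of_lt (a := 1) (by omega), h2, Nat.mod_self, Walk.getVert_zero]
  periodic i := by simp
  ne i j hij hji h := by
    have h3 := hC.three_le_length
    have hi := Nat.mod_lt i (show 0 < C.length by omega)
    have hj := Nat.mod_lt j (show 0 < C.length by omega)
    have hmod : i % C.length = j % C.length :=
      hC.getVert_injOn' (by simp; omega) (by simp; omega) h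
    have hdvd : C.length ∣ j - i := (Nat.modEq_iff_dvd' hij.le).1 hmod
    have := Nat.le_of_dvd (by omega) hdvd
    omega

namespace RunsAround

variable {V : Type*} {G : SimpleGraph V} {f : ℕ → V} {c : ℕ}

theorem mono {G' : SimpleGraph V} (hle : G ≤ G') (h : RunsAround G f c) : RunsAround G' f c :=
  ⟨h.three_le, fun i => hle (h.adj i), h.periodic, h.ne⟩

theorem apply_mod (h : RunsAround G f c) (i : ℕ) : f (i % c) = f i := by
  have : ∀ k j, f (j + c * k) = f j := by
    intro k
    induction k with
    | zero => simp
    | succ k ih => intro j; rw [Nat.mul_succ, ← add_assoc, h.periodic, ih]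
  conv_rhs => rw [← Nat.mod_add_div i c]
  rw [this]

theorem injOn_Icc (h : RunsAround G f c) {i j : ℕ} (hj : j < i + c) :
    Set.InjOn f (Finset.Icc i j) := by
  intro k hk l hl hkl
  simp only [Finset.coe_Icc, Set.mem_Icc] at hk hl
  rcases lt_trichotomy k l with hlt | rfl | hlt
  · exact absurd hkl (h.ne _ _ hlt (by omega))
  · rfl
  · exact absurd hkl.symm (h.ne _ _ hlt (by omega))

variable [DecidableEq V]

theorem card_image_Icc (h : RunsAround G f c) {i j : ℕ} (hj : j < i + c) :
    ((Finset.Icc i j).image f).card = j + 1 - i := by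
  rw [Finset.card_image_of_injOn (h.injOn_Icc hj), Nat.card_Icc]

theorem card_image_range (h : RunsAround G f c) : ((Finset.range c).image f).card = c := by
  have h3 := h.three_le
  have : Finset.range c = Finset.Icc 0 (c - 1) := by
    ext x; simp; omega
  rw [this, h.card_image_Icc (by omega)]
  omega

theorem mem_image_range (h : RunsAround G f c) (i : ℕ) : f i ∈ (Finset.range c).image f := by
  rw [← h.apply_mod]
  exact Finset.mem_image_of_mem _ (Finset.mem_range.2 (Nat.mod_lt _ (by have := h.three_le; omega)))

theorem pathOn (h : RunsAround G f c) (i n : ℕ) (hn : n < c) :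
    PathOn G (f i) (f (i + n)) ((Finset.Icc i (i + n)).image f) := by
  induction n with
  | zero => simpa using PathOn.single (G := G) (f i)
  | succ n ih =>
    have : (Finset.Icc i (i + (n + 1))).image f =
        (Finset.Icc i (i + n)).image f ∪ {f (i + n + 1)} := by
      rw [← Finset.image_singleton f, ← Finset.image_union]
      congr 1
      ext x; simp; omega
    rw [this]
    refine (ih (by omega)).append (h.adj _) (.single _) ?_
    rw [Finset.disjoint_singleton_right, Finset.mem_image]
    rintro ⟨k, hk, hkn⟩
    rw [Finset.mem_Icc] at hk
    exact h.ne k (i + n + 1) (by omega) (by omega) hkn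

/-- A path leaving a longest cycle at one vertex and coming back at another one is at most as long
as the arc it bypasses. -/
theorem card_le_of_detour (h : RunsAround G f c) (hmax : ∀ S, CycleOn G S → S.card ≤ c)
    {i j : ℕ} (hij : i < j) (hj : j < i + c) {T : Finset V} (hT : PathOn G (f i) (f j) T)
    (hTC : ∀ x ∈ T, x ∈ (Finset.range c).image f → x = f i ∨ x = f j) :
    T.card ≤ j - i + 1 := by
  by_cases hT2 : T.card ≤ 2
  · omega
  have hW := h.pathOn j (i + c - j) (by omega)
  rw [show j + (i + c - j) = i + c by omega, h.periodic] at hW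
  set W := (Finset.Icc j (i + c)).image f with hWdef
  have hWc : W.card = i + c + 1 - j := h.card_image_Icc (by omega)
  have hne := h.ne i j hij hj
  have hTW : ∀ x ∈ T, x ∈ W → x = f i ∨ x = f j := by
    intro x hx hxW
    obtain ⟨k, -, rfl⟩ := Finset.mem_image.1 hxW
    exact hTC _ hx (h.mem_image_range k)
  have hle := Finset.card_le_card (Finset.subset_union_left (s₁ := T) (s₂ := W))
  have := hmax _ (hT.cycleOn_union hW hne hTW (by omega))
  have hinter : (T ∩ W).card ≤ 2 := by
    refine le_trans (Finset.card_le_card (t := {f i, f j}) ?_) Finset.card_le_two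
    intro x hx
    rw [Finset.mem_inter] at hx
    simpa using hTW x hx.1 hx.2
  have := Finset.card_union_add_card_inter T W
  omega

end RunsAround

/-- A path of `G` from `u` to `y ∈ C` that meets `C` only in its end `y`; its vertex set is `S`. -/
structure IsArm {V : Type*} [DecidableEq V] (G : SimpleGraph V) (C : Finset V) (u y : V)
    (S : Finset V) : Prop where
  path : PathOn G u y S
  mem : y ∈ C
  eq : ∀ x ∈ S, x ∈ C → x = y

/-- A path from the neighbour `p` of `v` to `y ∈ C`, avoiding `v` and meeting `C` only in its
end `y`. -/
structure IsSpoke {V : Type*} [DecidableEq V] (G : SimpleGraph V) (v : V) (C : Finset V) (p y : V)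
    (S : Finset V) : Prop extends IsArm G C p y S where
  adj : G.Adj v p
  notMem : v ∉ S

namespace RunsAround

variable {V : Type*} [DecidableEq V] {G : SimpleGraph V} {f : ℕ → V} {c : ℕ}

/-- An arc of a longest cycle between the ends of two disjoint spokes is long. -/
theorem arc_bound [DecidableRel G.Adj] (h : RunsAround G f c)
    (hmax : ∀ S, CycleOn G S → S.card ≤ c)
    {v p r : V} (hv : v ∉ (Finset.range c).image f) {a b : ℕ} (hab : a < b) (hb : b < a + c)
    {S T : Finset V} (hS : IsSpoke G v ((Finset.range c).image f) p (f a) S)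
    (hT : IsSpoke G v ((Finset.range c).image f) r (f b) T) (hST : Disjoint S T) :
    2 * ((Finset.Ioo a b).filter fun i => G.Adj v (f i)).card + S.card + T.card ≤ b - a := by
  have hvT : PathOn G v (f b) (insert v T) := hT.path.cons hT.adj hT.notMem
  set K := (Finset.Ioo a b).filter fun i => G.Adj v (f i) with hK
  have hlow : ∀ i ∈ K, a + S.card + 1 ≤ i := by
    intro i hi
    simp only [hK, Finset.mem_filter, Finset.mem_Ioo] at hi
    have hiS : f i ∉ S := fun hm =>
      h.ne a i hi.1.1 (by omega) (hS.eq _ hm (h.mem_image_range i)).symm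
    have hiv : v ≠ f i := G.ne_of_adj hi.2
    have hpath := hS.path.symm.append hS.adj.symm ((PathOn.single (f i)).cons hi.2 (by simpa))
      (by simp [hiS, hS.notMem])
    have := h.card_le_of_detour hmax hi.1.1 (by omega) hpath (by
      intro x hx hxC
      simp only [Finset.mem_union, Finset.mem_insert, Finset.mem_singleton] at hx
      rcases hx with hx | rfl | rfl
      · exact Or.inl (hS.eq x hx hxC)
      · exact absurd hxC hv
      · exact Or.inr rfl)
    rw [Finset.card_union_of_disjoint (by simp [hiS, hS.notMem]), Finset.card_pair hiv] at this
    omega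
  have hhigh : ∀ i ∈ K, i + T.card + 1 ≤ b := by
    intro i hi
    simp only [hK, Finset.mem_filter, Finset.mem_Ioo] at hi
    have hiT : f i ∉ T := fun hm =>
      h.ne i b hi.1.2 (by omega) (hT.eq _ hm (h.mem_image_range i))
    have hiv : v ≠ f i := G.ne_of_adj hi.2
    have hnot : f i ∉ insert v T := by simp [hiT, hiv.symm]
    have := h.card_le_of_detour hmax hi.1.2 (by omega) (hvT.cons hi.2.symm hnot) (by
      intro x hx hxC
      simp only [Finset.mem_insert] at hx
      rcases hx with rfl | rfl | hx
      · exact Or.inl rfl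
      · exact absurd hxC hv
      · exact Or.inr (hT.eq x hx hxC))
    rw [Finset.card_insert_of_notMem hnot, Finset.card_insert_of_notMem hT.notMem] at this
    omega
  have hgap : ∀ i ∈ K, i + 1 ∉ K := by
    intro i hi hi'
    simp only [hK, Finset.mem_filter, Finset.mem_Ioo] at hi hi'
    have hiv : v ≠ f i := G.ne_of_adj hi.2
    have hiv' : v ≠ f (i + 1) := G.ne_of_adj hi'.2
    have hne := G.ne_of_adj (h.adj i)
    have := h.card_le_of_detour hmax (Nat.lt_succ_self i) (by have := h.three_le; omega)
      (((PathOn.single (f (i + 1))).cons hi'.2 (by simpa)).cons hi.2.symm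
        (by simp [hiv.symm, hne])) (by
      intro x hx hxC
      simp only [Finset.mem_insert, Finset.mem_singleton] at hx
      rcases hx with rfl | rfl | rfl
      · exact Or.inl rfl
      · exact absurd hxC hv
      · exact Or.inr rfl)
    rw [Finset.card_insert_of_notMem (by simp [hiv.symm, hne]), Finset.card_pair hiv'] at this
    omega
  rcases K.eq_empty_or_nonempty with hE | ⟨k, hk⟩
  · have hdis : Disjoint S (insert v T) := by simp [hS.notMem, hST]
    have := h.card_le_of_detour hmax hab hb (hS.path.symm.append hS.adj.symm hvT hdis) (by
      intro x hx hxC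
      simp only [Finset.mem_union, Finset.mem_insert] at hx
      rcases hx with hx | rfl | hx
      · exact Or.inl (hS.eq x hx hxC)
      · exact absurd hxC hv
      · exact Or.inr (hT.eq x hx hxC))
    rw [Finset.card_union_of_disjoint hdis, Finset.card_insert_of_notMem hT.notMem] at this
    rw [hE, Finset.card_empty]
    omega
  · have hdis : Disjoint K (K.image (· + 1)) := by
      rw [Finset.disjoint_right]
      intro x hx
      obtain ⟨i, hi, rfl⟩ := Finset.mem_image.1 hx
      exact hgap i hi
    have hsub : K ∪ K.image (· + 1) ⊆ Finset.Icc (a + S.card + 1) (b - T.card) := by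
      intro x hx
      rw [Finset.mem_Icc]
      rcases Finset.mem_union.1 hx with hx | hx
      · have := hlow x hx
        have := hhigh x hx
        omega
      · obtain ⟨i, hi, rfl⟩ := Finset.mem_image.1 hx
        have := hlow i hi
        have := hhigh i hi
        omega
    have := Finset.card_le_card hsub
    rw [Finset.card_union_of_disjoint hdis,
      Finset.card_image_of_injective _ (add_left_injective 1), Nat.card_Icc] at this
    have := hlow k hk
    have := hhigh k hk
    omega

/-- A longest cycle is long compared with any two disjoint spokes and the number of neighbours
of `v` on the cycle. -/
theorem cycle_bound [DecidableRel G.Adj] (h : RunsAround G f c)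
    (hmax : ∀ S, CycleOn G S → S.card ≤ c)
    {v p r y z : V} (hv : v ∉ (Finset.range c).image f)
    {S T : Finset V} (hS : IsSpoke G v ((Finset.range c).image f) p y S)
    (hT : IsSpoke G v ((Finset.range c).image f) r z T) (hST : Disjoint S T) :
    2 * (((Finset.range c).image f).filter (G.Adj v)).card + 2 * (S.card + T.card) ≤ c + 4 := by
  obtain ⟨a, ha, rfl⟩ := Finset.mem_image.1 hS.mem
  obtain ⟨b, hb, rfl⟩ := Finset.mem_image.1 hT.mem
  rw [Finset.mem_range] at ha hb
  wlog hab : a < b generalizing a b p r S T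
  · have hne : a ≠ b := by
      rintro rfl
      exact Finset.disjoint_left.1 hST hS.path.right_mem hT.path.right_mem
    have := this (p := r) (r := p) hST.symm b hb hT a ha hS (by omega)
    omega
  have h1 := h.arc_bound hmax hv hab (by omega) hS hT hST
  have h2 := h.arc_bound hmax hv (a := b) (b := a + c) (by omega) (by omega) hT
    (by rwa [h.periodic]) hST.symm
  have hsub : ((Finset.range c).image f).filter (G.Adj v) ⊆
      (((Finset.Ioo a b).filter fun i => G.Adj v (f i)).image f ∪
      ((Finset.Ioo b (a + c)).filter fun i => G.Adj v (f i)).image f) ∪ {f a, f b} := by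
    intro x hx
    rw [Finset.mem_filter] at hx
    obtain ⟨hx, hvx⟩ := hx
    obtain ⟨i, hi, rfl⟩ := Finset.mem_image.1 hx
    rw [Finset.mem_range] at hi
    simp only [Finset.mem_union, Finset.mem_image, Finset.mem_filter, Finset.mem_Ioo,
      Finset.mem_insert, Finset.mem_singleton]
    by_cases hia : i < a
    · exact Or.inl (Or.inr ⟨i + c, ⟨by omega, by rwa [h.periodic]⟩, h.periodic i⟩)
    by_cases hia' : i = a
    · exact Or.inr (Or.inl (by rw [hia']))
    by_cases hib : i < b
    · exact Or.inl (Or.inl ⟨i, ⟨by omega, hvx⟩, rfl⟩)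
    by_cases hib' : i = b
    · exact Or.inr (Or.inr (by rw [hib']))
    · exact Or.inl (Or.inr ⟨i, ⟨by omega, hvx⟩, rfl⟩)
  have h3 := Finset.card_le_card hsub
  have h4 := Finset.card_union_le
    (((Finset.Ioo a b).filter fun i => G.Adj v (f i)).image f ∪
      ((Finset.Ioo b (a + c)).filter fun i => G.Adj v (f i)).image f) {f a, f b}
  have h5 := Finset.card_union_le (((Finset.Ioo a b).filter fun i => G.Adj v (f i)).image f)
      (((Finset.Ioo b (a + c)).filter fun i => G.Adj v (f i)).image f)
  have h6 := Finset.card_image_le (s := (Finset.Ioo a b).filter fun i => G.Adj v (f i)) (f := f)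
  have h7 := Finset.card_image_le
    (s := (Finset.Ioo b (a + c)).filter fun i => G.Adj v (f i)) (f := f)
  have h8 : ({f a, f b} : Finset V).card ≤ 2 := Finset.card_le_two
  omega

end RunsAround

section Fans

variable {V : Type*} [DecidableEq V] {G : SimpleGraph V} {C : Finset V}

theorem PathOn.trans {u w z : V} {S T : Finset V} (h : PathOn G u w S) (h' : PathOn G w z T)
    (hST : ∀ x ∈ S, x ∈ T → x = w) : PathOn G u z (S ∪ T) := by
  by_cases hwz : w = z
  · subst hwz
    rw [h'.eq_singleton, Finset.union_eq_left.2 (by simpa using h.right_mem)]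
    exact h
  · obtain ⟨p, hp, hpath⟩ := h'.exists_erase hwz
    have : S ∪ T = S ∪ T.erase w := by
      have := h.right_mem
      ext x
      simp only [Finset.mem_union, Finset.mem_erase]
      by_cases hx : x = w <;> simp_all
    rw [this]
    refine h.append hp hpath (Finset.disjoint_left.2 fun x hx hxT => ?_)
    rw [Finset.mem_erase] at hxT
    exact hxT.1 (hST x hx hxT.2)

namespace IsArm

variable {u w y z e e' : V} {S T M : Finset V}

theorem append (hM : PathOn G u e' M) (hadj : G.Adj e' e) (h : IsArm G C e y S)
    (hMS : Disjoint M S) (hMC : Disjoint M C) : IsArm G C u y (M ∪ S) where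
  path := hM.append hadj h.path hMS
  mem := h.mem
  eq x hx hxC := (Finset.mem_union.1 hx).elim
    (fun hxM => absurd hxC (Finset.disjoint_left.1 hMC hxM)) fun hxS => h.eq x hxS hxC

theorem single (hy : y ∈ C) : IsArm G C y y {y} :=
  ⟨.single y, hy, by simp⟩

theorem exists_suffix (h : IsArm G C w y S) (he : e ∈ S) :
    ∃ R ⊆ S, IsArm G C e y R ∧ (w ∈ R → e = w) := by
  obtain ⟨R, hR, ⟨rfl, rfl⟩ | ⟨S₁, t, h₁, -, hd, rfl⟩⟩ := h.path.exists_suffix he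
  · exact ⟨_, subset_rfl, h, fun _ => rfl⟩
  · exact ⟨R, Finset.subset_union_right,
      ⟨hR, h.mem, fun x hx => h.eq x (Finset.mem_union_right _ hx)⟩,
      fun hw => absurd hw (Finset.disjoint_left.1 hd h₁.left_mem)⟩

end IsArm

/-- The vertex `u` is joined to `C` by two paths that share only `u`. -/
def HasFan {V : Type*} [DecidableEq V] (G : SimpleGraph V) (C : Finset V) (u : V) : Prop :=
  ∃ y z S T, IsArm G C u y S ∧ IsArm G C u z T ∧ ∀ x ∈ S, x ∈ T → x = u

namespace HasFan

variable {u w y z c : V} {S T : Finset V}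

theorem of_adj (hadj : G.Adj u w) (hu : u ∉ C) (hS : IsArm G C u y S) (hT : IsArm G C w z T)
    (hST : Disjoint S T) : HasFan G C u := by
  refine ⟨y, z, S, {u} ∪ T, hS, hT.append (.single u) hadj ?_ (by simpa), ?_⟩
  · simpa using Finset.disjoint_left.1 hST hS.path.left_mem
  · intro x hx hxT
    rcases Finset.mem_union.1 hxT with h | h
    · simpa using h
    · exact absurd h (Finset.disjoint_left.1 hST hx)

theorem of_adj_mem (hconn : ∀ x, (G.induce {u | u ≠ x}).Connected) (hC : 2 ≤ C.card)
    (hadj : G.Adj u c) (hu : u ∉ C) (hc : c ∈ C) : HasFan G C u := by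
  obtain ⟨b, hb, T, e', e, hT, -, hTO, hcT, he, heO⟩ := exists_exit (O := C.erase c) (B := {u})
    (hconn c) (by simp) (by simpa using hadj.ne.symm) (by simp) (by simp [hu])
    (by rw [← Finset.card_pos, Finset.card_erase_of_mem hc]; omega)
  obtain rfl : b = u := by simpa using hb
  have hTC : Disjoint T C := Finset.disjoint_left.2 fun x hx hxC =>
    Finset.disjoint_left.1 hTO hx (Finset.mem_erase.2 ⟨fun h => hcT (h ▸ hx), hxC⟩)
  rw [Finset.mem_erase] at heO
  refine of_adj hadj hu ((IsArm.single heO.2).append hT he ?_ hTC) (.single hc) ?_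
  · simpa using fun h => Finset.disjoint_left.1 hTC h heO.2
  · simpa using ⟨Ne.symm heO.1, hcT⟩

theorem of_adj_hasFan (hconn : ∀ x, (G.induce {u | u ≠ x}).Connected) (hadj : G.Adj u w)
    (hu : u ∉ C) (hw : w ∉ C) (h : HasFan G C w) : HasFan G C u := by
  obtain ⟨y, z, S, T, hS, hT, hST⟩ := h
  have key : ∀ {y z : V} {S T : Finset V}, IsArm G C w y S → IsArm G C w z T →
      (∀ x ∈ S, x ∈ T → x = w) → u ∈ S → HasFan G C u := by
    intro y z S T hS hT hST huS
    obtain ⟨R, hRS, hR, hwR⟩ := hS.exists_suffix huS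
    refine of_adj hadj hu hR hT (Finset.disjoint_left.2 fun x hx hxT => ?_)
    obtain rfl := hST x (hRS hx) hxT
    exact hadj.ne (hwR hx)
  by_cases huS : u ∈ S
  · exact key hS hT hST huS
  by_cases huT : u ∈ T
  · exact key hT hS (fun x h h' => hST x h' h) huT
  obtain ⟨b, hb, M, e', e, hM, -, hMO, hwM, he, heO⟩ := exists_exit (O := (C ∪ S ∪ T).erase w)
    (B := {u}) (hconn w) (by simp) (by simpa using hadj.ne.symm) (by simp) (by simp [*])
    ⟨y, Finset.mem_erase.2 ⟨fun h => hw (h ▸ hS.mem), by simp [hS.mem]⟩⟩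
  obtain rfl : b = u := by simpa using hb
  rw [Finset.mem_erase] at heO
  have hM' : Disjoint M (C ∪ S ∪ T) := Finset.disjoint_left.2 fun x hx hxC =>
    Finset.disjoint_left.1 hMO hx (Finset.mem_erase.2 ⟨fun h => hwM (h ▸ hx), hxC⟩)
  rw [Finset.disjoint_union_right, Finset.disjoint_union_right] at hM'
  have key : ∀ {y z : V} {S T : Finset V}, IsArm G C w y S → IsArm G C w z T →
      (∀ x ∈ S, x ∈ T → x = w) → Disjoint M S → Disjoint M T → e ∈ S → HasFan G C b := by
    intro y z S T hS hT hST hMS hMT heS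
    obtain ⟨R, hRS, hR, hwR⟩ := hS.exists_suffix heS
    refine of_adj hadj hu
      (hR.append hM he (Finset.disjoint_of_subset_right hRS hMS) hM'.1.1) hT ?_
    refine Finset.disjoint_union_left.2 ⟨hMT, Finset.disjoint_left.2 fun x hx hxT => ?_⟩
    obtain rfl := hST x (hRS hx) hxT
    exact heO.1 (hwR hx)
  by_cases heS : e ∈ S
  · exact key hS hT hST hM'.1.2 hM'.2 heS
  by_cases heT : e ∈ T
  · exact key hT hS (fun x h h' => hST x h' h) hM'.2 hM'.1.2 heT
  have heC : e ∈ C := by simpa [heS, heT] using heO.2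
  refine of_adj hadj hu ((IsArm.single heC).append hM he ?_ hM'.1.1) hT ?_
  · simpa using fun h => Finset.disjoint_left.1 hM'.1.1 h heC
  · simpa [heT] using hM'.2

theorem of_notMem (hconn : ∀ x, (G.induce {u | u ≠ x}).Connected) (hC : 2 ≤ C.card)
    (hu : u ∉ C) : HasFan G C u := by
  obtain ⟨c, hc⟩ := Finset.card_pos.1 (by omega : 0 < C.card)
  obtain ⟨b, hb, T, e', e, hT, -, hTO, hcT, he, heO⟩ := exists_exit (O := C.erase c) (B := {u})
    (hconn c) (by simp) (by rintro h; simp_all) (by simp) (by simp [hu])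
    (by rw [← Finset.card_pos, Finset.card_erase_of_mem hc]; omega)
  obtain rfl : b = u := by simpa using hb
  have hTC : Disjoint T C := Finset.disjoint_left.2 fun x hx hxC =>
    Finset.disjoint_left.1 hTO hx (Finset.mem_erase.2 ⟨fun h => hcT (h ▸ hx), hxC⟩)
  have hfan := of_adj_mem hconn hC he (Finset.disjoint_left.1 hTC hT.right_mem)
    (Finset.mem_of_mem_erase heO)
  clear hTO hcT he heO hu hb
  induction hT with
  | single => exact hfan
  | @cons u v w S huv huS h ih =>
    rw [Finset.disjoint_insert_left] at hTC
    exact of_adj_hasFan hconn huv hTC.1 (Finset.disjoint_left.1 hTC.2 h.left_mem)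
      (ih hTC.2 hfan)

theorem exists_isSpoke {v : V} (h : HasFan G C v) (hv : v ∉ C) :
    ∃ p y S r z T, IsSpoke G v C p y S ∧ IsSpoke G v C r z T ∧ Disjoint S T := by
  obtain ⟨y, z, S, T, hS, hT, hST⟩ := h
  have key : ∀ {y S}, IsArm G C v y S → ∃ p, IsSpoke G v C p y (S.erase v) := by
    intro y S hS
    obtain ⟨p, hp, hpath⟩ := hS.path.exists_erase fun h => hv (h ▸ hS.mem)
    exact ⟨p, ⟨hpath, hS.mem, fun x hx => hS.eq x (Finset.mem_of_mem_erase hx)⟩, hp, by simp⟩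
  obtain ⟨p, hp⟩ := key hS
  obtain ⟨r, hr⟩ := key hT
  refine ⟨p, y, _, r, z, _, hp, hr, Finset.disjoint_left.2 fun x hx hx' => ?_⟩
  rw [Finset.mem_erase] at hx hx'
  exact hx.1 (hST x hx.2 hx'.2)

end HasFan

end Fans

/-- Two disjoint spokes at `v` of maximum total size. -/
structure IsMaxFan {V : Type*} [DecidableEq V] (G : SimpleGraph V) (v : V) (C : Finset V)
    (p y : V) (S : Finset V) (r z : V) (T : Finset V) : Prop where
  left : IsSpoke G v C p y S
  right : IsSpoke G v C r z T
  disj : Disjoint S T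
  card_le : ∀ p' y' S' r' z' T', IsSpoke G v C p' y' S' → IsSpoke G v C r' z' T' →
    Disjoint S' T' → S'.card + T'.card ≤ S.card + T.card

theorem exists_isMaxFan {V : Type*} [Fintype V] [DecidableEq V] {G : SimpleGraph V} {v : V}
    {C : Finset V}
    (h : ∃ p y S r z T, IsSpoke G v C p y S ∧ IsSpoke G v C r z T ∧ Disjoint S T) :
    ∃ p y S r z T, IsMaxFan G v C p y S r z T := by
  classical
  obtain ⟨p, y, S, r, z, T, hS, hT, hST⟩ := h
  obtain ⟨⟨S₁, T₁⟩, hm, hmax⟩ := Finset.exists_max_image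
    (Finset.univ.filter fun q : Finset V × Finset V => ∃ p y r z,
      IsSpoke G v C p y q.1 ∧ IsSpoke G v C r z q.2 ∧ Disjoint q.1 q.2)
    (fun q => q.1.card + q.2.card) ⟨(S, T), Finset.mem_filter.2
      ⟨Finset.mem_univ _, p, y, r, z, hS, hT, hST⟩⟩
  obtain ⟨p₁, y₁, r₁, z₁, h₁, h₂, h₃⟩ := (Finset.mem_filter.1 hm).2
  refine ⟨p₁, y₁, S₁, r₁, z₁, T₁, h₁, h₂, h₃, fun p' y' S' r' z' T' h h' hd => ?_⟩
  exact hmax (S', T') (Finset.mem_filter.2 ⟨Finset.mem_univ _, p', y', r', z', h, h', hd⟩)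

namespace IsMaxFan

variable {V : Type*} [DecidableEq V] {G : SimpleGraph V} {v : V} {C : Finset V}
  {p y r z l e e' w : V} {S T M W R : Finset V}

theorem symm (h : IsMaxFan G v C p y S r z T) : IsMaxFan G v C r z T p y S :=
  ⟨h.right, h.left, h.disj.symm, fun _ _ _ _ _ _ h₁ h₂ h₃ =>
    (h.card_le _ _ _ _ _ _ h₁ h₂ h₃).trans (add_comm _ _).le⟩

theorem card_add_one_le (h : IsMaxFan G v C p y S r z T) (hM : PathOn G l e' M) (hvl : G.Adj v l)
    (hvM : v ∉ M) (hMC : Disjoint M C) (hMS : Disjoint M S) (hMT : Disjoint M T)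
    (he : G.Adj e' e) (heS : e ∈ S) : M.card + 1 ≤ S.card := by
  obtain ⟨R, hRS, hR, -⟩ := h.left.exists_suffix heS
  have hMR := Finset.disjoint_of_subset_right hRS hMS
  have := h.card_le _ _ _ _ _ _ ⟨hR.append hM he hMR hMC, hvl, by
    simpa [hvM] using fun hv => h.left.notMem (hRS hv)⟩ h.right
    (Finset.disjoint_union_left.2 ⟨hMT, Finset.disjoint_of_subset_left hRS h.disj⟩)
  rw [Finset.card_union_of_disjoint hMR] at this
  have := Finset.card_pos.2 ⟨_, hR.path.left_mem⟩
  omega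

/-- A path from a neighbour of `v` to a neighbour of the cycle or of a spoke is short. -/
theorem card_add_two_le (h : IsMaxFan G v C p y S r z T) (hvC : v ∉ C) (hM : PathOn G l e' M)
    (hvl : G.Adj v l) (hvM : v ∉ M) (hMO : Disjoint M (C ∪ S ∪ T)) (he : G.Adj e' e)
    (heO : e ∈ C ∪ S ∪ T) : M.card + 2 ≤ S.card + T.card := by
  rw [Finset.disjoint_union_right, Finset.disjoint_union_right] at hMO
  have hS := Finset.card_pos.2 ⟨_, h.left.path.left_mem⟩
  have hT := Finset.card_pos.2 ⟨_, h.right.path.left_mem⟩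
  by_cases heS : e ∈ S
  · have := h.card_add_one_le hM hvl hvM hMO.1.1 hMO.1.2 hMO.2 he heS
    omega
  by_cases heT : e ∈ T
  · have := h.symm.card_add_one_le hM hvl hvM hMO.1.1 hMO.2 hMO.1.2 he heT
    omega
  have heC : e ∈ C := by simpa [heS, heT] using heO
  have heM : Disjoint M {e} := by
    simpa using fun hm => Finset.disjoint_left.1 hMO.1.1 hm heC
  have := h.card_le _ _ _ _ _ _ ⟨(IsArm.single heC).append hM he heM hMO.1.1, hvl, by
    simpa [hvM] using fun hv : v = e => hvC (hv ▸ heC)⟩ h.right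
    (Finset.disjoint_union_left.2 ⟨hMO.2, by simpa⟩)
  rw [Finset.card_union_of_disjoint heM, Finset.card_singleton] at this
  omega

variable [DecidableRel G.Adj]

theorem card_le_of_suffix (h : IsMaxFan G v C p y S r z T) (hpr : G.Adj p r)
    (hW : IsSpoke G v C l w W) (hyR : y ∈ R)
    (hR : R = S ∨ ∃ Q t, PathOn G p t Q ∧ Disjoint Q R ∧ S = Q ∪ R)
    (hWT : Disjoint W T) (hWS : Disjoint W (S \ R)) :
    W.card ≤ R.card + ((S ∪ T).filter fun x => x ∉ C ∧ ¬ G.Adj v x).card := by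
  rcases hR with rfl | ⟨Q, t, hQ, hQR, rfl⟩
  · have := h.card_le _ _ _ _ _ _ hW h.right hWT
    omega
  · obtain ⟨a, ha, P, hPQ, hP, hlast⟩ := hQ.symm.exists_first_mem
      ((Q ∪ R).filter (G.Adj v)) (by simp [hQ.left_mem, h.left.adj])
    have hQW : Disjoint W Q := by
      rwa [Finset.union_sdiff_right, Finset.sdiff_eq_self_of_disjoint hQR] at hWS
    have hQT := (Finset.disjoint_union_left.1 h.disj).1
    have hPT := Finset.disjoint_of_subset_left hPQ hQT
    have hQC : ∀ x ∈ Q, x ∉ C := fun x hx hxC =>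
      Finset.disjoint_left.1 hQR hx (h.left.eq x (Finset.mem_union_left _ hx) hxC ▸ hyR)
    have hvQ : v ∉ Q := fun hv => h.left.notMem (Finset.mem_union_left _ hv)
    have := h.card_le _ _ _ _ _ _ hW ⟨h.right.toIsArm.append hP hpr hPT
      (Finset.disjoint_left.2 fun x hx => hQC x (hPQ hx)), (Finset.mem_filter.1 ha).2, by
        simpa [h.right.notMem] using fun hv => hvQ (hPQ hv)⟩
      (Finset.disjoint_union_right.2 ⟨Finset.disjoint_of_subset_right hPQ hQW, hWT⟩)
    rw [Finset.card_union_of_disjoint hPT, Finset.card_union_of_disjoint hQR] at this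
    have h1 : Q \ P ⊆ (Q ∪ R ∪ T).filter fun x => x ∉ C ∧ ¬ G.Adj v x := by
      intro x hx
      rw [Finset.mem_sdiff] at hx
      simp only [Finset.mem_filter, Finset.mem_union]
      refine ⟨Or.inl (Or.inl hx.1), hQC x hx.1, fun hvx => hx.2 (hlast x hx.1 ?_)⟩
      simp [hx.1, hvx]
    have h2 := Finset.card_le_card h1
    have h3 := Finset.card_sdiff_add_card_eq_card hPQ
    omega

theorem card_le_of_adj_left (h : IsMaxFan G v C p y S r z T) (hpr : G.Adj p r)
    (hM : PathOn G l e' M) (hvl : G.Adj v l) (hvM : v ∉ M) (hMC : Disjoint M C)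
    (hMS : Disjoint M S) (hMT : Disjoint M T) (he : G.Adj e' e) (heS : e ∈ S) :
    M.card ≤ ((S ∪ T).filter fun x => x ∉ C ∧ ¬ G.Adj v x).card := by
  obtain ⟨R, hR, hS⟩ := h.left.path.exists_suffix heS
  have hRS : R ⊆ S := by
    rcases hS with ⟨-, rfl⟩ | ⟨Q, t, -, -, -, rfl⟩
    · exact subset_rfl
    · exact Finset.subset_union_right
  have hMR := Finset.disjoint_of_subset_right hRS hMS
  have hRarm : IsArm G C e y R := ⟨hR, h.left.mem, fun x hx => h.left.eq x (hRS hx)⟩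
  have := h.card_le_of_suffix hpr (R := R) ⟨hRarm.append hM he hMR hMC, hvl, by
    simpa [hvM] using fun hv => h.left.notMem (hRS hv)⟩ hR.right_mem
    (by
      rcases hS with ⟨-, rfl⟩ | ⟨Q, t, h₁, -, h₂, h₃⟩
      · exact Or.inl rfl
      · exact Or.inr ⟨Q, t, h₁, h₂, h₃⟩)
    (Finset.disjoint_union_left.2 ⟨hMT, Finset.disjoint_of_subset_left hRS h.disj⟩)
    (Finset.disjoint_union_left.2
      ⟨Finset.disjoint_of_subset_right Finset.sdiff_subset hMS, Finset.disjoint_sdiff⟩)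
  rw [Finset.card_union_of_disjoint hMR] at this
  omega

/-- If the spokes start at adjacent vertices, then a path from a neighbour of `v` to a neighbour of
the cycle or of a spoke is bounded by the number of non-neighbours of `v` on the spokes. -/
theorem card_le_of_adj (h : IsMaxFan G v C p y S r z T) (hpr : G.Adj p r) (hvC : v ∉ C)
    (hM : PathOn G l e' M) (hvl : G.Adj v l) (hvM : v ∉ M) (hMO : Disjoint M (C ∪ S ∪ T))
    (he : G.Adj e' e) (heO : e ∈ C ∪ S ∪ T) :
    M.card ≤ ((S ∪ T).filter fun x => x ∉ C ∧ ¬ G.Adj v x).card := by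
  rw [Finset.disjoint_union_right, Finset.disjoint_union_right] at hMO
  by_cases heS : e ∈ S
  · exact h.card_le_of_adj_left hpr hM hvl hvM hMO.1.1 hMO.1.2 hMO.2 he heS
  by_cases heT : e ∈ T
  · rw [Finset.union_comm]
    exact h.symm.card_le_of_adj_left hpr.symm hM hvl hvM hMO.1.1 hMO.2 hMO.1.2 he heT
  have heC : e ∈ C := by simpa [heS, heT] using heO
  have heM : Disjoint M {e} := by
    simpa using fun hm => Finset.disjoint_left.1 hMO.1.1 hm heC
  obtain ⟨R, hR, hS⟩ := h.left.path.exists_suffix h.left.path.right_mem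
  have hR1 := hR.eq_singleton
  have := h.card_le_of_suffix hpr (R := R) ⟨(IsArm.single heC).append hM he heM hMO.1.1, hvl, by
    simpa [hvM] using fun hv : v = e => hvC (hv ▸ heC)⟩ hR.right_mem
    (by
      rcases hS with ⟨-, rfl⟩ | ⟨Q, t, h₁, -, h₂, h₃⟩
      · exact Or.inl rfl
      · exact Or.inr ⟨Q, t, h₁, h₂, h₃⟩)
    (Finset.disjoint_union_left.2 ⟨hMO.2, by simpa⟩)
    (Finset.disjoint_union_left.2
      ⟨Finset.disjoint_of_subset_right Finset.sdiff_subset hMO.1.2, by simp [heS]⟩)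
  rw [Finset.card_union_of_disjoint heM, hR1, Finset.card_singleton, Finset.card_singleton] at this
  omega

/-- A vertex of large degree has many neighbours off the cycle and the spokes. -/
theorem card_neighbors_off [Fintype V] (h : IsMaxFan G v C p y S r z T) (hvC : v ∉ C)
    (hdeg : Fintype.card V ≤ 2 * (Finset.univ.filter (G.Adj v)).card)
    (hcyc : 2 * (C.filter (G.Adj v)).card + 2 * (S.card + T.card) ≤ C.card + 4) :
    S.card + T.card + 2 * ((S ∪ T).filter fun x => x ∉ C ∧ ¬ G.Adj v x).card ≤
      (Finset.univ.filter fun x => G.Adj v x ∧ x ∉ C ∪ S ∪ T).card + 1 := by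
  set D := ((S ∪ T).filter (· ∉ C)) with hD
  set B := Finset.univ.filter fun x => G.Adj v x ∧ x ∉ C ∪ S ∪ T with hB
  have hm : ((S ∪ T).filter fun x => x ∉ C ∧ ¬ G.Adj v x) = D.filter fun x => ¬ G.Adj v x := by
    rw [hD, Finset.filter_filter]
  rw [hm]
  have h1 := Finset.card_filter_add_card_filter_not (s := D) (G.Adj v)
  have hy := h.left.path.right_mem
  have hz := h.right.path.right_mem
  have hyz : z ≠ y := fun he => Finset.disjoint_left.1 h.disj hy (he ▸ hz)
  have h2 : D ⊆ ((S ∪ T).erase y).erase z := by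
    intro x hx
    rw [hD, Finset.mem_filter] at hx
    simp only [Finset.mem_erase]
    exact ⟨fun he => hx.2 (he ▸ h.right.mem), fun he => hx.2 (he ▸ h.left.mem), hx.1⟩
  have h3 := Finset.card_le_card h2
  rw [Finset.card_erase_of_mem (by simp [hz, hyz]), Finset.card_erase_of_mem (by simp [hy]),
    Finset.card_union_of_disjoint h.disj] at h3
  have h4 : Finset.univ.filter (G.Adj v) ⊆ C.filter (G.Adj v) ∪ D.filter (G.Adj v) ∪ B := by
    intro x hx
    simp only [hD, hB, Finset.mem_filter, Finset.mem_univ, true_and, Finset.mem_union] at hx ⊢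
    tauto
  have h5 := Finset.card_le_card h4
  have h6 := Finset.card_union_le (C.filter (G.Adj v) ∪ D.filter (G.Adj v)) B
  have h7 := Finset.card_union_le (C.filter (G.Adj v)) (D.filter (G.Adj v))
  have hvS := h.left.notMem
  have hvT := h.right.notMem
  have hdC : Disjoint (insert v C) D := by
    rw [Finset.disjoint_left]
    intro x hx hxD
    rw [hD, Finset.mem_filter, Finset.mem_union] at hxD
    rcases Finset.mem_insert.1 hx with rfl | hx
    · tauto
    · exact hxD.2 hx
  have hdB : Disjoint (insert v C ∪ D) B := by
    rw [Finset.disjoint_left]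
    intro x hx hxB
    simp only [hD, hB, Finset.mem_filter, Finset.mem_univ, true_and, Finset.mem_union,
      Finset.mem_insert] at hx hxB
    rcases hx with (rfl | hx) | hx
    · exact G.irrefl hxB.1
    · tauto
    · tauto
  have h8 := Finset.card_le_univ (insert v C ∪ D ∪ B)
  rw [Finset.card_union_of_disjoint hdB, Finset.card_union_of_disjoint hdC,
    Finset.card_insert_of_notMem hvC] at h8
  have h9 := Finset.card_pos.2 ⟨_, hy⟩
  have h10 := Finset.card_pos.2 ⟨_, hz⟩
  omega

end IsMaxFan

section Reroute

variable {V : Type*} [DecidableEq V] {G : SimpleGraph V} {v : V}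

theorem exists_reroute {B O : Finset V} (hconn : (G.induce {u | u ≠ v}).Connected)
    (hB : B.Nonempty) (hvB : v ∉ B) (hvO : v ∉ O) (hBO : Disjoint B O) (hO : O.Nonempty) :
    ∃ l ∈ B, ∃ L ⊆ B, ∃ M e' e, PathOn G l e' M ∧ L ⊆ M ∧ (∀ x ∈ M, x ∈ B → x ∈ L) ∧
      (∀ x ∈ B, x ∉ L → ¬ G.Adj x l) ∧ l ∈ L ∧ v ∉ M ∧ Disjoint M O ∧ G.Adj e' e ∧ e ∈ O := by
  obtain ⟨b, hb, T, e', e, hT, hTB, hTO, hvT, he, heO⟩ := exists_exit hconn hB hvB hvO hBO hO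
  obtain ⟨l, L, hLB, hL, hmax⟩ := PathOn.exists_maximal G hb
  refine ⟨l, hLB hL.left_mem, L, hLB, L ∪ T, e', e,
    hL.trans hT fun x hx hxT => hTB x hxT (hLB hx), Finset.subset_union_left, ?_, hmax,
    hL.left_mem, ?_, Finset.disjoint_union_left.2
      ⟨Finset.disjoint_of_subset_left hLB hBO, hTO⟩, he, heO⟩
  · intro x hx hxB
    rcases Finset.mem_union.1 hx with hx | hx
    · exact hx
    · exact hTB x hx hxB ▸ hL.right_mem
  · simpa [hvT] using fun hv => hvB (hLB hv)

theorem exists_reroute_of_isClique {B O : Finset V} (hconn : (G.induce {u | u ≠ v}).Connected)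
    (hB : B.Nonempty) (hvB : v ∉ B) (hvO : v ∉ O) (hBO : Disjoint B O) (hO : O.Nonempty)
    (hclique : ∀ x ∈ B, ∀ x' ∈ B, x ≠ x' → G.Adj x x') :
    ∃ l ∈ B, ∃ M e' e, PathOn G l e' M ∧ B ⊆ M ∧ v ∉ M ∧ Disjoint M O ∧ G.Adj e' e ∧ e ∈ O := by
  obtain ⟨l, hl, L, hLB, M, e', e, hM, hLM, -, hmax, hlL, hvM, hMO, he, heO⟩ :=
    exists_reroute hconn hB hvB hvO hBO hO
  refine ⟨l, hl, M, e', e, hM, fun x hx => hLM ?_, hvM, hMO, he, heO⟩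
  by_contra hxL
  exact hmax x hx hxL (hclique x hx l hl fun h => hxL (h ▸ hlL))

end Reroute

namespace IsMaxFan

variable {V : Type*} [DecidableEq V] {G : SimpleGraph V} {v : V} {C : Finset V}
  {p y r z : V} {S T : Finset V}

theorem not_adj_left (h : IsMaxFan G v C p y S r z T) {b : V} (hvb : G.Adj v b)
    (hb : b ∉ C ∪ S ∪ T) : ¬ G.Adj b p := by
  intro hbp
  simp only [Finset.mem_union, not_or] at hb
  have hbS : Disjoint {b} S := by simpa using hb.1.2
  have := h.card_le _ _ _ _ _ _ ⟨h.left.toIsArm.append (.single b) hbp hbS (by simpa using hb.1.1),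
    hvb, by simpa [h.left.notMem] using hvb.ne⟩ h.right
    (Finset.disjoint_union_left.2 ⟨by simpa using hb.2, h.disj⟩)
  rw [Finset.card_union_of_disjoint hbS, Finset.card_singleton] at this
  omega

/-- If `v` has large degree and no four pairwise nonadjacent neighbours, then the off-cycle
neighbours of `v` force a larger pair of spokes. -/
theorem false_of_card_neighbors_off [Fintype V] [DecidableRel G.Adj]
    (h : IsMaxFan G v C p y S r z T) (hconn : (G.induce {u | u ≠ v}).Connected) (hvC : v ∉ C)
    (hind : ∀ a b c d, G.Adj v a → G.Adj v b → G.Adj v c → G.Adj v d → a ≠ b → a ≠ c → a ≠ d →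
      b ≠ c → b ≠ d → c ≠ d → ¬ G.Adj a b → ¬ G.Adj a c → ¬ G.Adj a d → ¬ G.Adj b c →
      ¬ G.Adj b d → G.Adj c d)
    (hcard : S.card + T.card + 2 * ((S ∪ T).filter fun x => x ∉ C ∧ ¬ G.Adj v x).card ≤
      (Finset.univ.filter fun x => G.Adj v x ∧ x ∉ C ∪ S ∪ T).card + 1) : False := by
  set O := C ∪ S ∪ T with hO
  set B := Finset.univ.filter fun x => G.Adj v x ∧ x ∉ O with hB
  have hpS := h.left.path.left_mem
  have hrT := h.right.path.left_mem
  have hS1 := Finset.card_pos.2 ⟨_, hpS⟩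
  have hT1 := Finset.card_pos.2 ⟨_, hrT⟩
  have hpO : p ∈ O := by simp [hO, hpS]
  have hrO : r ∈ O := by simp [hO, hrT]
  have hvO : v ∉ O := by simp [hO, hvC, h.left.notMem, h.right.notMem]
  have hpr : p ≠ r := fun he => Finset.disjoint_left.1 h.disj hpS (he ▸ hrT)
  have hBmem : ∀ x ∈ B, G.Adj v x ∧ x ∉ O := fun x hx => by simpa [hB] using hx
  have hvB : v ∉ B := fun hv => G.irrefl (hBmem v hv).1
  have hBO : Disjoint B O := Finset.disjoint_left.2 fun x hx => (hBmem x hx).2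
  have hBp : ∀ x ∈ B, ¬ G.Adj x p := fun x hx => h.not_adj_left (hBmem x hx).1 (hBmem x hx).2
  have hBr : ∀ x ∈ B, ¬ G.Adj x r := fun x hx => h.symm.not_adj_left (hBmem x hx).1 (by
    have := (hBmem x hx).2
    simp only [hO, Finset.mem_union] at this ⊢
    tauto)
  have hne : ∀ x ∈ B, ∀ o ∈ O, x ≠ o := fun x hx o ho he => (hBmem x hx).2 (he ▸ ho)
  have hBne : B.Nonempty := Finset.card_pos.1 (by omega)
  by_cases hadj : G.Adj p r
  · obtain ⟨l, hl, L, hLB, M, e', e, hM, hLM, hML, hmax, hlL, hvM, hMO, he, heO⟩ :=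
      exists_reroute hconn hBne hvB hvO hBO ⟨p, hpO⟩
    have h1 := h.card_le_of_adj hadj hvC hM (hBmem l hl).1 hvM hMO he heO
    have h2 := Finset.card_le_card hLM
    have h3 := Finset.card_sdiff_add_card_eq_card hLB
    rcases (B \ L).eq_empty_or_nonempty with hE | hE
    · rw [hE, Finset.card_empty] at h3
      omega
    have hsub : B \ L ⊆ B := Finset.sdiff_subset
    have hnel : ∀ x ∈ B \ L, l ≠ x := fun x hx he => (Finset.mem_sdiff.1 hx).2 (he ▸ hlL)
    have hnadj : ∀ x ∈ B \ L, ¬ G.Adj l x := fun x hx ha =>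
      hmax x (hsub hx) (Finset.mem_sdiff.1 hx).2 ha.symm
    have hclique : ∀ x ∈ B \ L, ∀ x' ∈ B \ L, x ≠ x' → G.Adj x x' := by
      intro x hx x' hx' hxx'
      exact hind p l x x' h.left.adj (hBmem l hl).1 (hBmem x (hsub hx)).1 (hBmem x' (hsub hx')).1
        (hne l hl p hpO).symm (hne x (hsub hx) p hpO).symm (hne x' (hsub hx') p hpO).symm
        (hnel x hx) (hnel x' hx') hxx' (fun ha => hBp l hl ha.symm)
        (fun ha => hBp x (hsub hx) ha.symm) (fun ha => hBp x' (hsub hx') ha.symm)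
        (hnadj x hx) (hnadj x' hx')
    obtain ⟨l₂, hl₂, M₂, a', a, hM₂, hLM₂, hvM₂, hMO₂, ha, haO⟩ :=
      exists_reroute_of_isClique (O := O ∪ M) hconn hE (fun hv => hvB (hsub hv))
        (by simp [hvO, hvM])
        (Finset.disjoint_union_right.2 ⟨Finset.disjoint_of_subset_left hsub hBO,
          Finset.disjoint_left.2 fun x hx hxM =>
            (Finset.mem_sdiff.1 hx).2 (hML x hxM (hsub hx))⟩)
        ⟨p, Finset.mem_union_left _ hpO⟩ hclique
    have h4 := Finset.card_le_card hLM₂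
    rw [Finset.disjoint_union_right] at hMO₂
    have h5 : M₂.card ≤ ((S ∪ T).filter fun x => x ∉ C ∧ ¬ G.Adj v x).card := by
      rcases Finset.mem_union.1 haO with haO | haM
      · exact h.card_le_of_adj hadj hvC hM₂ (hBmem _ (hsub hl₂)).1 hvM₂ hMO₂.1 ha haO
      · obtain ⟨M₃, hM₃M, hM₃⟩ := hM.exists_subpath haM
        refine (Finset.card_le_card Finset.subset_union_left).trans
          (h.card_le_of_adj hadj hvC
            (hM₂.append ha hM₃ (Finset.disjoint_of_subset_right hM₃M hMO₂.2))
            (hBmem _ (hsub hl₂)).1 ?_ ?_ he heO)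
        · simpa [hvM₂] using fun hv => hvM (hM₃M hv)
        · exact Finset.disjoint_union_left.2
            ⟨hMO₂.1, Finset.disjoint_of_subset_left hM₃M hMO⟩
    omega
  · have hclique : ∀ x ∈ B, ∀ x' ∈ B, x ≠ x' → G.Adj x x' := by
      intro x hx x' hx' hxx'
      exact hind p r x x' h.left.adj h.right.adj (hBmem x hx).1 (hBmem x' hx').1
        hpr (hne x hx p hpO).symm (hne x' hx' p hpO).symm
        (hne x hx r hrO).symm (hne x' hx' r hrO).symm hxx' hadj
        (fun ha => hBp x hx ha.symm) (fun ha => hBp x' hx' ha.symm)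
        (fun ha => hBr x hx ha.symm) (fun ha => hBr x' hx' ha.symm)
    obtain ⟨l, hl, M, e', e, hM, hBM, hvM, hMO, he, heO⟩ :=
      exists_reroute_of_isClique hconn hBne hvB hvO hBO ⟨p, hpO⟩ hclique
    have h1 := h.card_add_two_le hvC hM (hBmem l hl).1 hvM hMO he heO
    have h2 := Finset.card_le_card hBM
    omega

end IsMaxFan

theorem adj_of_forall_fin_four {V : Type*} {F : SimpleGraph V} {v a b c d : V}
    (h : ∀ l : Fin 4 → V, Function.Injective l → (∀ i, F.Adj v (l i)) →
      ∃ i j, i ≠ j ∧ F.Adj (l i) (l j))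
    (ha : F.Adj v a) (hb : F.Adj v b) (hc : F.Adj v c) (hd : F.Adj v d) (hab : a ≠ b) (hac : a ≠ c)
    (had : a ≠ d) (hbc : b ≠ c) (hbd : b ≠ d) (hcd : c ≠ d) (nab : ¬ F.Adj a b) (nac : ¬ F.Adj a c)
    (nad : ¬ F.Adj a d) (nbc : ¬ F.Adj b c) (nbd : ¬ F.Adj b d) : F.Adj c d := by
  by_contra ncd
  obtain ⟨i, j, hij, hadj⟩ := h ![a, b, c, d]
    (by
      intro i j hij
      fin_cases i <;> fin_cases j <;>
        first
          | rfl
          | exact absurd hij (by assumption)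
          | exact absurd hij.symm (by assumption))
    (by intro i; fin_cases i <;> assumption)
  fin_cases i <;> fin_cases j <;>
    first
      | exact hij rfl
      | exact absurd hadj (by assumption)
      | exact absurd hadj.symm (by assumption)

theorem stmt_6 {V : Type*} [Fintype V] [DecidableEq V] (G : SimpleGraph V)
    [DecidableRel G.Adj] (hG : TwoConnected G)
    (hheavy : ∀ (c : V) (l : Fin 4 → V), Function.Injective l →
      (∀ i, G.Adj c (l i)) → (∀ i j, i ≠ j → ¬ G.Adj (l i) (l j)) →
      ∃ i j, i ≠ j ∧ Fintype.card V ≤ G.degree (l i) + G.degree (l j))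
    (a : V) (C : G.Walk a a) (hC : C.IsCycle)
    (hlong : ∀ (b : V) (C' : G.Walk b b), C'.IsCycle → C'.length ≤ C.length) :
    ∀ v : V, Fintype.card V ≤ 2 * G.degree v → v ∈ C.support := by
  classical
  intro v hdeg
  by_contra hv
  have h3 := hC.three_le_length
  obtain ⟨F, hGF, hFv, hF, hFadj⟩ := exists_closure G v h3 fun S hS => by
    obtain ⟨u, C', hC', hlen⟩ := hS.exists_walk
    exact hlen ▸ hlong u C' hC'
  have hrun := hC.runsAround.mono hGF
  set X := (Finset.range C.length).image fun i => C.getVert (i % C.length) with hX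
  have hvX : v ∉ X := by
    intro hvX
    obtain ⟨i, -, rfl⟩ := Finset.mem_image.1 hvX
    exact hv (C.getVert_mem_support _)
  have hcard : X.card = C.length := hrun.card_image_range
  have hconn : ∀ x, (F.induce {u | u ≠ x}).Connected := fun x =>
    (hG.2 x).mono (comap_monotone _ hGF)
  obtain ⟨p, y, S, r, z, T, hfan⟩ := exists_isMaxFan
    ((HasFan.of_notMem hconn (by omega) hvX).exists_isSpoke hvX)
  refine hfan.false_of_card_neighbors_off (hconn v) hvX ?_ (hfan.card_neighbors_off hvX ?_ ?_)
  · intro a b c d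
    refine adj_of_forall_fin_four fun l hl hvl => ?_
    by_contra! hl'
    obtain ⟨i, j, hij, hle⟩ := hheavy v l hl (fun i => (hFv _).1 (hvl i))
      fun i j hij hadj => hl' i j hij (hGF hadj)
    exact hl' i j hij (hFadj _ _ ((hFv _).1 (hvl i)) ((hFv _).1 (hvl j)) (hl.ne hij) hle)
  · rwa [Finset.filter_congr fun x _ => hFv x, ← neighborFinset_eq_filter,
      card_neighborFinset_eq_degree]
  · rw [hcard]
    exact hrun.cycle_bound hF hvX hfan.left hfan.right hfan.disj
end

section
/- Let G be a 2-connected graph on n vertices containing no induced subgraph isomorphic to K_{1,4}. Then every longest cycle of G contains all vertices of G of degree at least n/2. -/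
open SimpleGraph

section

variable {V : Type*} {G : SimpleGraph V}

theorem List.exists_append_cons_first {α : Type*} {p : α → Prop} {l : List α}
    (h : ∃ a ∈ l, p a) : ∃ l₁ a l₂, l = l₁ ++ a :: l₂ ∧ p a ∧ ∀ b ∈ l₁, ¬ p b := by
  induction l with
  | nil => simp at h
  | cons c l ih =>
    by_cases hc : p c
    · exact ⟨[], c, l, by simp [hc]⟩
    · obtain ⟨l₁, a, l₂, rfl, ha, hl⟩ := ih (by grind)
      exact ⟨c :: l₁, a, l₂, by grind⟩

theorem List.exists_append_cons_last {α : Type*} {p : α → Prop} {l : List α}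
    (h : ∃ a ∈ l, p a) : ∃ l₁ a l₂, l = l₁ ++ a :: l₂ ∧ p a ∧ ∀ b ∈ l₂, ¬ p b := by
  induction l with
  | nil => simp at h
  | cons c l ih =>
    by_cases hc : ∃ a ∈ l, p a
    · obtain ⟨l₁, a, l₂, rfl, ha, hl⟩ := ih hc
      exact ⟨c :: l₁, a, l₂, by grind⟩
    · exact ⟨[], c, l, by grind⟩

theorem exists_maximal_of_bounded {α : Type*} {p : α → Prop} (f : α → ℕ) (B : ℕ)
    (hB : ∀ a, p a → f a ≤ B) (h : ∃ a, p a) : ∃ a, p a ∧ ∀ b, p b → f b ≤ f a := by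
  obtain ⟨a, ha⟩ := h
  by_contra! hc
  have key : ∀ n, ∃ a, p a ∧ n ≤ f a := by
    intro n
    induction n with
    | zero => exact ⟨a, ha, Nat.zero_le _⟩
    | succ n ih =>
      obtain ⟨b, hb, hn⟩ := ih
      obtain ⟨c, hc, hlt⟩ := hc b hb
      exact ⟨c, hc, by omega⟩
  obtain ⟨b, hb, hn⟩ := key (B + 1)
  have := hB b hb
  omega

theorem isChain_adj_reverse {l : List V} (h : l.IsChain G.Adj) : l.reverse.IsChain G.Adj :=
  List.isChain_reverse.2 (h.imp fun _ _ h => h.symm)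

/-- From any vertex outside a set one reaches the set while avoiding a deleted vertex. -/
theorem exists_path_to_set {x : V} (hx : (G.induce {u | u ≠ x}).Connected) {F : Set V}
    {f : V} (hf : f ∈ F) (hfx : f ≠ x) {r : V} (hr : r ≠ x) (hrF : r ∉ F) :
    ∃ (L : List V) (s : V), (r :: L).Nodup ∧ (r :: L ++ [s]).IsChain G.Adj ∧ s ∈ F ∧ s ≠ x ∧
      ∀ y ∈ r :: L, y ∉ F ∧ y ≠ x := by
  obtain ⟨W⟩ := hx.preconnected ⟨r, hr⟩ ⟨f, hfx⟩
  have key : ∀ (a b : ({u | u ≠ x} : Set V)) (W : (G.induce {u | u ≠ x}).Walk a b), b.1 ∈ F →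
      a.1 ∉ F → ∃ (L : List V) (s : V), (a.1 :: L).Nodup ∧ (a.1 :: L ++ [s]).IsChain G.Adj ∧
        s ∈ F ∧ s ≠ x ∧ ∀ y ∈ a.1 :: L, y ∉ F ∧ y ≠ x := by
    intro a b W
    induction W with
    | nil => intro h h'; exact absurd h h'
    | @cons a b c hab W ih =>
      intro hc ha
      have hab' : G.Adj a.1 b.1 := hab
      have ha2 : a.1 ≠ x := a.2
      by_cases hb : b.1 ∈ F
      · exact ⟨[], b.1, by simp, by simpa using hab', hb, b.2, by simp [ha, ha2]⟩
      · obtain ⟨L, s, h1, h2, h3, h4, h5⟩ := ih hc hb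
        by_cases haL : a.1 ∈ b.1 :: L
        · obtain ⟨X, Y, hXY⟩ := List.append_of_mem haL
          refine ⟨Y, s, ?_, ?_, h3, h4, ?_⟩
          · rw [hXY] at h1
            exact (List.nodup_append.1 h1).2.1
          · rw [hXY] at h2
            have : (X ++ (a.1 :: Y ++ [s])).IsChain G.Adj := by simpa using h2
            exact this.right_of_append
          · rw [hXY] at h5
            intro y hy
            exact h5 y (by simp at hy ⊢; tauto)
        · refine ⟨b.1 :: L, s, List.nodup_cons.2 ⟨haL, h1⟩, ?_, h3, h4, ?_⟩
          · simpa using ⟨hab', by simpa using h2⟩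
          · intro y hy
            rcases List.mem_cons.1 hy with rfl | hy
            · exact ⟨ha, ha2⟩
            · exact h5 y hy
  exact key _ _ W hf hrF

/-- `L` is the vertex list of a path with distinct ends `u`, `v` in `S` and no other vertex
in `S`. -/
structure IsEar (G : SimpleGraph V) (S : Finset V) (u v : V) (L : List V) : Prop where
  nodup : L.Nodup
  chain : L.IsChain G.Adj
  head : L.head? = some u
  last : L.getLast? = some v
  ne : u ≠ v
  left_mem : u ∈ S
  right_mem : v ∈ S
  inner : ∀ y ∈ L, y ∈ S → y = u ∨ y = v

theorem IsEar.reverse {S : Finset V} {u v : V} {L : List V} (h : IsEar G S u v L) :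
    IsEar G S v u L.reverse where
  nodup := List.nodup_reverse.2 h.nodup
  chain := isChain_adj_reverse h.chain
  head := by simpa using h.last
  last := by simpa using h.head
  ne := h.ne.symm
  left_mem := h.right_mem
  right_mem := h.left_mem
  inner := by intro y hy hS; exact (h.inner y (by simpa using hy) hS).symm

/-- In a 2-connected graph every vertex lies in `S` or on an ear of `S`. -/
theorem exists_isEar (hG : ∀ v : V, (G.induce {u | u ≠ v}).Connected) {S : Finset V}
    {a b : V} (ha : a ∈ S) (hb : b ∈ S) (hab : a ≠ b) {x : V} (hx : x ∉ S)
    (hc : G.Reachable a x) : ∃ u v L, IsEar G S u v L ∧ x ∈ L := by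
  have other : ∀ w : V, ∃ f ∈ S, f ≠ w := fun w => by
    by_cases h : a = w
    · exact ⟨b, hb, fun h' => hab (h.trans h'.symm)⟩
    · exact ⟨a, ha, h⟩
  have key : ∀ y w : V, G.Walk y w → (w ∈ S ∨ ∃ u v L, IsEar G S u v L ∧ w ∈ L) →
      (y ∈ S ∨ ∃ u v L, IsEar G S u v L ∧ y ∈ L) := by
    intro y w W hw
    induction W with
    | nil => exact hw
    | @cons w w' z hadj W ih =>
      by_cases hwS : w ∈ S
      · exact Or.inl hwS
      right
      have ih' : w' ∈ S ∨ (w' ∉ S ∧ ∃ u v L, IsEar G S u v L ∧ w' ∈ L) := by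
        by_cases h : w' ∈ S
        · exact Or.inl h
        · exact Or.inr ⟨h, (ih hw).resolve_left h⟩
      rcases ih' with hS | ⟨hw'S, u, v, L, hL, hmem⟩
      · obtain ⟨f, hf, hfw⟩ := other w'
        obtain ⟨L, s, h1, h2, h3, h4, h5⟩ := exists_path_to_set (hG w') (F := (S : Set V))
          (by exact_mod_cast hf) hfw hadj.ne (by exact_mod_cast hwS)
        refine ⟨w', s, w' :: (w :: L ++ [s]), ⟨?_, ?_, ?_, ?_, h4.symm, hS, h3, ?_⟩, by simp⟩
        · grind
        · simpa using ⟨hadj.symm, by simpa using h2⟩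
        · simp
        · simp [List.getLast?_cons]
        · grind
      · by_cases hwL : w ∈ L
        · exact ⟨u, v, L, hL, hwL⟩
        obtain ⟨f, hf, hfw⟩ := other w'
        obtain ⟨P, s, h1, h2, h3, h4, h5⟩ := exists_path_to_set (hG w')
          (F := {y | y ∈ S ∨ y ∈ L}) (Or.inl hf) hfw hadj.ne (by simp [hwS, hwL])
        have step : ∀ (u v : V) (L : List V), IsEar G S u v L → w' ∈ L → s ∉ L ∨
            (∃ X Y Z, L = X ++ w' :: Y ++ s :: Z) → (∀ y ∈ w :: P, y ∉ L) →
            (s ∈ L ∨ s ∈ S) →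
            ∃ u v L, IsEar G S u v L ∧ w ∈ L := by
          intro u v L hL hmem hs hP hs'
          rcases hs with hs | ⟨X, Y, Z, rfl⟩
          · obtain ⟨X, Y, rfl⟩ := List.append_of_mem hmem
            have := hL.nodup
            have h6 := hL.head
            have h7 := hL.inner
            have h8 := hL.left_mem
            have h9 := List.isChain_split.1 hL.chain
            refine ⟨u, s, X ++ w' :: (w :: P ++ [s]), ⟨?_, ?_, ?_, ?_, ?_, h8, ?_, ?_⟩, by simp⟩
            · simp only [List.nodup_append, List.nodup_cons, List.mem_append, List.mem_cons,
                List.not_mem_nil, List.nodup_nil] at this h1 hP hs h5 ⊢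
              grind only
            · exact List.isChain_split.2 ⟨h9.1, by simpa using ⟨hadj.symm, by simpa using h2⟩⟩
            · cases X <;> simpa using h6
            · simp [List.getLast?_cons]
            · cases X <;> grind
            · exact hs'.resolve_left hs
            · intro y hy hyS
              have hvY : v ∈ Y := by
                have h10 := hL.last
                have h11 := hL.right_mem
                rcases List.eq_nil_or_concat Y with rfl | ⟨Y', t, rfl⟩
                · simp at h10; grind
                · simp [List.getLast?_append, List.getLast?_cons] at h10; simp [h10]
              simp only [Set.mem_ofPred_eq] at h5
              simp only [List.nodup_append, List.nodup_cons, List.mem_append, List.mem_cons,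
                List.not_mem_nil] at hy h5 h7 this ⊢
              grind only
          · have := hL.nodup
            have h6 := hL.head
            have h7 := hL.inner
            have h9 := List.isChain_split.1 hL.chain
            have h10 : (X ++ w' :: Y).IsChain G.Adj := hL.chain.left_of_append
            have h11 := List.isChain_split.1 h10
            have h12 : (w' :: (w :: P) ++ [s]).IsChain G.Adj := by
              simpa using ⟨hadj.symm, by simpa using h2⟩
            have h13 : ((X ++ w' :: (w :: P)) ++ [s]).IsChain G.Adj := by
              simpa [List.append_assoc] using List.isChain_split.2 ⟨h11.1, h12⟩
            refine ⟨u, v, (X ++ w' :: (w :: P)) ++ s :: Z,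
              ⟨?_, List.isChain_split.2 ⟨h13, h9.2⟩, ?_, ?_, hL.ne, hL.left_mem,
                hL.right_mem, ?_⟩, by simp⟩
            · simp only [List.nodup_append, List.nodup_cons, List.mem_append,
                List.mem_cons] at this h1 hP h5 ⊢
              grind only
            · cases X <;> simpa using h6
            · have := hL.last
              simpa [List.getLast?_append, List.getLast?_cons] using this
            · grind
        by_cases hsL : s ∈ L
        · obtain ⟨X, Y, hXY⟩ := List.append_of_mem hmem
          have hs2 : s ∈ X ∨ s ∈ Y := by grind
          rcases hs2 with hs2 | hs2
          · obtain ⟨X1, X2, rfl⟩ := List.append_of_mem hs2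
            refine step _ _ _ hL.reverse (by simpa using hmem) (Or.inr ⟨Y.reverse, X2.reverse,
              X1.reverse, by simp [hXY]⟩) ?_ (Or.inl (by simpa using hsL))
            intro y hy
            have := h5 y hy
            simp at this ⊢
            tauto
          · obtain ⟨Y1, Y2, rfl⟩ := List.append_of_mem hs2
            refine step _ _ _ hL hmem (Or.inr ⟨X, Y1, Y2, by simp [hXY]⟩) ?_ (Or.inl hsL)
            grind
        · refine step _ _ _ hL hmem (Or.inl hsL) ?_ ?_
          · grind
          · grind
  obtain ⟨W⟩ := hc
  exact (key x a W.reverse (Or.inl ha)).resolve_left hx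

/-- `l₁ ++ x :: l₂` is a longest ear of `S` among those through `x`. -/
structure IsMaxEar (G : SimpleGraph V) (S : Finset V) (x u v : V) (l₁ l₂ : List V) : Prop where
  ear : IsEar G S u v (l₁ ++ x :: l₂)
  notMem : x ∉ S
  max : ∀ u' v' L, IsEar G S u' v' L → x ∈ L → L.length ≤ l₁.length + l₂.length + 1

/-- The vertices of `S` together with the vertices on the two sides of an ear. -/
def earSet (S : Finset V) (l₁ l₂ : List V) : Set V := {y | y ∈ S ∨ y ∈ l₁ ∨ y ∈ l₂}

/-- `T` is the interior of a path from `x` to `s ∈ F` that is otherwise disjoint from `F`. -/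
structure IsLeg (G : SimpleGraph V) (F : Set V) (x : V) (T : List V) (s : V) : Prop where
  nodup : T.Nodup
  chain : (x :: T ++ [s]).IsChain G.Adj
  notMem : x ∉ T
  mem : s ∈ F
  avoid : ∀ t ∈ T, t ∉ F

namespace IsMaxEar

variable {S : Finset V} {x u v : V} {l₁ l₂ : List V}

theorem symm (h : IsMaxEar G S x u v l₁ l₂) :
    IsMaxEar G S x v u l₂.reverse l₁.reverse where
  ear := by simpa using h.ear.reverse
  notMem := h.notMem
  max := by
    intro u' v' L hL hx
    have := h.max u' v' L hL hx
    simp only [List.length_reverse]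
    omega

theorem earSet_symm : earSet S l₂.reverse l₁.reverse = earSet S l₁ l₂ := by
  ext y
  simp only [earSet, List.mem_reverse, Set.mem_ofPred_eq]
  tauto

theorem head_left (h : IsMaxEar G S x u v l₁ l₂) : l₁.head? = some u := by
  have h1 := h.ear.head
  cases l₁ with
  | nil =>
    simp at h1
    exact absurd (h1 ▸ h.ear.left_mem) h.notMem
  | cons a l => simpa using h1

theorem last_right (h : IsMaxEar G S x u v l₁ l₂) : l₂.getLast? = some v := by
  simpa using h.symm.head_left

theorem mem_left (h : IsMaxEar G S x u v l₁ l₂) : u ∈ l₁ := List.mem_of_head? h.head_left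

theorem mem_right (h : IsMaxEar G S x u v l₁ l₂) : v ∈ l₂ := List.mem_of_getLast? h.last_right

theorem nodup (h : IsMaxEar G S x u v l₁ l₂) :
    l₁.Nodup ∧ l₂.Nodup ∧ x ∉ l₁ ∧ x ∉ l₂ ∧ ∀ y ∈ l₁, y ∉ l₂ := by
  have := h.ear.nodup
  simp only [List.nodup_append, List.nodup_cons, List.mem_cons] at this
  grind only

theorem eq_left (h : IsMaxEar G S x u v l₁ l₂) {y : V} (hy : y ∈ l₁) (hS : y ∈ S) : y = u := by
  rcases h.ear.inner y (by simp [hy]) hS with h1 | h1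
  · exact h1
  · exact absurd h.mem_right (h1 ▸ h.nodup.2.2.2.2 y hy)

theorem eq_right (h : IsMaxEar G S x u v l₁ l₂) {y : V} (hy : y ∈ l₂) (hS : y ∈ S) : y = v :=
  h.symm.eq_left (by simpa using hy) hS

theorem self_notMem_earSet (h : IsMaxEar G S x u v l₁ l₂) : x ∉ earSet S l₁ l₂ := by
  have := h.nodup
  have := h.notMem
  simp only [earSet, Set.mem_ofPred_eq]
  tauto

theorem chain (h : IsMaxEar G S x u v l₁ l₂) :
    (l₁ ++ [x]).IsChain G.Adj ∧ (x :: l₂).IsChain G.Adj :=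
  List.isChain_split.1 h.ear.chain

theorem isEar_of_prefix_suffix (h : IsMaxEar G S x u v l₁ l₂) {Y W X Z M : List V} {s : V}
    (hY : Y ≠ []) (h₁ : l₁ = Y ++ W) (h₂ : l₂ = X ++ s :: Z) (hM : M.Nodup)
    (hc : (Y ++ M ++ s :: Z).IsChain G.Adj)
    (hd : ∀ m ∈ M, m ∉ S ∧ m ∉ Y ∧ m ∉ s :: Z) : IsEar G S u v (Y ++ M ++ s :: Z) where
  nodup := by
    have := h.nodup
    simp only [h₁, h₂, List.nodup_append, List.nodup_cons, List.mem_cons, List.mem_append] at *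
    grind only
  chain := hc
  head := by
    have := h.head_left
    cases Y <;> simp_all
  last := by
    have := h.last_right
    simp [h₂, List.getLast?_append, List.getLast?_cons] at this ⊢
    exact this
  ne := h.ear.ne
  left_mem := h.ear.left_mem
  right_mem := h.ear.right_mem
  inner := by
    intro y hy hS
    have h3 := h.eq_left (y := y)
    have h4 := h.eq_right (y := y)
    simp only [h₁, h₂, List.mem_cons, List.mem_append] at *
    grind only

theorem isEar_of_prefix (h : IsMaxEar G S x u v l₁ l₂) {Y W M : List V} {s : V}
    (hY : Y ≠ []) (h₁ : l₁ = Y ++ W) (hs : s ∈ S) (hsu : s ≠ u) (hM : M.Nodup)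
    (hc : (Y ++ M ++ [s]).IsChain G.Adj)
    (hd : ∀ m ∈ M, m ∉ S ∧ m ∉ Y) : IsEar G S u s (Y ++ M ++ [s]) where
  nodup := by
    have := h.nodup
    have h3 := fun hs' => h.eq_left (y := s) hs' hs
    simp only [h₁, List.nodup_append, List.nodup_cons, List.mem_cons, List.mem_append,
      List.not_mem_nil, List.nodup_nil] at *
    grind only
  chain := hc
  head := by
    have := h.head_left
    cases Y <;> simp_all
  last := by simp
  ne := hsu.symm
  left_mem := h.ear.left_mem
  right_mem := hs
  inner := by
    intro y hy hS
    have h3 := h.eq_left (y := y)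
    simp only [h₁, List.mem_cons, List.mem_append, List.not_mem_nil] at *
    grind only

end IsMaxEar

theorem isEar_of_mem {S : Finset V} {s s' : V} {M : List V} (hs : s ∈ S) (hs' : s' ∈ S)
    (hne : s ≠ s') (hM : M.Nodup) (hc : (s :: M ++ [s']).IsChain G.Adj) (hd : ∀ m ∈ M, m ∉ S) :
    IsEar G S s s' (s :: M ++ [s']) where
  nodup := by
    simp only [List.nodup_append, List.nodup_cons, List.mem_cons,
      List.not_mem_nil, List.nodup_nil]
    grind only
  chain := hc
  head := by simp
  last := by simp [List.getLast?_cons]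
  ne := hne
  left_mem := hs
  right_mem := hs'
  inner := by
    intro y hy hS
    simp only [List.mem_cons, List.mem_append, List.not_mem_nil] at *
    grind only

theorem IsLeg.chain_reverse {F : Set V} {x s : V} {T : List V} (h : IsLeg G F x T s) :
    (s :: T.reverse ++ [x]).IsChain G.Adj := by
  simpa using isChain_adj_reverse h.chain

theorem IsLeg.chain_join {F : Set V} {x s s' : V} {T T' : List V} (h : IsLeg G F x T s)
    (h' : IsLeg G F x T' s') : (s :: (T.reverse ++ x :: T') ++ [s']).IsChain G.Adj := by
  have := List.isChain_split.2 ⟨h.chain_reverse, h'.chain⟩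
  simpa using this

theorem isChain_overlap {l₁ l₂ l₃ : List V} {a b : V} (h : (l₁ ++ [a]).IsChain G.Adj)
    (h' : (a :: l₂ ++ [b]).IsChain G.Adj) (h'' : (b :: l₃).IsChain G.Adj) :
    (l₁ ++ a :: l₂ ++ b :: l₃).IsChain G.Adj := by
  rw [List.isChain_split]
  refine ⟨?_, h''⟩
  have := List.isChain_split.2 ⟨h, h'⟩
  simpa using this

namespace IsMaxEar

variable {S : Finset V} {x u v : V} {l₁ l₂ : List V}

theorem leg_length_of_mem_right (h : IsMaxEar G S x u v l₁ l₂) {T : List V} {s : V}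
    (hT : IsLeg G (earSet S l₁ l₂) x T s) (hs : s ∈ l₂) : T.length + 2 ≤ l₁.length + l₂.length := by
  obtain ⟨X, Z, hXZ⟩ := List.append_of_mem hs
  have hu := h.mem_left
  have hne : l₁ ≠ [] := List.ne_nil_of_mem hu
  have hc := h.chain
  have hs2 : (s :: Z).IsChain G.Adj := by
    have := hc.2
    rw [hXZ] at this
    exact (List.isChain_cons_split.1 this).2
  have ear := h.isEar_of_prefix_suffix (Y := l₁) (W := []) hne (by simp) hXZ (M := x :: T)
    (List.nodup_cons.2 ⟨hT.notMem, hT.nodup⟩) (isChain_overlap hc.1 hT.chain hs2) (by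
      intro m hm
      have h1 := h.self_notMem_earSet
      have h2 := hT.avoid m
      simp only [earSet, Set.mem_ofPred_eq, hXZ, List.mem_cons, List.mem_append] at *
      grind only)
  have := h.max _ _ _ ear (by simp)
  have := List.length_pos_of_mem hu
  simp only [hXZ, List.length_append, List.length_cons] at *
  omega

theorem leg_length_of_mem_base (h : IsMaxEar G S x u v l₁ l₂) {T : List V} {s : V}
    (hT : IsLeg G (earSet S l₁ l₂) x T s) (hs : s ∈ S) (hsu : s ≠ u) :
    T.length + 1 ≤ l₂.length := by
  have hne : l₁ ≠ [] := List.ne_nil_of_mem h.mem_left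
  have ear := h.isEar_of_prefix (Y := l₁) (W := []) hne (by simp) hs hsu (M := x :: T)
    (List.nodup_cons.2 ⟨hT.notMem, hT.nodup⟩)
    (isChain_overlap h.chain.1 hT.chain (List.isChain_singleton s)) (by
      intro m hm
      have h1 := h.self_notMem_earSet
      have h2 := hT.avoid m
      simp only [earSet, Set.mem_ofPred_eq, List.mem_cons] at *
      grind only)
  have := h.max _ _ _ ear (by simp)
  simp only [List.length_append, List.length_cons, List.length_nil] at *
  omega

theorem leg_length (h : IsMaxEar G S x u v l₁ l₂) {T : List V} {s : V}
    (hT : IsLeg G (earSet S l₁ l₂) x T s) : T.length + 2 ≤ l₁.length + l₂.length := by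
  have h1 := List.length_pos_of_mem h.mem_left
  by_cases h2 : s ∈ l₂
  · exact h.leg_length_of_mem_right hT h2
  by_cases h3 : s ∈ l₁
  · have := h.symm.leg_length_of_mem_right (T := T) (s := s) (by rwa [earSet_symm])
      (by simpa using h3)
    simp only [List.length_reverse] at this
    omega
  · have hs : s ∈ S := by
      have := hT.mem
      simp only [earSet, Set.mem_ofPred_eq] at this
      tauto
    have := h.leg_length_of_mem_base hT hs (by rintro rfl; exact h3 h.mem_left)
    omega

theorem two_legs_of_mem_right (h : IsMaxEar G S x u v l₁ l₂) {T T' : List V} {s s' : V}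
    (hskip : (l₁ ++ l₂).IsChain G.Adj)
    (hT : IsLeg G (earSet S l₁ l₂) x T s) (hT' : IsLeg G (earSet S l₁ l₂) x T' s')
    (hd : ∀ t ∈ T, t ∉ T') {X Y Z : List V} (hl : l₂ = X ++ s :: Y ++ s' :: Z) :
    T.length + T'.length + 2 ≤ l₁.length + l₂.length := by
  have hne : l₁ ≠ [] := List.ne_nil_of_mem h.mem_left
  have hc : (l₁ ++ (X ++ s :: (T.reverse ++ x :: T')) ++ s' :: Z).IsChain G.Adj := by
    rw [hl] at hskip
    have h1 : ((l₁ ++ X) ++ s :: (Y ++ s' :: Z)).IsChain G.Adj := by simpa using hskip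
    have h2 := List.isChain_split.1 h1
    have h3 := isChain_overlap h2.1 (hT.chain_join hT')
      ((List.isChain_cons_split.1 h2.2).2)
    simpa using h3
  have ear := h.isEar_of_prefix_suffix (Y := l₁) (W := []) hne (by simp) (X := X ++ s :: Y)
    (by simp [hl]) (M := X ++ s :: (T.reverse ++ x :: T')) (by
      have h0 := h.nodup
      have h1 := h.self_notMem_earSet
      have h2 := hT.avoid
      have h3 := hT'.avoid
      have h4 := hT.nodup
      have h5 := hT'.nodup
      have h6 := hT.notMem
      have h7 := hT'.notMem
      simp only [earSet, Set.mem_ofPred_eq, hl, List.mem_cons, List.mem_append, List.nodup_append,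
        List.nodup_cons, List.mem_reverse, List.nodup_reverse] at h0 h1 h2 h3 h4 h5 h6 h7 ⊢
      grind only) hc (by
      intro m hm
      have h0 := h.nodup
      have h1 := h.self_notMem_earSet
      have h2 := hT.avoid m
      have h3 := hT'.avoid m
      have h4 := h.eq_right (y := m)
      have h5 := h.mem_right
      have h6 := h.last_right
      have h7 : v ∈ s' :: Z := by
        simp [hl, List.getLast?_append, List.getLast?_cons] at h6
        rw [← h6]
        cases hz : Z.getLast? with
        | none => simp
        | some a => simp [List.mem_of_getLast? hz]
      simp only [earSet, Set.mem_ofPred_eq, hl, List.mem_cons, List.mem_append, List.nodup_append,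
        List.nodup_cons, List.mem_reverse] at h0 h1 h2 h3 h4 h7 hm ⊢
      grind only)
  have := h.max _ _ _ ear (by simp)
  simp only [hl, List.length_append, List.length_cons, List.length_reverse] at *
  omega

theorem two_legs_of_mem_right_right (h : IsMaxEar G S x u v l₁ l₂) {T T' : List V} {s s' : V}
    (hskip : (l₁ ++ l₂).IsChain G.Adj)
    (hT : IsLeg G (earSet S l₁ l₂) x T s) (hT' : IsLeg G (earSet S l₁ l₂) x T' s')
    (hd : ∀ t ∈ T, t ∉ T') (hss : s ≠ s') (hs : s ∈ l₂) (hs' : s' ∈ l₂) :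
    T.length + T'.length + 2 ≤ l₁.length + l₂.length := by
  obtain ⟨X, Y, rfl⟩ := List.append_of_mem hs
  rcases List.mem_append.1 hs' with h1 | h1
  · obtain ⟨X, Z, rfl⟩ := List.append_of_mem h1
    have := h.two_legs_of_mem_right hskip hT' hT (fun t h1 h2 => hd t h2 h1) (X := X) (Y := Z)
      (Z := Y) (by simp)
    omega
  · obtain ⟨Y, Z, rfl⟩ := List.append_of_mem ((List.mem_cons.1 h1).resolve_left hss.symm)
    exact h.two_legs_of_mem_right hskip hT hT' hd (X := X) (Y := Y) (Z := Z) (by simp)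

theorem nodup_join {F : Set V} {T T' : List V} {s s' : V} (hT : IsLeg G F x T s)
    (hT' : IsLeg G F x T' s') (hd : ∀ t ∈ T, t ∉ T') : (T.reverse ++ x :: T').Nodup := by
  have h4 := hT.nodup
  have h5 := hT'.nodup
  have h6 := hT.notMem
  have h7 := hT'.notMem
  simp only [List.mem_cons, List.nodup_append, List.nodup_cons, List.mem_reverse,
    List.nodup_reverse]
  grind only

theorem notMem_earSet_of_mem_join (h : IsMaxEar G S x u v l₁ l₂) {T T' : List V} {s s' : V}
    (hT : IsLeg G (earSet S l₁ l₂) x T s) (hT' : IsLeg G (earSet S l₁ l₂) x T' s') :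
    ∀ m ∈ T.reverse ++ x :: T', m ∉ S ∧ m ∉ l₁ ∧ m ∉ l₂ := by
  intro m hm
  have h1 := h.self_notMem_earSet
  have h2 := hT.avoid m
  have h3 := hT'.avoid m
  simp only [earSet, Set.mem_ofPred_eq, List.mem_cons, List.mem_append, List.mem_reverse] at *
  grind only

theorem two_legs_of_mem_left_right (h : IsMaxEar G S x u v l₁ l₂) {T T' : List V} {s s' : V}
    (hT : IsLeg G (earSet S l₁ l₂) x T s) (hT' : IsLeg G (earSet S l₁ l₂) x T' s')
    (hd : ∀ t ∈ T, t ∉ T') (hs : s ∈ l₁) (hs' : s' ∈ l₂) :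
    T.length + T'.length + 2 ≤ l₁.length + l₂.length := by
  obtain ⟨X, Y, rfl⟩ := List.append_of_mem hs
  obtain ⟨Y', Z, rfl⟩ := List.append_of_mem hs'
  have hm := h.notMem_earSet_of_mem_join hT hT'
  have hc := h.chain
  have h1 : (X ++ [s]).IsChain G.Adj := by
    have : ((X ++ [s]) ++ (Y ++ [x])).IsChain G.Adj := by simpa using hc.1
    exact this.left_of_append
  have h2 : (s' :: Z).IsChain G.Adj := (List.isChain_cons_split.1 hc.2).2
  have ear := h.isEar_of_prefix_suffix (Y := X ++ [s]) (W := Y) (by simp) (by simp) rfl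
    (nodup_join hT hT' hd)
    (by simpa using isChain_overlap h1 (hT.chain_join hT') h2) (by
      intro m hm'
      have := hm m hm'
      simp only [List.mem_cons, List.mem_append, List.not_mem_nil] at *
      grind only)
  have := h.max _ _ _ ear (by simp)
  simp only [List.length_append, List.length_cons, List.length_reverse, List.length_nil] at *
  omega

theorem two_legs_of_mem_left_base (h : IsMaxEar G S x u v l₁ l₂) {T T' : List V} {s s' : V}
    (hT : IsLeg G (earSet S l₁ l₂) x T s) (hT' : IsLeg G (earSet S l₁ l₂) x T' s')
    (hd : ∀ t ∈ T, t ∉ T') (hs : s ∈ l₁) (hs' : s' ∈ S) (hs'1 : s' ∉ l₁) :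
    T.length + T'.length + 2 ≤ l₁.length + l₂.length := by
  have hu := h.mem_left
  obtain ⟨X, Y, rfl⟩ := List.append_of_mem hs
  have hm := h.notMem_earSet_of_mem_join hT hT'
  have hc := h.chain
  have h1 : (X ++ [s]).IsChain G.Adj := by
    have : ((X ++ [s]) ++ (Y ++ [x])).IsChain G.Adj := by simpa using hc.1
    exact this.left_of_append
  have ear := h.isEar_of_prefix (Y := X ++ [s]) (W := Y) (by simp) (by simp) hs'
    (by rintro rfl; exact hs'1 hu) (nodup_join hT hT' hd)
    (by simpa using isChain_overlap h1 (hT.chain_join hT') (List.isChain_singleton s')) (by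
      intro m hm'
      have := hm m hm'
      simp only [List.mem_cons, List.mem_append, List.not_mem_nil] at *
      grind only)
  have := h.max _ _ _ ear (by simp)
  simp only [List.length_append, List.length_cons, List.length_reverse, List.length_nil] at *
  omega

theorem two_legs_of_mem_base (h : IsMaxEar G S x u v l₁ l₂) {T T' : List V} {s s' : V}
    (hT : IsLeg G (earSet S l₁ l₂) x T s) (hT' : IsLeg G (earSet S l₁ l₂) x T' s')
    (hd : ∀ t ∈ T, t ∉ T') (hss : s ≠ s') (hs : s ∈ S) (hs' : s' ∈ S) :
    T.length + T'.length + 2 ≤ l₁.length + l₂.length := by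
  have ear := isEar_of_mem hs hs' hss (nodup_join hT hT' hd) (hT.chain_join hT')
    fun m hm => (h.notMem_earSet_of_mem_join hT hT' m hm).1
  have := h.max _ _ _ ear (by simp)
  simp only [List.length_append, List.length_cons, List.length_reverse, List.length_nil] at *
  omega

/-- Two disjoint legs with different ends are short in total, provided that the two neighbours
of `x` on the ear are adjacent. -/
theorem two_legs (h : IsMaxEar G S x u v l₁ l₂) {T T' : List V} {s s' : V}
    (hskip : (l₁ ++ l₂).IsChain G.Adj)
    (hT : IsLeg G (earSet S l₁ l₂) x T s) (hT' : IsLeg G (earSet S l₁ l₂) x T' s')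
    (hd : ∀ t ∈ T, t ∉ T') (hss : s ≠ s') :
    T.length + T'.length + 2 ≤ l₁.length + l₂.length := by
  have hd' : ∀ t ∈ T', t ∉ T := fun t h1 h2 => hd t h2 h1
  have hTs : IsLeg G (earSet S l₂.reverse l₁.reverse) x T s := by rwa [earSet_symm]
  have hTs' : IsLeg G (earSet S l₂.reverse l₁.reverse) x T' s' := by rwa [earSet_symm]
  have hskip' : (l₂.reverse ++ l₁.reverse).IsChain G.Adj := by
    simpa using isChain_adj_reverse hskip
  have key : s ∈ l₁ ∨ s ∈ l₂ ∨ (s ∈ S ∧ s ∉ l₁ ∧ s ∉ l₂) := by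
    have := hT.mem
    simp only [earSet, Set.mem_ofPred_eq] at this
    tauto
  have key' : s' ∈ l₁ ∨ s' ∈ l₂ ∨ (s' ∈ S ∧ s' ∉ l₁ ∧ s' ∉ l₂) := by
    have := hT'.mem
    simp only [earSet, Set.mem_ofPred_eq] at this
    tauto
  rcases key with h1 | h1 | h1 <;> rcases key' with h2 | h2 | h2
  · have := h.symm.two_legs_of_mem_right_right hskip' hTs hTs' hd hss (by simpa using h1)
      (by simpa using h2)
    simp only [List.length_reverse] at this
    omega
  · exact h.two_legs_of_mem_left_right hT hT' hd h1 h2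
  · exact h.two_legs_of_mem_left_base hT hT' hd h1 h2.1 h2.2.1
  · have := h.two_legs_of_mem_left_right hT' hT hd' h2 h1
    omega
  · exact h.two_legs_of_mem_right_right hskip hT hT' hd hss h1 h2
  · have := h.symm.two_legs_of_mem_left_base hTs hTs' hd (by simpa using h1) h2.1
      (by simpa using h2.2.2)
    simp only [List.length_reverse] at this
    omega
  · have := h.two_legs_of_mem_left_base hT' hT hd' h2 h1.1 h1.2.1
    omega
  · have := h.symm.two_legs_of_mem_left_base hTs' hTs hd' (by simpa using h2) h1.1
      (by simpa using h1.2.2)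
    simp only [List.length_reverse] at this
    omega
  · exact h.two_legs_of_mem_base hT hT' hd hss h1.1 h2.1

end IsMaxEar

/-- No vertex has four pairwise distinct and pairwise nonadjacent neighbours. -/
def StarFree (G : SimpleGraph V) : Prop :=
  ∀ c a b d e, G.Adj c a → G.Adj c b → G.Adj c d → G.Adj c e → a ≠ b → a ≠ d → a ≠ e → b ≠ d →
    b ≠ e → d ≠ e → G.Adj a b ∨ G.Adj a d ∨ G.Adj a e ∨ G.Adj b d ∨ G.Adj b e ∨ G.Adj d e

open Classical in
/-- A longest ear through `x`, whose neighbours on the ear are `p` and `m`, together with a leg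
starting in `t` that contains as many neighbours of `x` outside the ear (the set `R`) as
possible. -/
structure IsConfig (G : SimpleGraph V) (S : Finset V) (x u v : V) (l₁ l₂ : List V) (R : Finset V)
    (T : List V) (s t p m : V) : Prop where
  ear : IsMaxEar G S x u v l₁ l₂
  star : StarFree G
  mem_R : ∀ r, r ∈ R ↔ G.Adj x r ∧ r ∉ earSet S l₁ l₂
  leg : IsLeg G (earSet S l₁ l₂) x T s
  best : ∀ T' s', IsLeg G (earSet S l₁ l₂) x T' s' →
    (R.filter (· ∈ T')).card ≤ (R.filter (· ∈ T)).card
  card_le : l₁.length + l₂.length ≤ R.card + 1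
  head : T.head? = some t
  last_left : l₁.getLast? = some p
  head_right : l₂.head? = some m

namespace IsConfig

variable {S : Finset V} {x u v : V} {l₁ l₂ : List V} {R : Finset V} {T : List V} {s t p m : V}

theorem symm (h : IsConfig G S x u v l₁ l₂ R T s t p m) :
    IsConfig G S x v u l₂.reverse l₁.reverse R T s t m p where
  ear := h.ear.symm
  star := h.star
  mem_R := by simpa only [IsMaxEar.earSet_symm] using h.mem_R
  leg := by simpa only [IsMaxEar.earSet_symm] using h.leg
  best := by simpa only [IsMaxEar.earSet_symm] using h.best
  card_le := by
    have := h.card_le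
    simp only [List.length_reverse]
    omega
  head := h.head
  last_left := by simpa using h.head_right
  head_right := by simpa using h.last_left

theorem eq_left (h : IsConfig G S x u v l₁ l₂ R T s t p m) : ∃ A, l₁ = A ++ [p] := by
  have := h.last_left
  exact List.getLast?_eq_some_iff.1 this

theorem eq_right (h : IsConfig G S x u v l₁ l₂ R T s t p m) : ∃ B, l₂ = m :: B :=
  List.head?_eq_some_iff.1 h.head_right

theorem eq_leg (h : IsConfig G S x u v l₁ l₂ R T s t p m) : ∃ T₀, T = t :: T₀ :=
  List.head?_eq_some_iff.1 h.head

theorem mem_of_best (h : IsConfig G S x u v l₁ l₂ R T s t p m) {T' : List V} {s' : V}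
    (hT' : IsLeg G (earSet S l₁ l₂) x T' s') (hsub : ∀ r ∈ R, r ∈ T → r ∈ T') {r : V}
    (hr : r ∈ R) (hrT : r ∈ T') : r ∈ T := by
  classical
  have h1 : R.filter (· ∈ T) ⊆ R.filter (· ∈ T') := by
    intro y hy
    rw [Finset.mem_filter] at hy ⊢
    exact ⟨hy.1, hsub y hy.1 hy.2⟩
  have h2 := Finset.eq_of_subset_of_card_le h1 (by convert h.best T' s' hT')
  have h3 : r ∈ R.filter (· ∈ T') := Finset.mem_filter.2 ⟨hr, hrT⟩
  rw [← h2] at h3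
  exact (Finset.mem_filter.1 h3).2

theorem not_adj_left (h : IsConfig G S x u v l₁ l₂ R T s t p m) {r : V} (hr : r ∈ R) :
    ¬ G.Adj p r := by
  intro hpr
  obtain ⟨A, hA⟩ := h.eq_left
  obtain ⟨B, hB⟩ := h.eq_right
  have hr' := (h.mem_R r).1 hr
  have hxr := hr'.1.symm
  have hc := h.ear.chain
  have hc1 : (A ++ [p]).IsChain G.Adj := by
    have h1 := hc.1
    rw [hA] at h1
    exact h1.left_of_append
  have ear := h.ear.isEar_of_prefix_suffix (Y := l₁) (W := []) (X := []) (M := [r, x])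
    (by simp [hA]) (by simp) (by simpa using hB) (by simpa using hxr.ne) (by
      have h2 : ([p, r, x] : List V).IsChain G.Adj := by simp [hpr, hxr]
      have h3 := hc.2
      rw [hB] at h3
      have h4 := List.isChain_split.2 ⟨hc1, h2⟩
      have h5 : ((A ++ [p, r]) ++ [x]).IsChain G.Adj := by simpa using h4
      have h6 := List.isChain_split.2 ⟨h5, h3⟩
      simpa [hA] using h6) (by
      intro y hy
      have h1 := h.ear.self_notMem_earSet
      have h2 := hr'.2
      simp only [earSet, Set.mem_ofPred_eq, ← hB, List.mem_cons, List.not_mem_nil] at *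
      grind only)
  have := h.ear.max _ _ _ ear (by simp)
  simp only [hB, List.length_append, List.length_cons, List.length_nil] at this
  omega

theorem not_adj_right (h : IsConfig G S x u v l₁ l₂ R T s t p m) {r : V} (hr : r ∈ R) :
    ¬ G.Adj m r := h.symm.not_adj_left hr

theorem mem_leg (h : IsConfig G S x u v l₁ l₂ R T s t p m) : t ∈ T := List.mem_of_head? h.head

theorem mem_left (h : IsConfig G S x u v l₁ l₂ R T s t p m) : p ∈ l₁ :=
  List.mem_of_getLast? h.last_left

theorem mem_right (h : IsConfig G S x u v l₁ l₂ R T s t p m) : m ∈ l₂ :=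
  List.mem_of_head? h.head_right

theorem adj_left (h : IsConfig G S x u v l₁ l₂ R T s t p m) : G.Adj x p := by
  obtain ⟨A, hA⟩ := h.eq_left
  have h1 := h.ear.chain.1
  rw [hA] at h1
  have h2 : (A ++ p :: [x]).IsChain G.Adj := by simpa using h1
  have h3 := (List.isChain_split.1 h2).2
  have h4 : G.Adj p x := by simpa using h3
  exact h4.symm

theorem adj_right (h : IsConfig G S x u v l₁ l₂ R T s t p m) : G.Adj x m := h.symm.adj_left

theorem head_mem_R (h : IsConfig G S x u v l₁ l₂ R T s t p m) : t ∈ R := by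
  obtain ⟨T₀, hT⟩ := h.eq_leg
  have h1 := h.leg.chain
  rw [hT] at h1
  exact (h.mem_R t).2 ⟨by simp at h1; exact h1.1, h.leg.avoid t h.mem_leg⟩

theorem ne_of_mem_R (h : IsConfig G S x u v l₁ l₂ R T s t p m) {r y : V} (hr : r ∈ R)
    (hy : y ∈ earSet S l₁ l₂) : r ≠ y := by
  rintro rfl
  exact ((h.mem_R r).1 hr).2 hy

theorem left_mem_earSet (h : IsConfig G S x u v l₁ l₂ R T s t p m) : p ∈ earSet S l₁ l₂ :=
  Or.inr (Or.inl h.mem_left)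

theorem right_mem_earSet (h : IsConfig G S x u v l₁ l₂ R T s t p m) : m ∈ earSet S l₁ l₂ :=
  Or.inr (Or.inr h.mem_right)

theorem not_adj_head (h : IsConfig G S x u v l₁ l₂ R T s t p m) {r : V} (hr : r ∈ R)
    (hrT : r ∉ T) : ¬ G.Adj r t := by
  intro hrt
  obtain ⟨T₀, hT⟩ := h.eq_leg
  have hxr := (h.mem_R r).1 hr
  have h1 : IsLeg G (earSet S l₁ l₂) x (r :: T) s := by
    refine ⟨List.nodup_cons.2 ⟨hrT, h.leg.nodup⟩, ?_, ?_, h.leg.mem, ?_⟩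
    · have h2 := h.leg.chain
      rw [hT] at h2 ⊢
      simp at h2 ⊢
      exact ⟨hxr.1, hrt, h2.2⟩
    · simpa using ⟨hxr.1.ne, h.leg.notMem⟩
    · intro y hy
      rcases List.mem_cons.1 hy with rfl | hy
      · exact hxr.2
      · exact h.leg.avoid y hy
  exact hrT (h.mem_of_best h1 (fun y _ hy => by simp [hy]) hr (by simp))

theorem exists_notMem (h : IsConfig G S x u v l₁ l₂ R T s t p m) : ∃ r ∈ R, r ∉ T := by
  classical
  by_contra! hc
  have h1 : R ⊆ T.toFinset := fun r hr => by simpa using hc r hr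
  have h2 := (Finset.card_le_card h1).trans T.toFinset_card_le
  have h3 := h.ear.leg_length h.leg
  have h4 := h.card_le
  omega

theorem clique (h : IsConfig G S x u v l₁ l₂ R T s t p m) {r r' : V} (hr : r ∈ R)
    (hr' : r' ∈ R) (hrT : r ∉ T) (hrT' : r' ∉ T) (hne : r ≠ r') : G.Adj r r' := by
  have ht := h.head_mem_R
  have hp := h.left_mem_earSet
  have := h.star x t r r' p ((h.mem_R t).1 ht).1 ((h.mem_R r).1 hr).1 ((h.mem_R r').1 hr').1
    h.adj_left (by rintro rfl; exact hrT h.mem_leg) (by rintro rfl; exact hrT' h.mem_leg)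
    (h.ne_of_mem_R ht hp) hne (h.ne_of_mem_R hr hp) (h.ne_of_mem_R hr' hp)
  have h1 := h.not_adj_head hr hrT
  have h2 := h.not_adj_head hr' hrT'
  have h3 := h.not_adj_left ht
  have h4 := h.not_adj_left hr
  have h5 := h.not_adj_left hr'
  simp only [G.adj_comm r t, G.adj_comm r' t, G.adj_comm p] at h1 h2 h3 h4 h5
  tauto

theorem skip (h : IsConfig G S x u v l₁ l₂ R T s t p m) : (l₁ ++ l₂).IsChain G.Adj := by
  have hpm : G.Adj p m := by
    obtain ⟨r, hr, hrT⟩ := h.exists_notMem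
    have ht := h.head_mem_R
    have hp := h.left_mem_earSet
    have hm := h.right_mem_earSet
    have := h.star x t r p m ((h.mem_R t).1 ht).1 ((h.mem_R r).1 hr).1
      h.adj_left h.adj_right (by rintro rfl; exact hrT h.mem_leg)
      (h.ne_of_mem_R ht hp) (h.ne_of_mem_R ht hm) (h.ne_of_mem_R hr hp) (h.ne_of_mem_R hr hm)
      (by rintro rfl; exact h.ear.nodup.2.2.2.2 _ h.mem_left h.mem_right)
    have h1 := h.not_adj_head hr hrT
    have h3 := h.not_adj_left ht
    have h4 := h.not_adj_left hr
    have h5 := h.not_adj_right ht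
    have h6 := h.not_adj_right hr
    simp only [G.adj_comm r t, G.adj_comm p t, G.adj_comm p r, G.adj_comm m] at h1 h3 h4 h5 h6
    tauto
  obtain ⟨A, hA⟩ := h.eq_left
  obtain ⟨B, hB⟩ := h.eq_right
  have h1 := h.ear.chain.1.left_of_append
  have h3 := h.ear.chain.2
  rw [hB] at h3
  rw [hA] at h1
  have h4 : (m :: B).IsChain G.Adj := by simp at h3 ⊢; exact h3.2
  have h5 : (p :: m :: B).IsChain G.Adj := by simpa using ⟨hpm, h4⟩
  have := List.isChain_split.2 ⟨h1, h5⟩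
  simpa [hA, hB] using this

end IsConfig

/-- `z` is the end of a path from `x` that contains all neighbours of `x` missed by the ear and by
the leg `T`, and is otherwise disjoint from the ear and from `T`. -/
def IsAttach (G : SimpleGraph V) (S : Finset V) (x : V) (l₁ l₂ : List V) (R : Finset V)
    (T : List V) (z : V) (L : List V) : Prop :=
  IsLeg G {y | y ∈ earSet S l₁ l₂ ∨ y ∈ T} x L z ∧ ∀ r ∈ R, r ∉ T → r ∈ L

namespace IsConfig

variable {S : Finset V} {x u v : V} {l₁ l₂ : List V} {R : Finset V} {T : List V} {s t p m : V}

theorem notMem_R (h : IsConfig G S x u v l₁ l₂ R T s t p m) : x ∉ R := fun hx =>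
  G.loopless.irrefl x ((h.mem_R x).1 hx).1

theorem exists_isAttach_of_path (h : IsConfig G S x u v l₁ l₂ R T s t p m) {r z : V} {L : List V}
    (hr : r ∈ R) (hrT : r ∉ T) (hn : (r :: L).Nodup) (hc : (r :: L ++ [z]).IsChain G.Adj)
    (hz : z ∈ {y | y ∈ earSet S l₁ l₂ ∨ y ∈ T})
    (hd : ∀ y ∈ r :: L, y ∉ {y | y ∈ earSet S l₁ l₂ ∨ y ∈ T} ∧ y ≠ x) :
    ∃ L, IsAttach G S x l₁ l₂ R T z L := by
  classical
  obtain ⟨A, r₀, B, hAB, ⟨hr₀, hrT₀⟩, hB⟩ := List.exists_append_cons_last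
    (p := fun y => y ∈ R ∧ y ∉ T) ⟨r, List.mem_cons_self, hr, hrT⟩
  rw [hAB] at hn hc hd
  set O := ((R.filter (· ∉ T)).erase r₀).toList with hO
  have hOm : ∀ y, y ∈ O ↔ y ≠ r₀ ∧ y ∈ R ∧ y ∉ T := by
    intro y
    simp [hO]
  have hOn : O.Nodup := Finset.nodup_toList _
  refine ⟨O ++ r₀ :: B, ⟨?_, ?_, ?_, hz, ?_⟩, ?_⟩
  · simp only [List.nodup_append, List.nodup_cons, List.mem_cons] at hn ⊢
    grind only
  · have h1 : (x :: O ++ [r₀]).IsChain G.Adj := by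
      apply List.Pairwise.isChain
      have h2 : (O ++ [r₀]).Nodup := by
        simp only [List.nodup_append, List.nodup_cons, List.mem_cons, List.not_mem_nil,
          List.nodup_nil]
        grind only
      have h4 : ∀ y ∈ O ++ [r₀], y ∈ R ∧ y ∉ T := by
        intro y hy
        simp only [List.mem_append, List.mem_cons, List.not_mem_nil] at hy
        grind only
      rw [List.cons_append, List.pairwise_cons]
      refine ⟨fun y hy => ((h.mem_R y).1 (h4 y hy).1).1, ?_⟩
      exact List.Pairwise.imp_of_mem
        (fun ha hb hab => h.clique (h4 _ ha).1 (h4 _ hb).1 (h4 _ ha).2 (h4 _ hb).2 hab) h2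
    have h2 : (A ++ r₀ :: (B ++ [z])).IsChain G.Adj := by simpa using hc
    have h3 := List.isChain_split.2 ⟨h1, (List.isChain_split.1 h2).2⟩
    simpa using h3
  · intro hx
    rcases List.mem_append.1 hx with hx | hx
    · exact h.notMem_R ((hOm x).1 hx).2.1
    · exact (hd x (List.mem_append_right A hx)).2 rfl
  · intro y hy
    rcases List.mem_append.1 hy with hy | hy
    · have h1 := (hOm y).1 hy
      rintro (h2 | h2)
      · exact ((h.mem_R y).1 h1.2.1).2 h2
      · exact h1.2.2 h2
    · exact (hd y (List.mem_append_right A hy)).1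
  · intro y hy hyT
    by_cases hyr : y = r₀
    · simp [hyr]
    · exact List.mem_append_left _ ((hOm y).2 ⟨hyr, hy, hyT⟩)

theorem exists_isAttach_of_adj (h : IsConfig G S x u v l₁ l₂ R T s t p m) {r z : V}
    (hr : r ∈ R) (hrT : r ∉ T) (hz : z ∈ {y | y ∈ earSet S l₁ l₂ ∨ y ∈ T}) (hrz : G.Adj r z) :
    ∃ L, IsAttach G S x l₁ l₂ R T z L := by
  have h1 := (h.mem_R r).1 hr
  refine h.exists_isAttach_of_path (L := []) hr hrT (by simp) (by simpa using hrz) hz ?_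
  simpa only [List.mem_singleton, forall_eq] using ⟨fun h2 => h2.elim h1.2 hrT, h1.1.ne'⟩

theorem exists_isAttach (h : IsConfig G S x u v l₁ l₂ R T s t p m)
    (hG : (G.induce {u | u ≠ x}).Connected) :
    ∃ z L, IsAttach G S x l₁ l₂ R T z L := by
  obtain ⟨r, hr, hrT⟩ := h.exists_notMem
  have h1 := (h.mem_R r).1 hr
  obtain ⟨L, z, h2, h3, h4, -, h5⟩ := exists_path_to_set hG
    (F := {y | y ∈ earSet S l₁ l₂ ∨ y ∈ T}) (Or.inl h.left_mem_earSet) h.adj_left.ne' h1.1.ne'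
    (fun h2 => h2.elim h1.2 hrT)
  exact ⟨z, h.exists_isAttach_of_path hr hrT h2 h3 h4 h5⟩

theorem _root_.IsAttach.isLeg {z : V} {L : List V}
    (hL : IsAttach G S x l₁ l₂ R T z L) (hz : z ∈ earSet S l₁ l₂) :
    IsLeg G (earSet S l₁ l₂) x L z :=
  ⟨hL.1.nodup, hL.1.chain, hL.1.notMem, hz, fun y hy h1 => hL.1.avoid y hy (Or.inl h1)⟩

theorem _root_.IsAttach.card_le {z : V} {L T' : List V} (hL : IsAttach G S x l₁ l₂ R T z L)
    (hT' : ∀ r ∈ R, r ∈ T → r ∈ T') :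
    R.card ≤ T'.length + L.length := by
  classical
  have h1 : R ⊆ (T' ++ L).toFinset := by
    intro r hr
    simp only [List.mem_toFinset, List.mem_append]
    by_cases hrT : r ∈ T
    · exact Or.inl (hT' r hr hrT)
    · exact Or.inr (hL.2 r hr hrT)
  have h2 := (Finset.card_le_card h1).trans (List.toFinset_card_le _)
  simpa using h2

/-- Two disjoint legs with different ends cannot contain all of `R`. -/
theorem two_legs_absurd (h : IsConfig G S x u v l₁ l₂ R T s t p m) {z y : V} {L T' : List V}
    (hL : IsAttach G S x l₁ l₂ R T z L) (hz : z ∈ earSet S l₁ l₂)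
    (hT' : IsLeg G (earSet S l₁ l₂) x T' y) (hsub : ∀ r ∈ R, r ∈ T → r ∈ T')
    (hsub' : ∀ r ∈ T', r ∈ T) (hyz : y ≠ z) : False := by
  have h1 := h.ear.two_legs h.skip hT' (hL.isLeg hz)
    (fun r h1 h2 => hL.1.avoid r h2 (Or.inr (hsub' r h1))) hyz
  have h2 := hL.card_le hsub
  have h3 := h.card_le
  omega

theorem mem_or_eq_of_isAttach (h : IsConfig G S x u v l₁ l₂ R T s t p m) {z : V} {L : List V}
    (hL : IsAttach G S x l₁ l₂ R T z L) : z ∈ T ∨ z = s := by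
  by_contra! hc
  have hz : z ∈ earSet S l₁ l₂ := hL.1.mem.resolve_right hc.1
  exact h.two_legs_absurd hL hz h.leg (fun _ _ h => h) (fun _ h => h) hc.2.symm

/-- Rerouting a leg: from `x` to `z` along `L`, then inside `T` along `M` to the end `y`. -/
theorem isLeg_reroute (h : IsConfig G S x u v l₁ l₂ R T s t p m) {z y : V} {L M : List V}
    (hL : IsAttach G S x l₁ l₂ R T z L) (hM : (z :: M).Nodup) (hMT : ∀ a ∈ z :: M, a ∈ T)
    (hc : (z :: M ++ [y]).IsChain G.Adj) (hy : y ∈ earSet S l₁ l₂) :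
    IsLeg G (earSet S l₁ l₂) x (L ++ z :: M) y := by
  have hav := hL.1.avoid
  refine ⟨?_, ?_, ?_, hy, ?_⟩
  · have h1 := hL.1.nodup
    simp only [Set.mem_ofPred_eq] at hav
    simp only [List.nodup_append, List.nodup_cons, List.mem_cons] at hM hMT h1 ⊢
    grind only
  · have := List.isChain_split.2 ⟨hL.1.chain, hc⟩
    simpa using this
  · intro hx
    rcases List.mem_append.1 hx with hx | hx
    · exact hL.1.notMem hx
    · exact h.leg.notMem (hMT x hx)
  · intro a ha h1
    rcases List.mem_append.1 ha with ha | ha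
    · exact hav a ha (Or.inl h1)
    · exact h.leg.avoid a (hMT a ha) h1

/-- No leg contains all of `R`. -/
theorem not_forall_mem (h : IsConfig G S x u v l₁ l₂ R T s t p m) {T' : List V} {y : V}
    (hT' : IsLeg G (earSet S l₁ l₂) x T' y) (hsub : ∀ r ∈ R, r ∈ T') : False := by
  obtain ⟨r, hr, hrT⟩ := h.exists_notMem
  exact hrT (h.mem_of_best hT' (fun r hr _ => hsub r hr) hr (hsub r hr))

/-- The attachment that comes last along the leg. -/
theorem exists_last_isAttach (h : IsConfig G S x u v l₁ l₂ R T s t p m)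
    (hG : (G.induce {u | u ≠ x}).Connected) :
    ∃ X z Y L, T ++ [s] = X ++ z :: Y ∧ IsAttach G S x l₁ l₂ R T z L ∧
      ∀ y ∈ Y, ∀ L', ¬ IsAttach G S x l₁ l₂ R T y L' := by
  obtain ⟨z, L, hL⟩ := h.exists_isAttach hG
  have hz : z ∈ T ++ [s] := by simpa using h.mem_or_eq_of_isAttach hL
  obtain ⟨X, z, Y, h1, ⟨L, hL⟩, h3⟩ := List.exists_append_cons_last
    (p := fun z => ∃ L, IsAttach G S x l₁ l₂ R T z L) ⟨z, hz, L, hL⟩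
  exact ⟨X, z, Y, L, h1, hL, fun y hy L' h4 => h3 y hy ⟨L', h4⟩⟩

theorem notMem_leg (h : IsConfig G S x u v l₁ l₂ R T s t p m) {y : V}
    (hy : y ∈ earSet S l₁ l₂) : y ∉ T := fun h1 => h.leg.avoid y h1 hy

theorem head_eq_of_eq (h : IsConfig G S x u v l₁ l₂ R T s t p m) {X Y : List V} {z : V}
    (hT : T = X ++ z :: Y) : ∃ P, z :: X.reverse = P ++ [t] := by
  have h1 := h.head
  rw [hT] at h1
  cases X with
  | nil => exact ⟨[], by simpa using h1⟩
  | cons a X =>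
    obtain rfl : a = t := by simpa using h1
    exact ⟨z :: X.reverse, by simp⟩

theorem isChain_reverse_append (h : IsConfig G S x u v l₁ l₂ R T s t p m) {X Y M : List V}
    {z y : V} (hT : T = X ++ z :: Y) (hty : G.Adj t y) (hM : (y :: M).IsChain G.Adj) :
    (z :: X.reverse ++ y :: M).IsChain G.Adj := by
  obtain ⟨P, hP⟩ := h.head_eq_of_eq hT
  have h1 : (z :: X.reverse).IsChain G.Adj := by
    have h2 := h.leg.chain
    rw [hT] at h2
    have h3 : ([x] ++ ((X ++ [z]) ++ (Y ++ [s]))).IsChain G.Adj := by simpa using h2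
    simpa using isChain_adj_reverse h3.right_of_append.left_of_append
  rw [hP] at h1 ⊢
  have h4 : (t :: y :: M).IsChain G.Adj := by simpa using ⟨hty, hM⟩
  have := List.isChain_split.2 ⟨h1, h4⟩
  simpa using this

theorem notMem_R_of_last_isAttach (h : IsConfig G S x u v l₁ l₂ R T s t p m) {X Y L : List V}
    {z : V} (hT : T = X ++ z :: Y) (hL : IsAttach G S x l₁ l₂ R T z L)
    (hlast : ∀ y ∈ Y, ∀ L', ¬ IsAttach G S x l₁ l₂ R T y L') : ∀ y ∈ Y, y ∉ R := by
  by_contra! hc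
  obtain ⟨Y₀, y, Y₁, hY, hyR, hY₀⟩ := List.exists_append_cons_first (p := fun y => y ∈ R) hc
  obtain ⟨r, hr, hrT⟩ := h.exists_notMem
  have hyT : y ∈ T := by simp [hT, hY]
  have htR := h.head_mem_R
  have htT : t ∈ z :: X.reverse := by
    obtain ⟨P, hP⟩ := h.head_eq_of_eq hT
    simp [hP]
  have hn := h.leg.nodup
  have hty : t ≠ y := by
    rintro rfl
    simp only [hT, hY, List.nodup_append, List.nodup_cons, List.mem_cons, List.mem_append,
      List.mem_reverse] at hn htT
    grind only
  have hadj : G.Adj t y := by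
    have hp := h.left_mem_earSet
    have h0 := h.star x t y r p ((h.mem_R t).1 htR).1 ((h.mem_R y).1 hyR).1 ((h.mem_R r).1 hr).1
      h.adj_left hty (by rintro rfl; exact hrT h.mem_leg) (h.ne_of_mem_R htR hp)
      (by rintro rfl; exact hrT hyT) (h.ne_of_mem_R hyR hp) (h.ne_of_mem_R hr hp)
    have h1 := h.not_adj_head hr hrT
    have h3 := h.not_adj_left htR
    have h4 := h.not_adj_left hr
    have h5 := h.not_adj_left hyR
    have h6 : ¬ G.Adj r y := by
      intro h6
      obtain ⟨L', hL'⟩ := h.exists_isAttach_of_adj hr hrT (Or.inr hyT) h6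
      exact hlast y (by simp [hY]) L' hL'
    simp only [G.adj_comm r t, G.adj_comm r y, G.adj_comm p] at h1 h3 h4 h5 h6
    tauto
  have hch : (y :: (Y₁ ++ [s])).IsChain G.Adj := by
    have h2 := h.leg.chain
    rw [hT, hY] at h2
    have h3 : ((x :: X ++ z :: Y₀) ++ (y :: (Y₁ ++ [s]))).IsChain G.Adj := by simpa using h2
    exact h3.right_of_append
  have h1 := h.isChain_reverse_append hT hadj hch
  have h2 := h.isLeg_reroute hL (M := X.reverse ++ y :: Y₁) (y := s) (by
    simp only [hT, hY, List.nodup_append, List.nodup_cons, List.mem_cons, List.mem_append,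
      List.mem_reverse, List.nodup_reverse] at hn ⊢
    grind only) (by
    intro a ha
    simp only [hT, hY, List.mem_cons, List.mem_append, List.mem_reverse] at ha ⊢
    grind only) (by simpa using h1) h.leg.mem
  refine h.not_forall_mem h2 fun a ha => ?_
  by_cases haT : a ∈ T
  · have := hY₀ a
    simp only [hT, hY, List.mem_cons, List.mem_append, List.mem_reverse] at haT ⊢
    grind only
  · exact List.mem_append_left _ (hL.2 a ha haT)

theorem last_isAttach_cases (h : IsConfig G S x u v l₁ l₂ R T s t p m)
    (hG : (G.induce {u | u ≠ x}).Connected) :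
    (∃ L, IsAttach G S x l₁ l₂ R T s L) ∨
      ∃ X z Y L, T = X ++ z :: Y ∧ IsAttach G S x l₁ l₂ R T z L ∧ ∀ y ∈ Y, y ∉ R := by
  obtain ⟨X, z, Y, L, hT, hL, hlast⟩ := h.exists_last_isAttach hG
  rcases List.eq_nil_or_concat Y with rfl | ⟨Y, y, rfl⟩
  · obtain ⟨rfl, h1⟩ := List.append_inj' hT rfl
    obtain rfl : s = z := by simpa using h1
    exact Or.inl ⟨L, hL⟩
  · rw [List.concat_eq_append] at *
    have h1 : T ++ [s] = (X ++ z :: Y) ++ [y] := by simpa using hT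
    obtain ⟨h2, -⟩ := List.append_inj' h1 rfl
    exact Or.inr ⟨X, z, Y, L, h2, hL, h.notMem_R_of_last_isAttach h2 hL
      fun y hy => hlast y (by simp [hy])⟩

theorem not_adj_earSet (h : IsConfig G S x u v l₁ l₂ R T s t p m)
    (hG : (G.induce {u | u ≠ x}).Connected) {y : V} (hy : y ∈ earSet S l₁ l₂) (hys : y ≠ s) :
    ¬ G.Adj t y := by
  intro hty
  have hn := h.leg.nodup
  rcases h.last_isAttach_cases hG with ⟨L, hL⟩ | ⟨X, z, Y, L, hT, hL, hY⟩
  · obtain ⟨X, w, Y, hT, hw, hY⟩ := List.exists_append_cons_last (p := fun y => y ∈ R)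
      ⟨t, h.mem_leg, h.head_mem_R⟩
    have h1 := h.isChain_reverse_append hT hty (List.isChain_singleton y)
    have hxw := ((h.mem_R w).1 hw).1
    have h2 : IsLeg G (earSet S l₁ l₂) x (w :: X.reverse) y := by
      refine ⟨?_, ?_, ?_, hy, ?_⟩
      · simp only [hT, List.nodup_append, List.nodup_cons, List.mem_cons,
          List.mem_reverse, List.nodup_reverse] at hn ⊢
        grind only
      · simpa using ⟨hxw, by simpa using h1⟩
      · have := h.leg.notMem
        simp only [hT, List.mem_cons, List.mem_append, List.mem_reverse] at this ⊢
        grind only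
      · intro a ha
        apply h.leg.avoid
        simp only [hT, List.mem_cons, List.mem_append, List.mem_reverse] at ha ⊢
        grind only
    refine h.two_legs_absurd hL h.leg.mem h2 ?_ ?_ hys
    · intro a ha haT
      have := hY a
      simp only [hT, List.mem_cons, List.mem_append, List.mem_reverse] at haT ⊢
      grind only
    · intro a ha
      simp only [hT, List.mem_cons, List.mem_append, List.mem_reverse] at ha ⊢
      grind only
  · have h1 := h.isChain_reverse_append hT hty (List.isChain_singleton y)
    have h2 := h.isLeg_reroute hL (M := X.reverse) (y := y) (by
      simp only [hT, List.nodup_append, List.nodup_cons, List.mem_cons,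
        List.mem_reverse, List.nodup_reverse] at hn ⊢
      grind only) (by
      intro a ha
      simp only [hT, List.mem_cons, List.mem_append, List.mem_reverse] at ha ⊢
      grind only) (by simpa using h1) hy
    refine h.not_forall_mem h2 fun a ha => ?_
    by_cases haT : a ∈ T
    · have := hY a
      simp only [hT, List.mem_cons, List.mem_append, List.mem_reverse] at haT ⊢
      grind only
    · exact List.mem_append_left _ (hL.2 a ha haT)

theorem not_adj_earSet_of_notMem (h : IsConfig G S x u v l₁ l₂ R T s t p m) {r y : V}
    (hr : r ∈ R) (hrT : r ∉ T) (hy : y ∈ earSet S l₁ l₂) (hys : y ≠ s) : ¬ G.Adj r y := by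
  intro hry
  obtain ⟨L, hL⟩ := h.exists_isAttach_of_adj hr hrT (Or.inl hy) hry
  exact (h.mem_or_eq_of_isAttach hL).elim (h.notMem_leg hy) hys

theorem clique_earSet (h : IsConfig G S x u v l₁ l₂ R T s t p m)
    (hG : (G.induce {u | u ≠ x}).Connected) {y y' : V} (hy : y ∈ earSet S l₁ l₂) (hys : y ≠ s)
    (hy' : y' ∈ earSet S l₁ l₂) (hys' : y' ≠ s) (hne : y ≠ y') (hxy : G.Adj x y)
    (hxy' : G.Adj x y') : G.Adj y y' := by
  obtain ⟨r, hr, hrT⟩ := h.exists_notMem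
  have htR := h.head_mem_R
  have h0 := h.star x t r y y' ((h.mem_R t).1 htR).1 ((h.mem_R r).1 hr).1 hxy hxy'
    (by rintro rfl; exact hrT h.mem_leg) (h.ne_of_mem_R htR hy) (h.ne_of_mem_R htR hy')
    (h.ne_of_mem_R hr hy) (h.ne_of_mem_R hr hy') hne
  have h1 := h.not_adj_head hr hrT
  have h2 := h.not_adj_earSet hG hy hys
  have h3 := h.not_adj_earSet hG hy' hys'
  have h4 := h.not_adj_earSet_of_notMem hr hrT hy hys
  have h5 := h.not_adj_earSet_of_notMem hr hrT hy' hys'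
  rw [G.adj_comm] at h1
  tauto

theorem card_le_two_mul (h : IsConfig G S x u v l₁ l₂ R T s t p m)
    (hG : (G.induce {u | u ≠ x}).Connected) : R.card ≤ 2 * T.length := by
  classical
  have key : ∃ T', IsLeg G (earSet S l₁ l₂) x T' s ∧ ∀ r ∈ R, r ∉ T → r ∈ T' := by
    rcases h.last_isAttach_cases hG with ⟨L, hL⟩ | ⟨X, z, Y, L, hT, hL, hY⟩
    · exact ⟨L, hL.isLeg h.leg.mem, hL.2⟩
    · refine ⟨L ++ z :: Y, h.isLeg_reroute hL ?_ ?_ ?_ h.leg.mem,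
        fun r hr hrT => List.mem_append_left _ (hL.2 r hr hrT)⟩
      · have hn := h.leg.nodup
        rw [hT] at hn
        exact (List.nodup_append.1 hn).2.1
      · intro a ha
        rw [hT]
        exact List.mem_append_right _ ha
      · have h1 := h.leg.chain
        rw [hT] at h1
        have h2 : ((x :: X) ++ (z :: Y ++ [s])).IsChain G.Adj := by simpa using h1
        exact h2.right_of_append
  obtain ⟨T', hT', hsub⟩ := key
  have h1 : (R.filter (· ∉ T)).card ≤ (R.filter (· ∈ T')).card := by
    apply Finset.card_le_card
    intro r hr
    rw [Finset.mem_filter] at hr ⊢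
    exact ⟨hr.1, hsub r hr.1 hr.2⟩
  have h2 : (R.filter (· ∈ T')).card ≤ (R.filter (· ∈ T)).card := by
    convert h.best T' s hT'
  have h3 : (R.filter (· ∈ T)).card ≤ T.length := by
    refine (Finset.card_le_card (t := T.toFinset) ?_).trans (List.toFinset_card_le _)
    intro r hr
    simpa using (Finset.mem_filter.1 hr).2
  have h4 := Finset.card_filter_add_card_filter_not (s := R) (· ∈ T)
  omega

theorem end_mem (h : IsConfig G S x u v l₁ l₂ R T s t p m)
    (hG : (G.induce {u | u ≠ x}).Connected) : s ∈ l₁ ∨ s ∈ l₂ := by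
  by_contra! hc
  have hs : s ∈ S := by
    have := h.leg.mem
    simp only [earSet, Set.mem_ofPred_eq] at this
    tauto
  have h1 := h.ear.leg_length_of_mem_base h.leg hs (by rintro rfl; exact hc.1 h.ear.mem_left)
  have h2 := h.symm.ear.leg_length_of_mem_base h.symm.leg hs
    (by rintro rfl; exact hc.2 h.ear.mem_right)
  have h3 := h.card_le_two_mul hG
  have h4 := h.card_le
  simp only [List.length_reverse] at h2
  omega

open Classical in
theorem length_filter_le (h : IsConfig G S x u v l₁ l₂ R T s t p m)
    (hG : (G.induce {u | u ≠ x}).Connected) {X Z : List V} (hl : l₂ = X ++ s :: Z) :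
    (X.filter (G.Adj x ·)).length + T.length + Z.length + 1 ≤ l₂.length := by
  set W := X.filter (G.Adj x ·) with hW
  have hWm : ∀ y, y ∈ W ↔ y ∈ X ∧ G.Adj x y := by simp [hW]
  have hn := h.ear.nodup
  have hWn : W.Nodup := by
    have h1 := hn.2.1
    rw [hl] at h1
    exact (List.nodup_append.1 h1).1.filter _
  obtain ⟨A, hA⟩ := h.eq_left
  have h1 : ([p] ++ W ++ [x]).IsChain G.Adj := by
    apply List.Pairwise.isChain
    have h3 : ∀ y ∈ p :: W, y ∈ earSet S l₁ l₂ ∧ y ≠ s ∧ G.Adj x y := by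
      intro y hy
      rcases List.mem_cons.1 hy with rfl | hy
      · refine ⟨h.left_mem_earSet, ?_, h.adj_left⟩
        rintro rfl
        exact hn.2.2.2.2 _ h.mem_left (by simp [hl])
      · have h4 := (hWm y).1 hy
        refine ⟨Or.inr (Or.inr (by simp [hl, h4.1])), ?_, h4.2⟩
        rintro rfl
        simp only [hl, List.nodup_append, List.mem_cons] at hn
        grind only
    have h4 : (p :: W).Nodup := by
      refine List.nodup_cons.2 ⟨fun h5 => ?_, hWn⟩
      exact hn.2.2.2.2 p h.mem_left (by simp [hl, ((hWm p).1 h5).1])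
    rw [List.singleton_append, List.pairwise_append]
    refine ⟨?_, List.pairwise_singleton _ _, ?_⟩
    · refine List.Pairwise.imp_of_mem (fun ha hb hab => ?_) h4
      have ha := h3 _ ha
      have hb := h3 _ hb
      exact h.clique_earSet hG ha.1 ha.2.1 hb.1 hb.2.1 hab ha.2.2 hb.2.2
    · intro a ha b hb
      rw [List.mem_singleton.1 hb]
      exact (h3 a ha).2.2.symm
  have hc : (l₁ ++ (W ++ x :: T) ++ s :: Z).IsChain G.Adj := by
    have h2 := h.ear.chain.1.left_of_append
    rw [hA] at h2 ⊢
    have h3 : (p :: (W ++ [x])).IsChain G.Adj := by simpa using h1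
    have h4 : ((A ++ p :: W) ++ [x]).IsChain G.Adj := by
      simpa using List.isChain_split.2 ⟨h2, h3⟩
    have h5 : (s :: Z).IsChain G.Adj := by
      have h6 := h.ear.chain.2
      rw [hl] at h6
      exact (List.isChain_cons_split.1 h6).2
    simpa using isChain_overlap h4 h.leg.chain h5
  have hx := h.ear.self_notMem_earSet
  have hav := h.leg.avoid
  have hTn := h.leg.nodup
  have hxT := h.leg.notMem
  have ear := h.ear.isEar_of_prefix_suffix (Y := l₁) (W := []) (M := W ++ x :: T)
    (List.ne_nil_of_mem h.mem_left) (by simp) hl (by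
      simp only [earSet, Set.mem_ofPred_eq, hl, List.mem_cons, List.mem_append, List.nodup_append,
        List.nodup_cons] at hn hx hav ⊢
      grind only) hc (by
      intro y hy
      have h4 := h.ear.eq_right (y := y)
      have h7 : v ∈ s :: Z := by
        have h6 := h.ear.last_right
        rw [hl, List.getLast?_append_of_ne_nil _ (by simp)] at h6
        exact List.mem_of_getLast? h6
      simp only [earSet, Set.mem_ofPred_eq, hl, List.mem_cons, List.mem_append, List.nodup_append,
        List.nodup_cons] at hn hx hav hy h4 h7 ⊢
      grind only)
  have h1 := h.ear.max _ _ _ ear (by simp)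
  simp only [List.length_append, List.length_cons] at h1
  omega

theorem absurd_of_end_mem_right (h : IsConfig G S x u v l₁ l₂ R T s t p m)
    (hG : (G.induce {u | u ≠ x}).Connected) {N : Finset V}
    (hN : ∀ y, y ∈ N ↔ G.Adj x y ∧ y ∉ S) (hcard : 2 * (l₁.length + l₂.length) ≤ N.card + 3)
    (hs : s ∈ l₂) : False := by
  classical
  obtain ⟨X, Z, hl⟩ := List.append_of_mem hs
  have h1 := h.length_filter_le hG hl
  have h2 := h.card_le_two_mul hG
  have h3 := h.ear.leg_length h.leg
  have huv := h.ear.ear.ne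
  have hu := h.ear.ear.left_mem
  have hv := h.ear.ear.right_mem
  have h7 : v ∈ s :: Z := by
    have h6 := h.ear.last_right
    rw [hl, List.getLast?_append_of_ne_nil _ (by simp)] at h6
    exact List.mem_of_getLast? h6
  have h8 : insert u (insert v N) ⊆
      R ∪ (l₁ ++ X.filter (G.Adj x ·) ++ s :: Z).toFinset := by
    intro y hy
    simp only [Finset.mem_insert, Finset.mem_union, List.mem_toFinset, List.mem_append,
      List.mem_filter] at hy ⊢
    rcases hy with rfl | rfl | hy
    · exact Or.inr (Or.inl (Or.inl h.ear.mem_left))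
    · exact Or.inr (Or.inr h7)
    · have h9 := (hN y).1 hy
      by_cases hyR : y ∈ R
      · exact Or.inl hyR
      · have h10 := mt (h.mem_R y).2 hyR
        simp only [earSet, Set.mem_ofPred_eq, hl, List.mem_append] at h10
        have := h9.1
        simp only [this, decide_true]
        tauto
  have h9 := (Finset.card_le_card h8).trans (Finset.card_union_le _ _)
  have h10 := List.toFinset_card_le (l₁ ++ X.filter (G.Adj x ·) ++ s :: Z)
  rw [Finset.card_insert_of_notMem, Finset.card_insert_of_notMem] at h9
  · simp only [hl, List.length_append, List.length_cons] at *
    omega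
  · exact fun h => ((hN v).1 h).2 hv
  · rw [Finset.mem_insert]
    rintro (h | h)
    · exact huv h
    · exact ((hN u).1 h).2 hu

theorem absurd (h : IsConfig G S x u v l₁ l₂ R T s t p m)
    (hG : (G.induce {u | u ≠ x}).Connected) {N : Finset V}
    (hN : ∀ y, y ∈ N ↔ G.Adj x y ∧ y ∉ S) (hcard : 2 * (l₁.length + l₂.length) ≤ N.card + 3) :
    False := by
  rcases h.end_mem hG with hs | hs
  · refine h.symm.absurd_of_end_mem_right hG hN ?_ (by simpa using hs)
    simp only [List.length_reverse]
    omega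
  · exact h.absurd_of_end_mem_right hG hN hcard hs

end IsConfig

/-- A longest ear through a vertex `x` with many neighbours outside `S` cannot exist in a graph
without induced stars. -/
theorem IsMaxEar.absurd [Fintype V] {S : Finset V} {x u v : V} {l₁ l₂ : List V}
    (h : IsMaxEar G S x u v l₁ l₂) (hstar : StarFree G) (hG : (G.induce {u | u ≠ x}).Connected)
    {N : Finset V} (hN : ∀ y, y ∈ N ↔ G.Adj x y ∧ y ∉ S)
    (hcard : 2 * (l₁.length + l₂.length) ≤ N.card + 3) : False := by
  classical
  set R := Finset.univ.filter fun r => G.Adj x r ∧ r ∉ earSet S l₁ l₂ with hR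
  have hmR : ∀ r, r ∈ R ↔ G.Adj x r ∧ r ∉ earSet S l₁ l₂ := by simp [hR]
  have hu := h.mem_left
  have hRcard : l₁.length + l₂.length ≤ R.card + 1 := by
    have h8 : insert u (insert v N) ⊆ R ∪ (l₁ ++ l₂).toFinset := by
      intro y hy
      simp only [Finset.mem_insert, Finset.mem_union, List.mem_toFinset, List.mem_append] at hy ⊢
      rcases hy with rfl | rfl | hy
      · exact Or.inr (Or.inl hu)
      · exact Or.inr (Or.inr h.mem_right)
      · have h9 := (hN y).1 hy
        rw [hmR]
        simp only [earSet, Set.mem_ofPred_eq]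
        tauto
    have h9 := (Finset.card_le_card h8).trans (Finset.card_union_le _ _)
    have h10 := List.toFinset_card_le (l₁ ++ l₂)
    rw [Finset.card_insert_of_notMem, Finset.card_insert_of_notMem] at h9
    · simp only [List.length_append] at h10
      omega
    · exact fun h' => ((hN v).1 h').2 h.ear.right_mem
    · rw [Finset.mem_insert]
      rintro (h' | h')
      · exact h.ear.ne h'
      · exact ((hN u).1 h').2 h.ear.left_mem
  have hl1 := List.length_pos_of_mem hu
  have hl2 := List.length_pos_of_mem h.mem_right
  obtain ⟨p, hp⟩ : ∃ p, l₁.getLast? = some p :=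
    ⟨_, List.getLast?_eq_some_getLast (List.ne_nil_of_mem hu)⟩
  obtain ⟨m, hm⟩ : ∃ m, l₂.head? = some m :=
    ⟨_, List.head?_eq_some_head (List.ne_nil_of_mem h.mem_right)⟩
  obtain ⟨r, hr⟩ : R.Nonempty := Finset.card_pos.1 (by omega)
  have hr' := (hmR r).1 hr
  have hleg : ∃ L s, IsLeg G (earSet S l₁ l₂) x (r :: L) s := by
    have hxu : u ≠ x := by
      rintro rfl
      exact h.notMem h.ear.left_mem
    obtain ⟨L, s, h1, h2, h3, -, h5⟩ := exists_path_to_set hG (F := earSet S l₁ l₂)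
      (Or.inr (Or.inl hu)) hxu hr'.1.ne' hr'.2
    exact ⟨L, s, h1, by simpa using ⟨hr'.1, by simpa using h2⟩, fun hx => (h5 x hx).2 rfl, h3,
      fun y hy => (h5 y hy).1⟩
  obtain ⟨L, s₀, hL⟩ := hleg
  obtain ⟨⟨T, s⟩, hT, hbest⟩ := exists_maximal_of_bounded
    (p := fun q : List V × V => IsLeg G (earSet S l₁ l₂) x q.1 q.2)
    (fun q => (R.filter (· ∈ q.1)).card) R.card
    (fun _ _ => Finset.card_le_card (Finset.filter_subset _ _)) ⟨(r :: L, s₀), hL⟩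
  have hpos : 0 < (R.filter (· ∈ T)).card := by
    refine lt_of_lt_of_le ?_ (hbest (r :: L, s₀) hL)
    exact Finset.card_pos.2 ⟨r, by simp [hr]⟩
  obtain ⟨t, ht⟩ : ∃ t, T.head? = some t := by
    obtain ⟨y, hy⟩ := Finset.card_pos.1 hpos
    exact ⟨_, List.head?_eq_some_head (List.ne_nil_of_mem (Finset.mem_filter.1 hy).2)⟩
  exact IsConfig.absurd (R := R) ⟨h, hstar, hmR, hT, fun T' s' h' => by
    convert hbest (T', s') h', hRcard, ht, hp, hm⟩ hG hN hcard

section Segment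

variable {S : Finset V} {u v x : V} {P₁ P₂ A : List V}

open Classical in
theorem length_suffix_ge (hAn : A.Nodup) (hAc : (u :: A ++ [v]).IsChain G.Adj)
    (hAS : ∀ y ∈ A, y ∈ S) (h₂ : (x :: P₂ ++ [v]).IsChain G.Adj) (hn : (x :: P₂).Nodup)
    (hd : ∀ y ∈ x :: P₂, y ∉ S)
    (hmax : ∀ A' : List V, A'.Nodup → (u :: A' ++ [v]).IsChain G.Adj →
      (∀ y ∈ A', y ∈ A ∨ y ∉ S) → A'.length ≤ A.length) (n : ℕ) :
    ∀ (X Y : List V) (w : V), Y.length = n → A = X ++ w :: Y → G.Adj x w →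
      P₂.length + 1 + 2 * (Y.filter (G.Adj x ·)).length ≤ Y.length := by
  induction n using Nat.strong_induction_on with
  | _ n ih =>
    intro X Y w hYn hA hxw
    have hX : (u :: X ++ [w]).IsChain G.Adj := by
      rw [hA] at hAc
      have h1 : ((u :: X ++ [w]) ++ (Y ++ [v])).IsChain G.Adj := by simpa using hAc
      exact h1.left_of_append
    by_cases hY : ∃ y ∈ Y, G.Adj x y
    · obtain ⟨Y₀, w', Y₁, hYeq, hxw', hY₀⟩ := List.exists_append_cons_first hY
      have h1 := ih Y₁.length (by simp [← hYn, hYeq]; omega) (X ++ w :: Y₀) Y₁ w' rfl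
        (by simp [hA, hYeq]) hxw'
      have hY₁ : (w' :: (Y₁ ++ [v])).IsChain G.Adj := by
        rw [hA, hYeq] at hAc
        have h1 : ((u :: X ++ w :: Y₀) ++ (w' :: (Y₁ ++ [v]))).IsChain G.Adj := by simpa using hAc
        exact h1.right_of_append
      have h2 := hmax (X ++ w :: x :: w' :: Y₁) (by
        have := hd x (by simp)
        simp only [hA, hYeq, List.nodup_append, List.nodup_cons, List.mem_append,
          List.mem_cons] at hAn hAS ⊢
        grind only) (by
        have h3 : (w :: [x] ++ [w']).IsChain G.Adj := by simp [hxw.symm, hxw']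
        simpa using isChain_overlap hX h3 hY₁) (by
        intro y hy
        have := hd x (by simp)
        simp only [hA, hYeq, List.mem_append, List.mem_cons] at hy ⊢
        grind only)
      have h3 : Y₀.filter (G.Adj x ·) = [] := by simpa [List.filter_eq_nil_iff] using hY₀
      simp only [hA, hYeq, List.filter_append, h3, List.filter_cons, hxw', decide_true, if_true,
        List.length_append, List.length_cons, List.nil_append] at h2 ⊢
      omega
    · have h3 : Y.filter (G.Adj x ·) = [] := by
        push Not at hY
        simpa [List.filter_eq_nil_iff] using hY
      have h2 := hmax (X ++ w :: x :: P₂) (by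
        simp only [hA, List.nodup_append, List.nodup_cons, List.mem_append,
          List.mem_cons] at hAn hAS hn hd ⊢
        grind only) (by
        have h3 : (w :: (x :: (P₂ ++ [v]))).IsChain G.Adj := by
          simpa using ⟨hxw.symm, by simpa using h₂⟩
        simpa using List.isChain_split.2 ⟨hX, h3⟩) (by
        intro y hy
        simp only [hA, List.mem_append, List.mem_cons] at hy hd ⊢
        grind only)
      simp only [hA, h3, List.length_append, List.length_cons, List.length_nil] at h2 ⊢
      omega

open Classical in
/-- A segment of a cycle that cannot be replaced by a longer path is long. -/
theorem length_segment_ge (hAn : A.Nodup) (hAc : (u :: A ++ [v]).IsChain G.Adj)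
    (hAS : ∀ y ∈ A, y ∈ S) (h₁ : (u :: P₁ ++ [x]).IsChain G.Adj)
    (h₂ : (x :: P₂ ++ [v]).IsChain G.Adj) (hn : (P₁ ++ x :: P₂).Nodup)
    (hd : ∀ y ∈ P₁ ++ x :: P₂, y ∉ S)
    (hmax : ∀ A' : List V, A'.Nodup → (u :: A' ++ [v]).IsChain G.Adj →
      (∀ y ∈ A', y ∈ A ∨ y ∉ S) → A'.length ≤ A.length) :
    P₁.length + P₂.length + 1 + 2 * (A.filter (G.Adj x ·)).length ≤ A.length := by
  by_cases hY : ∃ y ∈ A, G.Adj x y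
  · obtain ⟨A₀, w, Y, hA, hxw, hA₀⟩ := List.exists_append_cons_first hY
    have h1 := length_suffix_ge hAn hAc hAS h₂ (List.nodup_append.1 hn).2.1
      (fun y hy => hd y (List.mem_append_right _ hy)) hmax Y.length A₀ Y w rfl hA hxw
    have h2 := hmax (P₁ ++ x :: w :: Y) (by
      simp only [hA, List.nodup_append, List.nodup_cons, List.mem_append,
        List.mem_cons] at hAn hAS hn hd ⊢
      grind only) (by
      have h3 : (x :: w :: (Y ++ [v])).IsChain G.Adj := by
        rw [hA] at hAc
        have h4 : ((u :: A₀) ++ (w :: (Y ++ [v]))).IsChain G.Adj := by simpa using hAc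
        simpa using ⟨hxw, h4.right_of_append⟩
      simpa using List.isChain_split.2 ⟨h₁, h3⟩) (by
      intro y hy
      simp only [hA, List.mem_append, List.mem_cons] at hy hd ⊢
      grind only)
    have h3 : A₀.filter (G.Adj x ·) = [] := by simpa [List.filter_eq_nil_iff] using hA₀
    simp only [hA, List.filter_append, h3, List.filter_cons, hxw, decide_true, if_true,
      List.length_append, List.length_cons, List.nil_append] at h2 ⊢
    omega
  · have h3 : A.filter (G.Adj x ·) = [] := by
      push Not at hY
      simpa [List.filter_eq_nil_iff] using hY
    have h2 := hmax (P₁ ++ x :: P₂) hn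
      (by simpa using List.isChain_split.2 ⟨h₁, h₂⟩) (fun y hy => Or.inr (hd y hy))
    simp only [h3, List.length_append, List.length_cons, List.length_nil] at h2 ⊢
    omega

end Segment

theorem exists_walk_of_isChain {l : List V} {a b : V} (h : (a :: l ++ [b]).IsChain G.Adj) :
    ∃ p : G.Walk a b, p.support = a :: l ++ [b] := by
  induction l generalizing a with
  | nil =>
    have hab : G.Adj a b := by simpa using h
    exact ⟨.cons hab .nil, by simp⟩
  | cons c l ih =>
    simp only [List.cons_append, List.isChain_cons_cons] at h ih
    obtain ⟨p, hp⟩ := ih h.2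
    exact ⟨.cons h.1 p, by simp [hp]⟩

theorem exists_isCycle_of_isChain {l : List V} {b : V} (hn : (b :: l).Nodup) (hl : 2 ≤ l.length)
    (h : (b :: l ++ [b]).IsChain G.Adj) :
    ∃ C : G.Walk b b, C.IsCycle ∧ C.length = l.length + 1 := by
  match l, hl with
  | c :: l, hl =>
    simp only [List.cons_append, List.isChain_cons_cons] at h
    obtain ⟨p, hp⟩ := exists_walk_of_isChain h.2
    have hlen : p.length = l.length + 1 := by
      have := p.length_support
      simp [hp] at this
      omega
    have hpath : p.IsPath := by
      rw [Walk.isPath_def, hp]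
      simp only [List.nodup_append, List.nodup_cons, List.mem_cons, List.not_mem_nil,
        List.nodup_nil] at hn ⊢
      grind only
    refine ⟨.cons h.1 p, (Walk.cons_isCycle_iff p h.1).2 ⟨hpath, fun he => ?_⟩, by simp [hlen]⟩
    have := hpath.length_eq_one_of_mem_edges (by rwa [Sym2.eq_swap])
    simp only [List.length_cons] at hl
    omega

theorem exists_cycle_split {a : V} {C : G.Walk a a} (hC : C.IsCycle) {u v : V}
    (hu : u ∈ C.support) (hv : v ∈ C.support) (huv : u ≠ v) :
    ∃ A B : List V, (u :: A ++ v :: B).Nodup ∧ (u :: A ++ [v]).IsChain G.Adj ∧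
      (v :: B ++ [u]).IsChain G.Adj ∧ (∀ y, y ∈ u :: A ++ v :: B ↔ y ∈ C.support) ∧
      A.length + B.length + 2 = C.length := by
  classical
  have hD := hC.rotate hu
  have hrot := C.support_rotate u hu
  have hDm := fun y => C.mem_support_rotate_iff (w := y) u hu
  set D := C.rotate u hu
  have hlen : D.length = C.length := by
    have h1 := hrot.perm.length_eq
    simpa using h1
  obtain ⟨L, hL⟩ : ∃ L, D.support = u :: L ++ [u] := by
    have h1 := D.cons_tail_support
    have h2 : D.support.getLast? = some u := by
      rw [List.getLast?_eq_some_getLast D.support_ne_nil, Walk.getLast_support]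
    have h3 : D.support.tail ≠ [] := List.ne_nil_of_mem (D.end_mem_tail_support hD.not_nil)
    rw [← h1, ← List.singleton_append, List.getLast?_append_of_ne_nil _ h3] at h2
    obtain ⟨L, hL⟩ := List.getLast?_eq_some_iff.1 h2
    exact ⟨L, by rw [← h1, hL]; simp⟩
  have hn := hD.support_nodup
  have hc := D.isChain_adj_support
  have hl := D.length_support
  have hvL : v ∈ L := by
    have := (hDm v).2 hv
    rw [hL] at this
    simpa [huv.symm] using this
  obtain ⟨A, B, rfl⟩ := List.append_of_mem hvL
  rw [hL] at hn hc hl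
  refine ⟨A, B, ?_, ?_, ?_, ?_, ?_⟩
  · simp only [List.cons_append, List.tail_cons, List.nodup_append, List.nodup_cons, List.mem_cons,
      List.mem_append, List.not_mem_nil, List.nodup_nil] at hn ⊢
    grind only
  · have : ((u :: A ++ [v]) ++ (B ++ [u])).IsChain G.Adj := by simpa using hc
    exact this.left_of_append
  · have : ((u :: A) ++ (v :: B ++ [u])).IsChain G.Adj := by simpa using hc
    exact this.right_of_append
  · intro y
    rw [← hDm, hL]
    simp only [List.cons_append, List.mem_cons, List.mem_append, List.not_mem_nil]
    tauto
  · simp only [List.length_append, List.length_cons, List.length_nil] at hl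
    omega

section Count

variable {S : Finset V} {x u v : V} {l₁ l₂ : List V}

theorem IsMaxEar.exists_left (h : IsMaxEar G S x u v l₁ l₂) : ∃ P, l₁ = u :: P :=
  List.head?_eq_some_iff.1 h.head_left

theorem IsMaxEar.exists_right (h : IsMaxEar G S x u v l₁ l₂) : ∃ P, l₂ = P ++ [v] :=
  List.getLast?_eq_some_iff.1 h.last_right

open Classical in
theorem IsMaxEar.length_segment_ge (h : IsMaxEar G S x u v l₁ l₂) {A : List V} (hAn : A.Nodup)
    (hAc : (u :: A ++ [v]).IsChain G.Adj) (hAS : ∀ y ∈ A, y ∈ S)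
    (hmax : ∀ A' : List V, A'.Nodup → (u :: A' ++ [v]).IsChain G.Adj →
      (∀ y ∈ A', y ∈ A ∨ y ∉ S) → A'.length ≤ A.length) :
    l₁.length + l₂.length + 2 * (A.filter (G.Adj x ·)).length ≤ A.length + 1 := by
  obtain ⟨P₁, h1⟩ := h.exists_left
  obtain ⟨P₂, h2⟩ := h.exists_right
  have hn := h.nodup
  have hc := h.chain
  have hx := h.notMem
  have hL := fun y => h.eq_left (y := y)
  have hR := fun y => h.eq_right (y := y)
  have := _root_.length_segment_ge (P₁ := P₁) (P₂ := P₂) (x := x) hAn hAc hAS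
    (by simpa [h1] using hc.1) (by simpa [h2] using hc.2) (by
      simp only [h1, h2, List.nodup_append, List.nodup_cons, List.mem_cons, List.mem_append,
        List.not_mem_nil, List.nodup_nil] at hn ⊢
      grind only) (by
      intro y hy
      have := hL y
      have := hR y
      simp only [h1, h2, List.nodup_append, List.nodup_cons, List.mem_cons, List.mem_append,
        List.not_mem_nil, List.nodup_nil] at *
      grind only) hmax
  simp only [h1, h2, List.length_append, List.length_cons, List.length_nil]
  omega

theorem IsMaxEar.card_bound [Fintype V] (h : IsMaxEar G S x u v l₁ l₂) {a : V} {C : G.Walk a a}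
    (hC : C.IsCycle) (hlong : ∀ (b : V) (C' : G.Walk b b), C'.IsCycle → C'.length ≤ C.length)
    (hS : ∀ y, y ∈ S ↔ y ∈ C.support) {N D : Finset V} (hN : ∀ y, y ∈ N ↔ G.Adj x y ∧ y ∉ S)
    (hD : ∀ y, y ∈ D ↔ G.Adj x y) (hdeg : Fintype.card V ≤ 2 * D.card) :
    2 * (l₁.length + l₂.length) ≤ N.card + 3 := by
  classical
  obtain ⟨A, B, hn, hA, hB, hm, hl⟩ := exists_cycle_split hC ((hS u).1 h.ear.left_mem)
    ((hS v).1 h.ear.right_mem) h.ear.ne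
  have hm' : ∀ y, y ∈ S ↔ y ∈ u :: A ++ v :: B := fun y => by rw [hS, hm]
  have hn' := hn
  simp only [List.nodup_append, List.nodup_cons, List.mem_cons] at hn
  simp only [List.mem_cons, List.mem_append] at hm'
  have hcyc : ∀ (b : V) (l : List V), (b :: l).Nodup → 2 ≤ l.length →
      (b :: l ++ [b]).IsChain G.Adj → l.length + 1 ≤ C.length := by
    intro b l h1 h2 h3
    obtain ⟨C', hC', hlen⟩ := exists_isCycle_of_isChain h1 h2 h3
    exact hlen ▸ hlong b C' hC'
  have key : ∀ (u v : V) (A B : List V), (v :: B ++ [u]).IsChain G.Adj →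
      (u :: A ++ v :: B).Nodup → (∀ y, y ∈ S ↔ y ∈ u :: A ++ v :: B) →
      A.length + B.length + 2 = C.length →
      ∀ A' : List V, A'.Nodup → (u :: A' ++ [v]).IsChain G.Adj →
      (∀ y ∈ A', y ∈ A ∨ y ∉ S) → A'.length ≤ A.length := by
    intro u v A B hB hn hm hl A' h1 h2 h3
    rcases A'.eq_nil_or_concat with rfl | ⟨A₀, y, hA₀⟩
    · simp
    · have h4 := hcyc u (A' ++ v :: B) (by
        simp only [List.nodup_append, List.nodup_cons, List.mem_cons, List.mem_append] at *
        grind only) (by simp [hA₀]; omega) (by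
        have h5 : (v :: (B ++ [u])).IsChain G.Adj := by simpa using hB
        simpa using List.isChain_split.2 ⟨h2, h5⟩)
      simp only [List.length_append, List.length_cons] at h4
      omega
  have hmaxA := key u v A B hB hn' (by simpa [or_assoc] using hm') hl
  have hmaxB := key v u B A hA (by
    simp only [List.nodup_append, List.nodup_cons, List.mem_cons]
    grind only) (by
    intro y
    simp only [hm', List.mem_cons, List.mem_append]
    tauto) (by omega)
  have h1 := h.length_segment_ge (A := A) (by tauto) hA (fun y hy => by simp [hm', hy]) hmaxA
  have h2 := h.symm.length_segment_ge (A := B) (by tauto) hB (fun y hy => by simp [hm', hy]) hmaxB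
  simp only [List.length_reverse] at h2
  have hScard : S.card = A.length + B.length + 2 := by
    have h3 : S = (u :: A ++ v :: B).toFinset := by
      ext y
      rw [List.mem_toFinset]
      simpa [or_assoc] using hm' y
    rw [h3, List.toFinset_card_of_nodup hn']
    simp
    omega
  have h3 : (insert x (S ∪ N)).card ≤ Fintype.card V := Finset.card_le_univ _
  have hdisj : Disjoint S N := Finset.disjoint_left.2 fun y hy hy' => ((hN y).1 hy').2 hy
  rw [Finset.card_insert_of_notMem, Finset.card_union_of_disjoint hdisj] at h3
  · have h4 : D ⊆ N ∪ insert u (insert v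
        ((A.filter (G.Adj x ·)).toFinset ∪ (B.filter (G.Adj x ·)).toFinset)) := by
      intro y hy
      have hxy := (hD y).1 hy
      simp only [Finset.mem_union, Finset.mem_insert, hN, hm', List.mem_toFinset, List.mem_filter,
        hxy, decide_true]
      tauto
    have h5 := (Finset.card_le_card h4).trans (Finset.card_union_le _ _)
    have h6 := Finset.card_insert_le u (insert v
        ((A.filter (G.Adj x ·)).toFinset ∪ (B.filter (G.Adj x ·)).toFinset))
    have h7 := Finset.card_insert_le v
        ((A.filter (G.Adj x ·)).toFinset ∪ (B.filter (G.Adj x ·)).toFinset)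
    have h8 := Finset.card_union_le (A.filter (G.Adj x ·)).toFinset
      (B.filter (G.Adj x ·)).toFinset
    have h9 := List.toFinset_card_le (A.filter (G.Adj x ·))
    have h10 := List.toFinset_card_le (B.filter (G.Adj x ·))
    omega
  · rw [Finset.mem_union]
    rintro (h4 | h4)
    · exact h.notMem h4
    · exact G.loopless.irrefl x ((hN x).1 h4).1

end Count

theorem starFree_of_not_exists (h : ¬ ∃ (c : V) (l : Fin 4 → V), Function.Injective l ∧
    (∀ i, G.Adj c (l i)) ∧ (∀ i j, i ≠ j → ¬ G.Adj (l i) (l j))) : StarFree G := by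
  intro c a b d e ha hb hd he hab had hae hbd hbe hde
  by_contra! hc
  obtain ⟨h1, h2, h3, h4, h5, h6⟩ := hc
  refine h ⟨c, ![a, b, d, e], ?_, ?_, ?_⟩
  · intro i j hij
    fin_cases i <;> fin_cases j <;> simp_all
  · intro i
    fin_cases i <;> assumption
  · intro i j hij
    fin_cases i <;> fin_cases j <;> simp_all [G.adj_comm]

theorem exists_isMaxEar [Fintype V] {S : Finset V} {x u v : V} {L : List V}
    (hL : IsEar G S u v L) (hx : x ∈ L) (hxS : x ∉ S) :
    ∃ u v l₁ l₂, IsMaxEar G S x u v l₁ l₂ := by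
  obtain ⟨⟨u, v, L⟩, ⟨hL, hx⟩, hmax⟩ := exists_maximal_of_bounded
    (p := fun q : V × V × List V => IsEar G S q.1 q.2.1 q.2.2 ∧ x ∈ q.2.2)
    (fun q => q.2.2.length) (Fintype.card V) (fun q hq => hq.1.nodup.length_le_card)
    ⟨(u, v, L), hL, hx⟩
  obtain ⟨l₁, l₂, rfl⟩ := List.append_of_mem hx
  refine ⟨u, v, l₁, l₂, hL, hxS, fun u' v' L' h h' => ?_⟩
  have := hmax (u', v', L') ⟨h, h'⟩
  simp only [List.length_append, List.length_cons] at this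
  omega

theorem TwoConnected.reachable [Fintype V] (hG : TwoConnected G) (a b : V) :
    G.Reachable a b := by
  classical
  obtain ⟨w, hw⟩ : ∃ w, w ∉ ({a, b} : Finset V) := by
    by_contra! h
    have h1 : (Finset.univ : Finset V) ⊆ {a, b} := fun y _ => h y
    have h2 := (Finset.card_le_card h1).trans Finset.card_le_two
    have h3 := hG.1
    rw [Finset.card_univ] at h2
    omega
  simp only [Finset.mem_insert, Finset.mem_singleton, not_or] at hw
  have h := (hG.2 w).preconnected ⟨a, fun h => hw.1 h.symm⟩ ⟨b, fun h => hw.2 h.symm⟩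
  exact h.map (Embedding.induce _).toHom

end

theorem stmt_7 {V : Type*} [Fintype V] [DecidableEq V] (G : SimpleGraph V)
    [DecidableRel G.Adj] (hG : TwoConnected G)
    (hfree : ¬ ∃ (c : V) (l : Fin 4 → V), Function.Injective l ∧
      (∀ i, G.Adj c (l i)) ∧ (∀ i j, i ≠ j → ¬ G.Adj (l i) (l j)))
    (a : V) (C : G.Walk a a) (hC : C.IsCycle)
    (hlong : ∀ (b : V) (C' : G.Walk b b), C'.IsCycle → C'.length ≤ C.length) :
    ∀ v : V, Fintype.card V ≤ 2 * G.degree v → v ∈ C.support := by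
  intro x hdeg
  by_contra hx
  set S := C.support.toFinset with hS
  have hmS : ∀ y, y ∈ S ↔ y ∈ C.support := by simp [hS]
  have hxS : x ∉ S := by rwa [hmS]
  have ha : a ∈ S := by simp [hmS]
  have hb : C.snd ∈ S := (hmS _).2 (C.getVert_mem_support 1)
  have hab : a ≠ C.snd := (C.adj_snd hC.not_nil).ne
  obtain ⟨u, v, L, hL, hxL⟩ := exists_isEar hG.2 ha hb hab hxS (hG.reachable a x)
  obtain ⟨u, v, l₁, l₂, h⟩ := exists_isMaxEar hL hxL hxS
  have hN : ∀ y, y ∈ (G.neighborFinset x).filter (· ∉ S) ↔ G.Adj x y ∧ y ∉ S := by simp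
  exact h.absurd (starFree_of_not_exists hfree) (hG.2 x) hN
    (h.card_bound hC hlong hmS hN (D := G.neighborFinset x) (by simp) (by simpa using hdeg))
end
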